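/- arXiv:math/0012169 — 4 statements merged into one kernel-verified Lean document; each statement's English description precedes it below -/
import Mathlib

section
/- A lattice tetrahedron in R^3 has volume 1/6 if and only if for each vertex v, the vertex lies in the lattice plane consecutive to the lattice plane spanned by the opposite facet. -/
open Set MeasureTheory
open scoped ENNReal

noncomputable section

abbrev Pt3 := Fin 3 → ℝ

/-- The corner simplex of size `t`. -/
def cornerSimplex (n : ℕ) (t : ℝ) : Set (Fin n → ℝ) :=
  {x | (∀ i, 0 ≤ x i) ∧ ∑ i, x i ≤ t}

lemma isClosed_cornerSimplex (n : ℕ) (t : ℝ) : IsClosed (cornerSimplex n t) := by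
  have : cornerSimplex n t = (⋂ i, {x | 0 ≤ x i}) ∩ {x | ∑ i, x i ≤ t} := by
    ext x; simp [cornerSimplex]
  rw [this]
  refine IsClosed.inter (isClosed_iInter fun i => ?_) ?_
  · exact isClosed_le continuous_const (continuous_apply i)
  · exact isClosed_le (by fun_prop) continuous_const

lemma volume_cornerSimplex (n : ℕ) : ∀ t : ℝ, 0 ≤ t →
    volume (cornerSimplex n t) = ENNReal.ofReal (t ^ n / n.factorial) := by
  induction n with
  | zero =>
    intro t ht
    have : cornerSimplex 0 t = univ := by
      ext x; simp [cornerSimplex, ht]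
    rw [this]
    simp [volume_pi]
  | succ n ih =>
    intro t ht
    have hmp := (volume_preserving_piFinSuccAbove (fun _ : Fin (n + 1) => ℝ) 0).symm
    rw [← hmp.measure_preimage
      (isClosed_cornerSimplex _ t).measurableSet.nullMeasurableSet]
    rw [Measure.volume_eq_prod, Measure.prod_apply
      (hmp.measurable (isClosed_cornerSimplex _ t).measurableSet)]
    have key : ∀ x : ℝ, volume (Prod.mk x ⁻¹'
        ((MeasurableEquiv.piFinSuccAbove (fun _ : Fin (n + 1) => ℝ) 0).symm ⁻¹'
          cornerSimplex (n + 1) t)) =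
        (Icc 0 t).indicator (fun x => ENNReal.ofReal ((t - x) ^ n / n.factorial)) x := by
      intro x
      by_cases hx : x ∈ Icc 0 t
      · rw [indicator_of_mem hx, ← ih (t - x) (by linarith [hx.2])]
        congr 1
        ext y
        simp only [cornerSimplex, mem_preimage, mem_ofPred_eq, Fin.forall_fin_succ,
          Fin.sum_univ_succ, MeasurableEquiv.piFinSuccAbove_symm_apply,
          Fin.insertNthEquiv_apply, Fin.insertNth_zero', Fin.cons_zero, Fin.cons_succ]
        constructor
        · rintro ⟨⟨_, h⟩, h'⟩
          exact ⟨h, by linarith⟩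
        · rintro ⟨h, h'⟩
          exact ⟨⟨hx.1, h⟩, by linarith⟩
      · rw [indicator_of_notMem hx]
        convert measure_empty (μ := (volume : Measure (Fin n → ℝ)))
        ext y
        simp only [cornerSimplex, mem_preimage, mem_ofPred_eq, Fin.forall_fin_succ,
          Fin.sum_univ_succ, MeasurableEquiv.piFinSuccAbove_symm_apply,
          Fin.insertNthEquiv_apply, Fin.insertNth_zero', Fin.cons_zero, Fin.cons_succ,
          mem_empty_iff_false, iff_false]
        rintro ⟨⟨h0, h⟩, h'⟩
        have := Finset.sum_nonneg fun i (_ : i ∈ Finset.univ) => h i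
        exact hx ⟨h0, by linarith⟩
    simp_rw [key]
    rw [lintegral_indicator measurableSet_Icc,
      ← ofReal_integral_eq_lintegral_ofReal]
    · congr 1
      rw [integral_Icc_eq_integral_Ioc, ← intervalIntegral.integral_of_le ht]
      rw [intervalIntegral.integral_comp_sub_left (fun x => x ^ n / (n.factorial : ℝ))]
      rw [intervalIntegral.integral_div, integral_pow, Nat.factorial_succ]
      push_cast
      simp
      field_simp
    · exact (Continuous.continuousOn (by fun_prop)).integrableOn_Icc
    · refine (ae_restrict_iff' measurableSet_Icc).2 (Filter.Eventually.of_forall fun x hx => ?_)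
      have : 0 ≤ t - x := by linarith [hx.2]
      positivity

/-- Edge matrix of a tetrahedron. -/
def edgeMat {R : Type*} [Sub R] (v : Fin 4 → Fin 3 → R) : Matrix (Fin 3) (Fin 3) R :=
  Matrix.of fun j k => v k.succ j - v 0 j

lemma hull_eq (f : Fin 4 → Pt3) : convexHull ℝ (range f) =
    (fun x => f 0 + x) '' (Matrix.toLin' (edgeMat f) '' cornerSimplex 3 1) := by
  have h1 : convexHull ℝ (range f) =
      (Fintype.linearCombination ℝ f) '' stdSimplex ℝ (Fin 4) := by
    rw [← convexHull_rangle_single_eq_stdSimplex, LinearMap.image_convexHull, ← range_comp]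
    congr 2
    ext i
    simp [Fintype.linearCombination_apply_single]
  rw [h1]
  ext y
  constructor
  · rintro ⟨w, ⟨hw0, hw1⟩, rfl⟩
    refine ⟨_, ⟨fun k => w k.succ, ⟨fun i => hw0 _, ?_⟩, rfl⟩, ?_⟩
    · rw [Fin.sum_univ_succ] at hw1
      linarith [hw0 0]
    · ext j
      rw [Fin.sum_univ_succ] at hw1
      have : w 0 = 1 - ∑ i : Fin 3, w i.succ := by linarith
      simp [Fintype.linearCombination_apply, Matrix.mulVec, dotProduct, edgeMat,
        Fin.sum_univ_succ, this]
      ring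
  · rintro ⟨_, ⟨x, ⟨hx0, hx1⟩, rfl⟩, rfl⟩
    refine ⟨Fin.cons (1 - ∑ i, x i) x, ⟨?_, ?_⟩, ?_⟩
    · intro i
      refine Fin.cases ?_ (fun i => ?_) i
      · simpa using hx1
      · simpa using hx0 i
    · simp [Fin.sum_univ_succ]
    · ext j
      simp [Fintype.linearCombination_apply, Matrix.mulVec, dotProduct, edgeMat,
        Fin.sum_univ_succ]
      ring

lemma volume_hull (f : Fin 4 → Pt3) : volume (convexHull ℝ (range f)) =
    ENNReal.ofReal (|(edgeMat f).det| / 6) := by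
  rw [hull_eq, image_add_left, measure_preimage_add, Measure.addHaar_image_linearMap,
    LinearMap.det_toLin', volume_cornerSimplex 3 1 zero_le_one,
    ← ENNReal.ofReal_mul (abs_nonneg _)]
  congr 1
  norm_num [Nat.factorial]
  ring

lemma volume_iff (v : Fin 4 → Fin 3 → ℤ) :
    volume (convexHull ℝ (Set.range (fun i => (fun j => (v i j : ℝ)) : Fin 4 → Pt3)))
        = (6 : ℝ≥0∞)⁻¹ ↔ IsUnit (edgeMat v).det := by
  rw [volume_hull]
  have h : edgeMat (fun i => (fun j => (v i j : ℝ)) : Fin 4 → Pt3) =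
      (edgeMat v).map (Int.castRingHom ℝ) := by
    ext i j; simp [edgeMat]
  have h2 : ((edgeMat v).map (Int.castRingHom ℝ)).det = ((edgeMat v).det : ℝ) :=
    (RingHom.map_det (Int.castRingHom ℝ) (edgeMat v)).symm
  have h6 : (6 : ℝ≥0∞)⁻¹ = ENNReal.ofReal (1 / 6) := by
    rw [one_div, ENNReal.ofReal_inv_of_pos (by norm_num)]
    norm_num
  rw [h, h2, h6, ENNReal.ofReal_eq_ofReal_iff (by positivity) (by norm_num),
    Int.isUnit_iff_abs_eq, div_left_inj' (by norm_num)]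
  exact_mod_cast Iff.rfl

lemma gcd_aux (a x y : Fin 3 → ℤ) (h : IsUnit (∑ j, a j * x j - ∑ j, a j * y j)) :
    Int.gcd (Int.gcd (a 0) (a 1)) (a 2) = 1 := by
  set g := Int.gcd (Int.gcd (a 0) (a 1)) (a 2) with hg
  have h2 : (g : ℤ) ∣ a 2 := Int.gcd_dvd_right ..
  have h01 : (g : ℤ) ∣ (Int.gcd (a 0) (a 1) : ℤ) := Int.gcd_dvd_left ..
  have h0 : (g : ℤ) ∣ a 0 := h01.trans (Int.gcd_dvd_left ..)
  have h1 : (g : ℤ) ∣ a 1 := h01.trans (Int.gcd_dvd_right ..)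
  have hd : (g : ℤ) ∣ ∑ j, a j * x j - ∑ j, a j * y j := by
    simp only [Fin.sum_univ_three]
    exact dvd_sub
      (dvd_add (dvd_add (h0.mul_right _) (h1.mul_right _)) (h2.mul_right _))
      (dvd_add (dvd_add (h0.mul_right _) (h1.mul_right _)) (h2.mul_right _))
  have := isUnit_of_dvd_unit hd h
  simpa [Int.isUnit_iff_natAbs_eq] using this

/-- A lattice tetrahedron in `ℝ³` has volume `1/6` if and only if
for each vertex `v`, the vertex lies in the lattice plane consecutive to the
lattice plane spanned by the opposite facet.  Here two parallel lattice planes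
`a·x = d` and `a·x = d - 1` (with `gcd(a₀,a₁,a₂) = 1`) are consecutive. -/
theorem unimodular_iff_consecutive_planes
    (v : Fin 4 → Fin 3 → ℤ)
    (hind : AffineIndependent ℝ (fun i => (fun j => (v i j : ℝ)) : Fin 4 → Pt3)) :
    volume (convexHull ℝ (Set.range (fun i => (fun j => (v i j : ℝ)) : Fin 4 → Pt3)))
        = (6 : ℝ≥0∞)⁻¹ ↔
      ∀ i : Fin 4, ∃ (a : Fin 3 → ℤ) (d : ℤ),
        Int.gcd (Int.gcd (a 0) (a 1)) (a 2) = 1 ∧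
        (∀ k : Fin 4, k ≠ i → ∑ j, a j * v k j = d) ∧
        (∑ j, a j * v i j = d - 1 ∨ ∑ j, a j * v i j = d + 1) := by
  rw [volume_iff]
  constructor
  · intro hu
    set B := (edgeMat v)⁻¹ with hB
    have hBN : B * edgeMat v = 1 := Matrix.nonsing_inv_mul _ hu
    have key : ∀ k l : Fin 3, ∑ j, B k j * v l.succ j =
        ∑ j, B k j * v 0 j + if k = l then 1 else 0 := by
      intro k l
      have := congrFun (congrFun hBN k) l
      simp only [Matrix.mul_apply, edgeMat, Matrix.of_apply, Matrix.one_apply, mul_sub,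
        Finset.sum_sub_distrib] at this
      linarith
    intro i
    refine Fin.cases ?_ (fun k => ?_) i
    · have h0 : ∀ l : Fin 3, ∑ j, (∑ k, B k j) * v l.succ j =
          ∑ j, (∑ k, B k j) * v 0 j + 1 := by
        intro l
        simp only [Finset.sum_mul]
        rw [Finset.sum_comm, Finset.sum_comm (f := fun j k => B k j * v 0 j)]
        simp only [key, Finset.sum_add_distrib]
        simp
      refine ⟨fun j => ∑ k, B k j, ∑ j, (∑ k, B k j) * v 0 j + 1, ?_, ?_, ?_⟩
      · apply gcd_aux (fun j => ∑ k, B k j) (v (Fin.succ 0)) (v 0)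
        rw [h0]; simp
      · intro l hl
        obtain ⟨l, rfl⟩ := Fin.exists_succ_eq.2 hl
        exact h0 l
      · left; simp
    · refine ⟨B k, ∑ j, B k j * v 0 j, ?_, ?_, ?_⟩
      · apply gcd_aux (B k) (v k.succ) (v 0)
        rw [key]; simp
      · intro l
        refine Fin.cases ?_ (fun l => ?_) l
        · intro _; rfl
        · intro hl
          have : k ≠ l := by rintro rfl; exact hl rfl
          rw [key]; simp [this]
      · right; rw [key]; simp
  · intro h
    choose a d _ h2 h3 using h
    let A : Matrix (Fin 3) (Fin 3) ℤ := Matrix.of fun i j => a i.succ j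
    have hAN : A * edgeMat v =
        Matrix.diagonal fun i : Fin 3 => ∑ j, a i.succ j * v i.succ j - d i.succ := by
      ext i k
      have h0 := h2 i.succ 0 (Fin.succ_ne_zero i).symm
      simp only [A, Matrix.mul_apply, edgeMat, Matrix.of_apply, mul_sub,
        Finset.sum_sub_distrib, h0, Matrix.diagonal_apply]
      split_ifs with hik
      · rw [hik]
      · rw [h2 i.succ k.succ (fun e => hik (Fin.succ_injective _ e).symm), sub_self]
    have hdet := congrArg Matrix.det hAN
    rw [Matrix.det_mul, Matrix.det_diagonal] at hdet
    refine isUnit_of_dvd_unit (Dvd.intro_left _ hdet) ?_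
    rw [IsUnit.prod_univ_iff]
    intro i
    rw [Int.isUnit_iff]
    rcases h3 i.succ with h | h
    · right; linarith
    · left; linarith
end
end

section
/- The polytope P = conv{(0,0,0),(1,0,0),(0,1,0),(1,1,0),(-1,0,1),(1,1,1),(0,1,-1),(2,0,-1)} has a dissection into 12 unimodular tetrahedra (each of volume 1/6) using only the vertices of P. -/
open Set MeasureTheory
open scoped Classical

noncomputable section

/-- A (geometric) tetrahedron: 4 affinely independent points. -/
def IsTet (σ : Finset Pt3) : Prop :=
  σ.card = 4 ∧ AffineIndependent ℝ (fun p : (σ : Set Pt3) => (p : Pt3))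

/-- A dissection of the convex polytope `conv V` using only vertices in `V`:
tetrahedra with pairwise disjoint interiors covering the polytope. -/
def IsDissection (V : Finset Pt3) (D : Finset (Finset Pt3)) : Prop :=
  (∀ σ ∈ D, IsTet σ ∧ (σ : Set Pt3) ⊆ (V : Set Pt3)) ∧
  (∀ σ ∈ D, ∀ τ ∈ D, σ ≠ τ →
    interior (convexHull ℝ (σ : Set Pt3)) ∩ interior (convexHull ℝ (τ : Set Pt3)) = ∅) ∧
  (⋃ σ ∈ D, convexHull ℝ (σ : Set Pt3)) = convexHull ℝ (V : Set Pt3)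

/-- A triangulation: a dissection in which any two tetrahedra meet in a common
(possibly empty) face. -/
def IsTriangulation (V : Finset Pt3) (D : Finset (Finset Pt3)) : Prop :=
  IsDissection V D ∧
  ∀ σ ∈ D, ∀ τ ∈ D,
    convexHull ℝ (σ : Set Pt3) ∩ convexHull ℝ (τ : Set Pt3)
      = convexHull ℝ ((σ ∩ τ : Finset Pt3) : Set Pt3)

/-- The eight vertices `s, e, w, n, v₁, v₂, u₁, u₂` of the polytope `P` of
Proposition 2.2(1). -/
def Pverts : Finset Pt3 :=
  {![0, 0, 0], ![1, 0, 0], ![0, 1, 0], ![1, 1, 0],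
   ![-1, 0, 1], ![1, 1, 1], ![0, 1, -1], ![2, 0, -1]}

open scoped ENNReal

/-- The vertices of `P`, with integer coordinates. -/
def tv : Fin 8 → Fin 3 → ℤ :=
  ![![0, 0, 0], ![1, 0, 0], ![0, 1, 0], ![1, 1, 0],
    ![-1, 0, 1], ![1, 1, 1], ![0, 1, -1], ![2, 0, -1]]

/-- The twelve tetrahedra. -/
def tt : Fin 12 → Fin 4 → Fin 8 :=
  ![![0, 1, 2, 6],
   ![0, 1, 3, 5],
   ![0, 1, 4, 5],
   ![0, 1, 6, 7],
   ![0, 2, 3, 4],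
   ![0, 2, 4, 6],
   ![0, 3, 4, 5],
   ![1, 2, 3, 7],
   ![1, 2, 6, 7],
   ![1, 3, 5, 7],
   ![2, 3, 4, 5],
   ![2, 3, 6, 7]]

/-- Barycentric coordinates of the twelve tetrahedra, as integer affine forms. -/
def tb : Fin 12 → Fin 4 → Fin 4 → ℤ :=
  ![![![-1, -1, 0, 1], ![1, 0, 0, 0], ![0, 1, 1, 0], ![0, 0, -1, 0]],
   ![![-1, 0, 0, 1], ![1, -1, 0, 0], ![0, 1, -1, 0], ![0, 0, 1, 0]],
   ![![-1, 2, -2, 1], ![1, -2, 1, 0], ![0, -1, 1, 0], ![0, 1, 0, 0]],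
   ![![-1, -2, -1, 1], ![1, 2, 2, 0], ![0, 1, 0, 0], ![0, -1, -1, 0]],
   ![![0, -1, -1, 1], ![-1, 1, -1, 0], ![1, 0, 1, 0], ![0, 0, 1, 0]],
   ![![1, -1, 0, 1], ![1, 1, 1, 0], ![-1, 0, 0, 0], ![-1, 0, -1, 0]],
   ![![1, -2, 0, 1], ![-1, 2, -1, 0], ![-1, 1, 0, 0], ![1, -1, 1, 0]],
   ![![0, -1, 1, 1], ![-1, 0, -1, 1], ![1, 1, 1, -1], ![0, 0, -1, 0]],
   ![![-1, -2, 0, 2], ![1, 2, 1, -1], ![-1, -1, -1, 1], ![1, 1, 0, -1]],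
   ![![-1, -1, 0, 2], ![-1, 1, -1, 1], ![1, 0, 1, -1], ![1, 0, 0, -1]],
   ![![-1, 2, 0, -1], ![1, -2, -1, 2], ![0, -1, 0, 1], ![0, 1, 1, -1]],
   ![![-1, -2, 1, 3], ![1, 2, 0, -2], ![0, 1, -1, -1], ![0, -1, 0, 1]]]

/-- Separating planes. -/
def tsep : List (Fin 4 → ℤ) :=
  [![0, 0, 1, 0], ![1, 1, 0, -1], ![1, -1, 0, 0], ![1, 0, 1, -1], ![1, 0, 1, 0], ![1, -2, 1, 0], ![1, 2, 1, -1], ![-1, 0, 0, 0], ![-1, 0, 0, 1], ![0, 1, 1, -1], ![0, 1, 1, 0], ![0, 1, -1, -1], ![0, 1, -1, 0], ![1, -1, 1, 0], ![-1, -2, 0, 2], ![1, -2, 0, 1], ![1, 1, 1, -1]]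

/-- Facets of `P`. -/
def tfac : List (Fin 4 → ℤ) :=
  [![1, 2, 2, 0], ![1, 1, 1, 0], ![1, -1, 0, 1], ![1, -2, -1, 2], ![0, 1, 0, 0], ![0, -1, 0, 1], ![-1, 2, -2, 1], ![-1, 1, -1, 1], ![-1, -1, 0, 2], ![-1, -2, 1, 3]]

def affZ (h : Fin 4 → ℤ) (x : Fin 3 → ℤ) : ℤ := h 0 * x 0 + h 1 * x 1 + h 2 * x 2 + h 3

def aff (h : Fin 4 → ℤ) (x : Pt3) : ℝ :=
  (h 0 : ℝ) * x 0 + (h 1 : ℝ) * x 1 + (h 2 : ℝ) * x 2 + (h 3 : ℝ)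

def pt (a : Fin 8) : Pt3 := fun j => (tv a j : ℝ)

def tetSet (i : Fin 12) : Finset Pt3 := Finset.univ.image (fun k => pt (tt i k))

lemma aff_pt (h : Fin 4 → ℤ) (a : Fin 8) : aff h (pt a) = ((affZ h (tv a) : ℤ) : ℝ) := by
  simp [aff, affZ, pt]

lemma aff_delta : ∀ i : Fin 12, ∀ k l : Fin 4,
    affZ (tb i k) (tv (tt i l)) = if k = l then 1 else 0 := by
  decide +kernel

lemma tb_sum : ∀ i : Fin 12, ∀ j : Fin 4,
    tb i 0 j + tb i 1 j + tb i 2 j + tb i 3 j = if j = 3 then 1 else 0 := by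
  decide +kernel

lemma tb_recon : ∀ i : Fin 12, ∀ j : Fin 4, ∀ m : Fin 3,
    tb i 0 j * tv (tt i 0) m + tb i 1 j * tv (tt i 1) m + tb i 2 j * tv (tt i 2) m
      + tb i 3 j * tv (tt i 3) m = if j = m.castSucc then 1 else 0 := by
  decide +kernel

lemma tsep_spec : ∀ i j : Fin 12, i ≠ j → ∃ h ∈ tsep,
    0 < h 0 * h 0 + h 1 * h 1 + h 2 * h 2 ∧
    (((∀ k, affZ h (tv (tt i k)) ≤ 0) ∧ (∀ k, 0 ≤ affZ h (tv (tt j k)))) ∨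
     ((∀ k, affZ h (tv (tt j k)) ≤ 0) ∧ (∀ k, 0 ≤ affZ h (tv (tt i k))))) := by
  decide +kernel

lemma tfac_spec : ∀ h ∈ tfac, ∀ a : Fin 8, 0 ≤ affZ h (tv a) := by
  decide +kernel

lemma tt_ne : ∀ i j : Fin 12, i ≠ j → ∃ k, ∀ l, tv (tt i k) ≠ tv (tt j l) := by
  decide +kernel

lemma pt_inj {a b : Fin 8} (h : pt a = pt b) : tv a = tv b := by
  funext j
  have := congrFun h j
  simpa [pt] using this

lemma Pverts_eq : Pverts = Finset.univ.image pt := by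
  ext x
  have e : ∀ a : Fin 8, pt a = ![(tv a 0 : ℝ), (tv a 1 : ℝ), (tv a 2 : ℝ)] := by
    intro a
    funext j
    fin_cases j <;> simp [pt]
  simp [Pverts, Fin.exists_fin_succ, e, tv, eq_comm]

lemma tetSet_coe (i : Fin 12) :
    (tetSet i : Set Pt3) = Set.range (fun k => pt (tt i k)) := by
  simp [tetSet]

lemma aff_convexComb (h : Fin 4 → ℤ) (x y : Pt3) (a b : ℝ) (hab : a + b = 1) :
    aff h (a • x + b • y) = a * aff h x + b * aff h y := by
  simp only [aff, Pi.add_apply, Pi.smul_apply, smul_eq_mul]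
  linear_combination (-(h 3 : ℝ)) * hab

lemma convex_nonneg (h : Fin 4 → ℤ) : Convex ℝ {x : Pt3 | 0 ≤ aff h x} := by
  intro x hx y hy a b ha hb hab
  simp only [mem_ofPred_eq] at *
  rw [aff_convexComb h x y a b hab]
  positivity

lemma convex_nonpos (h : Fin 4 → ℤ) : Convex ℝ {x : Pt3 | aff h x ≤ 0} := by
  intro x hx y hy a b ha hb hab
  simp only [mem_ofPred_eq] at *
  rw [aff_convexComb h x y a b hab]
  nlinarith [mul_nonneg ha (neg_nonneg.2 hx), mul_nonneg hb (neg_nonneg.2 hy)]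

lemma hull_nonneg (h : Fin 4 → ℤ) (i : Fin 12) (H : ∀ k, 0 ≤ affZ h (tv (tt i k))) :
    convexHull ℝ (tetSet i : Set Pt3) ⊆ {x | 0 ≤ aff h x} := by
  refine convexHull_min ?_ (convex_nonneg h)
  rw [tetSet_coe]
  rintro _ ⟨k, rfl⟩
  simp only [mem_ofPred_eq, aff_pt]
  exact_mod_cast H k

lemma hull_nonpos (h : Fin 4 → ℤ) (i : Fin 12) (H : ∀ k, affZ h (tv (tt i k)) ≤ 0) :
    convexHull ℝ (tetSet i : Set Pt3) ⊆ {x | aff h x ≤ 0} := by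
  refine convexHull_min ?_ (convex_nonpos h)
  rw [tetSet_coe]
  rintro _ ⟨k, rfl⟩
  simp only [mem_ofPred_eq, aff_pt]
  exact_mod_cast H k

lemma sep_interior (h : Fin 4 → ℤ) (hn : 0 < h 0 * h 0 + h 1 * h 1 + h 2 * h 2) (A B : Set Pt3)
    (hA : A ⊆ {x | aff h x ≤ 0}) (hB : B ⊆ {x | 0 ≤ aff h x}) :
    interior A ∩ interior B = ∅ := by
  rw [Set.eq_empty_iff_forall_notMem]
  rintro x ⟨hxA, hxB⟩
  rw [mem_interior_iff_mem_nhds] at hxA hxB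
  let n : Pt3 := fun j => (h j.castSucc : ℝ)
  have hc : Continuous (fun t : ℝ => x + t • n) := by fun_prop
  have ht : Filter.Tendsto (fun t : ℝ => x + t • n) (nhdsWithin 0 (Set.Ioi 0)) (nhds x) := by
    have := hc.tendsto 0
    simp only [zero_smul, add_zero] at this
    exact this.mono_left nhdsWithin_le_nhds
  have h1 : ∀ᶠ t : ℝ in nhdsWithin 0 (Set.Ioi 0), x + t • n ∈ A := ht hxA
  have h3 : ∀ᶠ t : ℝ in nhdsWithin 0 (Set.Ioi 0), 0 < t := eventually_mem_nhdsWithin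
  obtain ⟨t, ht1, ht0⟩ := (Filter.Eventually.and h1 h3).exists
  have e1 : aff h (x + t • n) ≤ 0 := hA ht1
  have e2 : 0 ≤ aff h x := hB (mem_of_mem_nhds hxB)
  have e3 : aff h (x + t • n) =
      aff h x + t * ((h 0 : ℝ) * h 0 + (h 1 : ℝ) * h 1 + (h 2 : ℝ) * h 2) := by
    simp [aff, n]
    ring
  have e4 : (0 : ℝ) < (h 0 : ℝ) * h 0 + (h 1 : ℝ) * h 1 + (h 2 : ℝ) * h 2 := by exact_mod_cast hn
  have := mul_pos ht0 e4
  linarith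

lemma tet_disjoint (i j : Fin 12) (hij : i ≠ j) :
    interior (convexHull ℝ (tetSet i : Set Pt3)) ∩ interior (convexHull ℝ (tetSet j : Set Pt3))
      = ∅ := by
  obtain ⟨h, -, hn, H | H⟩ := tsep_spec i j hij
  · exact sep_interior h hn _ _ (hull_nonpos h i H.1) (hull_nonneg h j H.2)
  · rw [Set.inter_comm]
    exact sep_interior h hn _ _ (hull_nonpos h j H.1) (hull_nonneg h i H.2)

lemma tetSet_inj : Function.Injective tetSet := by
  intro i j hij
  by_contra hne
  obtain ⟨k, hk⟩ := tt_ne i j hne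
  have : pt (tt i k) ∈ tetSet j := by
    rw [← hij]
    exact Finset.mem_image_of_mem _ (Finset.mem_univ k)
  simp only [tetSet, Finset.mem_image, Finset.mem_univ, true_and] at this
  obtain ⟨l, hl⟩ := this
  exact hk l (pt_inj hl).symm

lemma aff_sum (i : Fin 12) (x : Pt3) : ∑ k, aff (tb i k) x = 1 := by
  have H : ∀ j : Fin 4, ((tb i 0 j : ℝ) + tb i 1 j + tb i 2 j + tb i 3 j)
      = if j = 3 then 1 else 0 := fun j => by exact_mod_cast tb_sum i j
  have h0 := H 0
  have h1 := H 1
  have h2 := H 2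
  have h3 := H 3
  simp at h0 h1 h2 h3
  simp only [Fin.sum_univ_four, aff]
  linear_combination x 0 * h0 + x 1 * h1 + x 2 * h2 + h3

lemma aff_recon (i : Fin 12) (x : Pt3) : ∑ k, aff (tb i k) x • pt (tt i k) = x := by
  funext m
  have H : ∀ j : Fin 4, ((tb i 0 j : ℝ) * tv (tt i 0) m + tb i 1 j * tv (tt i 1) m
      + tb i 2 j * tv (tt i 2) m + tb i 3 j * tv (tt i 3) m)
      = if j = m.castSucc then 1 else 0 := fun j => by exact_mod_cast tb_recon i j m
  have h0 := H 0
  have h1 := H 1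
  have h2 := H 2
  have h3 := H 3
  simp only [Fin.sum_univ_four, aff, Pi.add_apply, Pi.smul_apply, smul_eq_mul, pt]
  have hx : x m = x 0 * (if (0 : Fin 4) = m.castSucc then 1 else 0)
      + x 1 * (if (1 : Fin 4) = m.castSucc then 1 else 0)
      + x 2 * (if (2 : Fin 4) = m.castSucc then 1 else 0)
      + (if (3 : Fin 4) = m.castSucc then 1 else 0) := by
    fin_cases m <;> simp [Fin.ext_iff]
  rw [hx]
  linear_combination x 0 * h0 + x 1 * h1 + x 2 * h2 + h3

lemma mem_hull_iff (i : Fin 12) (x : Pt3) :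
    x ∈ convexHull ℝ (tetSet i : Set Pt3) ↔ ∀ k, 0 ≤ aff (tb i k) x := by
  constructor
  · intro hx k
    refine hull_nonneg (tb i k) i (fun l => ?_) hx
    rw [aff_delta]
    split_ifs <;> norm_num
  · intro hx
    rw [← aff_recon i x]
    refine (convex_convexHull ℝ _).sum_mem (fun k _ => hx k) (aff_sum i x) (fun k _ => ?_)
    apply subset_convexHull
    rw [tetSet_coe]
    exact ⟨k, rfl⟩

lemma tet_affInd (i : Fin 12) : AffineIndependent ℝ (fun k => pt (tt i k)) := by
  rw [affineIndependent_iff]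
  intro s w hw hs k hk
  have h0 := congrFun hs 0
  have h1 := congrFun hs 1
  have h2 := congrFun hs 2
  simp only [Finset.sum_apply, Pi.smul_apply, smul_eq_mul, Pi.zero_apply] at h0 h1 h2
  have key : ∑ l ∈ s, w l * aff (tb i k) (pt (tt i l)) = 0 := by
    have : ∀ l, w l * aff (tb i k) (pt (tt i l)) = (tb i k 0 : ℝ) * (w l * pt (tt i l) 0)
        + (tb i k 1 : ℝ) * (w l * pt (tt i l) 1) + (tb i k 2 : ℝ) * (w l * pt (tt i l) 2)
        + (tb i k 3 : ℝ) * w l := fun l => by simp only [aff]; ring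
    simp only [this, Finset.sum_add_distrib, ← Finset.mul_sum]
    rw [h0, h1, h2, hw]
    ring
  simpa [aff_pt, aff_delta, hk] using key

lemma tet_isTet (i : Fin 12) : IsTet (tetSet i) := by
  refine ⟨?_, ?_⟩
  · rw [tetSet, Finset.card_image_of_injective _ (tet_affInd i).injective]
    simp
  · have := (tet_affInd i).range
    rw [← tetSet_coe] at this
    exact this

/-- The standard corner simplex. -/
def corner (n : ℕ) (c : ℝ) : Set (Fin n → ℝ) := {x | (∀ j, 0 ≤ x j) ∧ ∑ j, x j ≤ c}

lemma corner_closed (n : ℕ) (c : ℝ) : IsClosed (corner n c) := by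
  have : corner n c = (⋂ j, {x | 0 ≤ x j}) ∩ {x | ∑ j, x j ≤ c} := by
    ext x; simp [corner]
  rw [this]
  exact (isClosed_iInter fun j => isClosed_le continuous_const (continuous_apply j)).inter
    (isClosed_le (by fun_prop) continuous_const)

lemma corner_volume (n : ℕ) : ∀ c : ℝ, 0 ≤ c →
    volume (corner n c) = ENNReal.ofReal (c ^ n / (n.factorial : ℝ)) := by
  induction n with
  | zero =>
    intro c hc
    have : corner 0 c = Set.univ := by
      ext x; simp [corner, hc]
    rw [this, volume_pi, Measure.pi_of_empty]
    simp
  | succ n ih =>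
    intro c hc
    have hmp := (volume_preserving_piFinSuccAbove (fun _ : Fin (n + 1) => ℝ) 0).symm
    have hm := (corner_closed (n + 1) c).measurableSet
    rw [← hmp.measure_preimage_equiv, Measure.volume_eq_prod, Measure.prod_apply
      ((MeasurableEquiv.measurable _) hm)]
    have hs : ∀ s : ℝ, volume (Prod.mk s ⁻¹'
        ((MeasurableEquiv.piFinSuccAbove (fun _ : Fin (n + 1) => ℝ) 0).symm ⁻¹' corner (n + 1) c))
        = (Set.Icc 0 c).indicator
          (fun s => ENNReal.ofReal ((c - s) ^ n / (n.factorial : ℝ))) s := by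
      intro s
      have hmem : ∀ y : Fin n → ℝ, (y ∈ Prod.mk s ⁻¹'
        ((MeasurableEquiv.piFinSuccAbove (fun _ : Fin (n + 1) => ℝ) 0).symm ⁻¹' corner (n + 1) c))
          ↔ 0 ≤ s ∧ y ∈ corner n (c - s) := by
        intro y
        simp only [mem_preimage, corner, mem_ofPred_eq, MeasurableEquiv.piFinSuccAbove_symm_apply,
          Fin.forall_fin_succ, Fin.sum_univ_succ, Fin.insertNthEquiv, Equiv.coe_fn_mk,
          Fin.insertNth_zero, Fin.cons_zero, Fin.cons_succ, and_assoc, le_sub_iff_add_le']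
        rfl
      by_cases hsc : s ∈ Set.Icc 0 c
      · rw [Set.indicator_of_mem hsc, ← ih (c - s) (by linarith [hsc.2])]
        congr 1
        ext y
        rw [hmem]
        simp [hsc.1]
      · rw [Set.indicator_of_notMem hsc]
        convert measure_empty (μ := (volume : Measure (Fin n → ℝ)))
        rw [Set.eq_empty_iff_forall_notMem]
        intro y hy
        obtain ⟨h1, h2, h3⟩ := (hmem y).1 hy
        apply hsc
        have := Finset.sum_nonneg (fun j (_ : j ∈ Finset.univ) => h2 j)
        exact ⟨h1, by linarith⟩
    simp_rw [hs]
    rw [lintegral_indicator measurableSet_Icc, ← ofReal_integral_eq_lintegral_ofReal]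
    · congr 1
      rw [integral_Icc_eq_integral_Ioc, ← intervalIntegral.integral_of_le hc,
        intervalIntegral.integral_div,
        intervalIntegral.integral_comp_sub_left (fun u : ℝ => u ^ n) c, integral_pow]
      simp only [sub_self, sub_zero, Nat.factorial_succ, Nat.cast_mul, Nat.cast_succ]
      field_simp
      simp
    · exact (Continuous.integrableOn_Icc (by fun_prop))
    · refine (ae_restrict_mem measurableSet_Icc).mono fun s hsc => ?_
      have : 0 ≤ c - s := by linarith [hsc.2]
      simp only [Pi.zero_apply]
      positivity

def tM (i : Fin 12) : Matrix (Fin 3) (Fin 3) ℤ := fun k j => tb i k.succ j.castSucc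

lemma tM_det : ∀ i : Fin 12,
    (tM i 0 0 * tM i 1 1 * tM i 2 2 - tM i 0 0 * tM i 1 2 * tM i 2 1
      - tM i 0 1 * tM i 1 0 * tM i 2 2 + tM i 0 1 * tM i 1 2 * tM i 2 0
      + tM i 0 2 * tM i 1 0 * tM i 2 1 - tM i 0 2 * tM i 1 1 * tM i 2 0) ^ 2 = 1 := by
  decide +kernel

lemma tet_volume (i : Fin 12) :
    volume (convexHull ℝ (tetSet i : Set Pt3)) = (6 : ℝ≥0∞)⁻¹ := by
  let A : Matrix (Fin 3) (Fin 3) ℝ := (tM i).map (fun z => (z : ℝ))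
  let d : Pt3 := fun k => (tb i k.succ 3 : ℝ)
  have hdet : A.det ^ 2 = 1 := by
    rw [Matrix.det_fin_three]
    simp only [A, Matrix.map_apply]
    exact_mod_cast tM_det i
  have habs : |A.det| = 1 := by
    rcases (show A.det = 1 ∨ A.det = -1 from by simpa using hdet) with h | h <;> simp [h]
  have hlin : LinearMap.det (Matrix.toLin' A) = A.det := LinearMap.det_toLin' A
  have hne : LinearMap.det (Matrix.toLin' A) ≠ 0 := by
    rw [hlin]
    intro h
    simp [h] at habs
  have hset : convexHull ℝ (tetSet i : Set Pt3)
      = (Matrix.toLin' A) ⁻¹' ((fun y => y + d) ⁻¹' corner 3 1) := by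
    ext x
    have hk : ∀ k : Fin 3, (Matrix.toLin' A x + d) k = aff (tb i k.succ) x := by
      intro k
      simp [A, d, tM, aff, Matrix.mulVec, dotProduct, Fin.sum_univ_three]
    rw [mem_hull_iff]
    simp only [mem_preimage, corner, mem_ofPred_eq, hk]
    have hs := aff_sum i x
    rw [Fin.sum_univ_succ] at hs
    rw [Fin.forall_fin_succ]
    constructor
    · rintro ⟨h1, h2⟩
      exact ⟨h2, by linarith⟩
    · rintro ⟨h1, h2⟩
      exact ⟨by linarith, h1⟩
  rw [hset, Measure.addHaar_preimage_linearMap _ hne, measure_preimage_add_right,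
    corner_volume 3 1 zero_le_one, hlin, abs_inv, habs]
  rw [show ((1 : ℝ) ^ 3 / (Nat.factorial 3 : ℝ)) = (6 : ℝ)⁻¹ by norm_num [Nat.factorial],
    ENNReal.ofReal_inv_of_pos (by norm_num)]
  simp

lemma bary_nonneg (i : Fin 12) (p : Pt3) (h0 : 0 ≤ aff (tb i 0) p) (h1 : 0 ≤ aff (tb i 1) p)
    (h2 : 0 ≤ aff (tb i 2) p) (h3 : 0 ≤ aff (tb i 3) p) :
    p ∈ convexHull ℝ (tetSet i : Set Pt3) := by
  rw [mem_hull_iff]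
  intro k
  fin_cases k <;> assumption

lemma cover (p : Pt3) (hp : ∀ h ∈ tfac, 0 ≤ aff h p) :
    ∃ i, p ∈ convexHull ℝ (tetSet i : Set Pt3) := by
  simp [tfac, aff] at hp
  obtain ⟨f0, f1, f2, f3, f4, f5, f6, f7, f8, f9⟩ := hp
  rcases le_total 0 ((0)*p 0 + (0)*p 1 + (-1)*p 2 + (0)) with h | h
  · rcases le_total 0 ((1)*p 0 + (0)*p 1 + (0)*p 2 + (0)) with h | h
    · rcases le_total 0 ((-1)*p 0 + (0)*p 1 + (-1)*p 2 + (1)) with h | h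
      · rcases le_total 0 ((-1)*p 0 + (-1)*p 1 + (0)*p 2 + (1)) with h | h
        · rcases le_total 0 ((0)*p 0 + (1)*p 1 + (1)*p 2 + (0)) with h | h
          · exact ⟨0, bary_nonneg 0 p (by simp [aff, tb]; linarith) (by simp [aff, tb]; linarith)
                (by simp [aff, tb]; linarith) (by simp [aff, tb]; linarith)⟩
          · exact ⟨3, bary_nonneg 3 p (by simp [aff, tb]; linarith) (by simp [aff, tb]; linarith)
                (by simp [aff, tb]; linarith) (by simp [aff, tb]; linarith)⟩
        · rcases le_total 0 ((-1)*p 0 + (-2)*p 1 + (-1)*p 2 + (1)) with h | h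
          · exact ⟨3, bary_nonneg 3 p (by simp [aff, tb]; linarith) (by simp [aff, tb]; linarith)
                (by simp [aff, tb]; linarith) (by simp [aff, tb]; linarith)⟩
          · rcases le_total 0 ((0)*p 0 + (-1)*p 1 + (1)*p 2 + (1)) with h | h
            · rcases le_total 0 ((1)*p 0 + (1)*p 1 + (1)*p 2 + (-1)) with h | h
              · exact ⟨7, bary_nonneg 7 p (by simp [aff, tb]; linarith) (by simp [aff, tb]; linarith)
                    (by simp [aff, tb]; linarith) (by simp [aff, tb]; linarith)⟩
              · exact ⟨8, bary_nonneg 8 p (by simp [aff, tb]; linarith) (by simp [aff, tb]; linarith)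
                    (by simp [aff, tb]; linarith) (by simp [aff, tb]; linarith)⟩
            · rcases le_total 0 ((-1)*p 0 + (-2)*p 1 + (0)*p 2 + (2)) with h | h
              · exact ⟨8, bary_nonneg 8 p (by simp [aff, tb]; linarith) (by simp [aff, tb]; linarith)
                    (by simp [aff, tb]; linarith) (by simp [aff, tb]; linarith)⟩
              · exact ⟨11, bary_nonneg 11 p (by simp [aff, tb]; linarith) (by simp [aff, tb]; linarith)
                    (by simp [aff, tb]; linarith) (by simp [aff, tb]; linarith)⟩
      · exact ⟨9, bary_nonneg 9 p (by simp [aff, tb]; linarith) (by simp [aff, tb]; linarith)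
            (by simp [aff, tb]; linarith) (by simp [aff, tb]; linarith)⟩
    · exact ⟨5, bary_nonneg 5 p (by simp [aff, tb]; linarith) (by simp [aff, tb]; linarith)
          (by simp [aff, tb]; linarith) (by simp [aff, tb]; linarith)⟩
  · rcases le_total 0 ((-1)*p 0 + (0)*p 1 + (0)*p 2 + (1)) with h | h
    · rcases le_total 0 ((1)*p 0 + (0)*p 1 + (1)*p 2 + (0)) with h | h
      · rcases le_total 0 ((1)*p 0 + (-1)*p 1 + (0)*p 2 + (0)) with h | h
        · rcases le_total 0 ((0)*p 0 + (1)*p 1 + (-1)*p 2 + (0)) with h | h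
          · exact ⟨1, bary_nonneg 1 p (by simp [aff, tb]; linarith) (by simp [aff, tb]; linarith)
                (by simp [aff, tb]; linarith) (by simp [aff, tb]; linarith)⟩
          · exact ⟨2, bary_nonneg 2 p (by simp [aff, tb]; linarith) (by simp [aff, tb]; linarith)
                (by simp [aff, tb]; linarith) (by simp [aff, tb]; linarith)⟩
        · rcases le_total 0 ((1)*p 0 + (-2)*p 1 + (1)*p 2 + (0)) with h | h
          · exact ⟨2, bary_nonneg 2 p (by simp [aff, tb]; linarith) (by simp [aff, tb]; linarith)
                (by simp [aff, tb]; linarith) (by simp [aff, tb]; linarith)⟩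
          · rcases le_total 0 ((0)*p 0 + (-1)*p 1 + (-1)*p 2 + (1)) with h | h
            · rcases le_total 0 ((-1)*p 0 + (1)*p 1 + (-1)*p 2 + (0)) with h | h
              · exact ⟨4, bary_nonneg 4 p (by simp [aff, tb]; linarith) (by simp [aff, tb]; linarith)
                    (by simp [aff, tb]; linarith) (by simp [aff, tb]; linarith)⟩
              · exact ⟨6, bary_nonneg 6 p (by simp [aff, tb]; linarith) (by simp [aff, tb]; linarith)
                    (by simp [aff, tb]; linarith) (by simp [aff, tb]; linarith)⟩
            · rcases le_total 0 ((1)*p 0 + (-2)*p 1 + (0)*p 2 + (1)) with h | h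
              · exact ⟨6, bary_nonneg 6 p (by simp [aff, tb]; linarith) (by simp [aff, tb]; linarith)
                    (by simp [aff, tb]; linarith) (by simp [aff, tb]; linarith)⟩
              · exact ⟨10, bary_nonneg 10 p (by simp [aff, tb]; linarith) (by simp [aff, tb]; linarith)
                    (by simp [aff, tb]; linarith) (by simp [aff, tb]; linarith)⟩
      · exact ⟨5, bary_nonneg 5 p (by simp [aff, tb]; linarith) (by simp [aff, tb]; linarith)
            (by simp [aff, tb]; linarith) (by simp [aff, tb]; linarith)⟩
    · exact ⟨9, bary_nonneg 9 p (by simp [aff, tb]; linarith) (by simp [aff, tb]; linarith)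
          (by simp [aff, tb]; linarith) (by simp [aff, tb]; linarith)⟩

/-- The polytope `P` has a dissection into 12 unimodular
tetrahedra (each of volume `1/6`) using only the vertices of `P`. -/
theorem Pverts_unimodular_dissection :
    ∃ D : Finset (Finset Pt3), IsDissection Pverts D ∧ D.card = 12 ∧
      ∀ σ ∈ D, volume (convexHull ℝ (σ : Set Pt3)) = (6 : ℝ≥0∞)⁻¹ := by
  have hsub : ∀ i, (tetSet i : Set Pt3) ⊆ (Pverts : Set Pt3) := by
    intro i
    rw [tetSet_coe, Pverts_eq]
    rintro _ ⟨k, rfl⟩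
    simp
  refine ⟨Finset.univ.image tetSet, ⟨?_, ?_, ?_⟩, ?_, ?_⟩
  · intro σ hσ
    obtain ⟨i, -, rfl⟩ := Finset.mem_image.1 hσ
    exact ⟨tet_isTet i, hsub i⟩
  · intro σ hσ τ hτ hne
    obtain ⟨i, -, rfl⟩ := Finset.mem_image.1 hσ
    obtain ⟨j, -, rfl⟩ := Finset.mem_image.1 hτ
    exact tet_disjoint i j (fun h => hne (by rw [h]))
  · apply Set.Subset.antisymm
    · refine Set.iUnion₂_subset fun σ hσ => ?_
      obtain ⟨i, -, rfl⟩ := Finset.mem_image.1 hσ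
      exact convexHull_mono (hsub i)
    · intro p hp
      obtain ⟨i, hi⟩ := cover p (fun h hh => by
        refine convexHull_min ?_ (convex_nonneg h) hp
        rw [Pverts_eq]
        intro x hx
        simp only [Finset.coe_image, Finset.coe_univ, Set.image_univ] at hx
        obtain ⟨a, rfl⟩ := hx
        simp only [mem_ofPred_eq, aff_pt]
        exact_mod_cast tfac_spec h hh a)
      exact Set.mem_iUnion₂.2 ⟨tetSet i, Finset.mem_image_of_mem _ (Finset.mem_univ i), hi⟩
  · rw [Finset.card_image_of_injective _ tetSet_inj]
    simp
  · intro σ hσ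
    obtain ⟨i, -, rfl⟩ := Finset.mem_image.1 hσ
    exact tet_volume i
end
end

section
/- Every mismatched region of a dissection of a convex 3-polytope P is a convex polygon whose vertices are vertices of P, and distinct mismatched regions have disjoint relative interiors. -/
open Set MeasureTheory
open scoped Classical

noncomputable section

/-- The triangles (2-dimensional faces) of the tetrahedra of a dissection. -/
def triOf (D : Finset (Finset Pt3)) : Finset (Finset Pt3) :=
  D.biUnion (fun σ => σ.powersetCard 3)

/-- Two triangles intersect improperly: they lie in a common plane, are
distinct, and intersect with nonempty relative interior. -/
def ImproperAdj (s t : Finset Pt3) : Prop :=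
  s ≠ t ∧ Coplanar ℝ ((s : Set Pt3) ∪ (t : Set Pt3)) ∧
  (intrinsicInterior ℝ (convexHull ℝ (s : Set Pt3)) ∩
    intrinsicInterior ℝ (convexHull ℝ (t : Set Pt3))).Nonempty

/-- The adjacency relation of the auxiliary graph on the triangles of `D`. -/
def AdjIn (D : Finset (Finset Pt3)) (s t : Finset Pt3) : Prop :=
  s ∈ triOf D ∧ t ∈ triOf D ∧ ImproperAdj s t

/-- The mismatched region through a triangle `t`: the union of the triangles in
the connected component of `t` in the auxiliary graph. -/
def region (D : Finset (Finset Pt3)) (t : Finset Pt3) : Set Pt3 :=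
  ⋃ t' ∈ {t' | Relation.ReflTransGen (AdjIn D) t t'}, convexHull ℝ (t' : Set Pt3)

/-- `t` belongs to a mismatched region: its connected component in the
auxiliary graph has size larger than one. -/
def Mismatched (D : Finset (Finset Pt3)) (t : Finset Pt3) : Prop :=
  t ∈ triOf D ∧ ∃ t', t' ≠ t ∧ Relation.ReflTransGen (AdjIn D) t t'


section Helpers
open Filter Topology


/-- Relative interior of the convex hull. -/
abbrev ot (t : Finset Pt3) : Set Pt3 := intrinsicInterior ℝ (convexHull ℝ (t : Set Pt3))

theorem aff_seg (f : Pt3 →ᵃ[ℝ] ℝ) (x q : Pt3) (δ : ℝ) :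
    f (x + δ • (q - x)) = f x + δ * (f q - f x) := by
  have := f.apply_lineMap x q δ
  simp only [AffineMap.lineMap_apply, vsub_eq_sub, vadd_eq_add, smul_eq_mul] at this
  rw [add_comm, this]; ring

theorem aff_add (f : Pt3 →ᵃ[ℝ] ℝ) (x v : Pt3) (δ : ℝ) :
    f (x + δ • v) = f x + δ * f.linear v := by
  have := f.map_vadd x (δ • v)
  simp only [vadd_eq_add, map_smul, smul_eq_mul] at this
  rw [add_comm, this]; ring

theorem aff_cont (f : Pt3 →ᵃ[ℝ] ℝ) : Continuous f :=
  AffineMap.continuous_of_finiteDimensional f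

theorem aff_sum_s13 (f : Pt3 →ᵃ[ℝ] ℝ) (t : Finset Pt3) (c : Pt3 → ℝ) (x : Pt3)
    (h1 : ∑ v ∈ t, c v = 1) (hx : ∑ v ∈ t, c v • v = x) :
    f x = ∑ v ∈ t, c v * f v := by
  have key : ∀ y, f y = f.linear y + f 0 := fun y => by
    have := congrFun f.decomp y
    simpa using this
  rw [key x, ← hx, map_sum]
  have : ∀ v ∈ t, c v * f v = f.linear (c v • v) + c v * f 0 := by
    intro v _
    rw [key v, map_smul, smul_eq_mul]; ring
  rw [Finset.sum_congr rfl this, Finset.sum_add_distrib, ← Finset.sum_mul, h1, one_mul]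

theorem ev_pos (f : Pt3 →ᵃ[ℝ] ℝ) (x q : Pt3) (h : 0 < f x ∨ (0 ≤ f x ∧ 0 < f q)) :
    ∀ᶠ δ in 𝓝[>] (0:ℝ), 0 < f (x + δ • (q - x)) := by
  rcases lt_or_ge 0 (f x) with h0 | h0
  · have : Tendsto (fun δ : ℝ => f (x + δ • (q - x))) (𝓝[>] 0) (𝓝 (f x)) := by
      have : Continuous (fun δ : ℝ => f (x + δ • (q - x))) :=
        (aff_cont f).comp (by fun_prop)
      have := this.tendsto 0
      simp only [zero_smul, add_zero] at this
      exact this.mono_left nhdsWithin_le_nhds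
    exact this.eventually (lt_mem_nhds h0)
  · have h1 : f x = 0 ∧ 0 < f q := by
      rcases h with h | h
      · linarith
      · exact ⟨le_antisymm h0 h.1, h.2⟩
    filter_upwards [self_mem_nhdsWithin] with δ hδ
    rw [aff_seg, h1.1]
    have : (0:ℝ) < δ := hδ
    have := mul_pos this h1.2
    linarith

theorem seg_mem {K : Set Pt3} (hK : Convex ℝ K) {x q : Pt3} (hx : x ∈ K) (hq : q ∈ K) {δ : ℝ}
    (h0 : 0 ≤ δ) (h1 : δ ≤ 1) : x + δ • (q - x) ∈ K := by
  exact hK.add_smul_sub_mem hx hq ⟨h0, h1⟩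

theorem ev_mem {K : Set Pt3} (hK : Convex ℝ K) {x q : Pt3} (hx : x ∈ K) (hq : q ∈ K) :
    ∀ᶠ δ in 𝓝[>] (0:ℝ), x + δ • (q - x) ∈ K := by
  filter_upwards [Ioo_mem_nhdsGT (zero_lt_one : (0:ℝ) < 1)] with δ hδ
  exact seg_mem hK hx hq hδ.1.le hδ.2.le

theorem hull_closed (t : Finset Pt3) : IsClosed (convexHull ℝ (t : Set Pt3)) :=
  (t.finite_toSet.isCompact_convexHull ℝ).isClosed

theorem mem_intr_iff {s : Set Pt3} {x : Pt3} :
    x ∈ intrinsicInterior ℝ s ↔ x ∈ affineSpan ℝ s ∧ s ∈ 𝓝[(affineSpan ℝ s : Set Pt3)] x := by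
  rw [mem_intrinsicInterior]
  constructor
  · rintro ⟨y, hy, rfl⟩
    refine ⟨y.2, ?_⟩
    rw [mem_interior_iff_mem_nhds] at hy
    exact preimage_coe_mem_nhds_subtype.1 hy
  · rintro ⟨hx, h⟩
    exact ⟨⟨x, hx⟩, mem_interior_iff_mem_nhds.2 (preimage_coe_mem_nhds_subtype.2 h), rfl⟩

theorem tet_coords {σ : Finset Pt3} (h : IsTet σ) : ∃ L : Pt3 → Pt3 →ᵃ[ℝ] ℝ,
    (∀ v ∈ σ, L v v = 1) ∧ (∀ v ∈ σ, ∀ w ∈ σ, v ≠ w → L v w = 0) ∧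
    (∀ x, ∑ v ∈ σ, L v x = 1) ∧ (∀ x, ∑ v ∈ σ, L v x • v = x) ∧
    (∀ x, x ∈ convexHull ℝ (σ : Set Pt3) ↔ ∀ v ∈ σ, 0 ≤ L v x) ∧
    (∀ x, x ∈ interior (convexHull ℝ (σ : Set Pt3)) ↔ ∀ v ∈ σ, 0 < L v x) := by
  obtain ⟨hc, hi⟩ := h
  have htop : affineSpan ℝ (Set.range (fun p : (σ : Set Pt3) => (p : Pt3))) = ⊤ := by
    rw [hi.affineSpan_eq_top_iff_card_eq_finrank_add_one]
    simp [hc]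
  let b : AffineBasis (σ : Set Pt3) ℝ Pt3 := ⟨fun p => p, hi, htop⟩
  have hb : ∀ i, b i = (i : Pt3) := fun i => rfl
  have hr : Set.range b = (σ : Set Pt3) := by
    ext x; simp [hb]
  let L : Pt3 → Pt3 →ᵃ[ℝ] ℝ := fun v => if hv : v ∈ (σ : Set Pt3) then b.coord ⟨v, hv⟩ else 0
  have hL : ∀ v (hv : v ∈ (σ : Set Pt3)), L v = b.coord ⟨v, hv⟩ := fun v hv => dif_pos hv
  have hL' : ∀ v : (σ : Set Pt3), L v = b.coord v := fun v => hL v v.2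
  refine ⟨L, ?_, ?_, ?_, ?_, ?_, ?_⟩
  · intro v hv
    rw [hL v hv]
    exact b.coord_apply_eq ⟨v, hv⟩
  · intro v hv w hw hvw
    rw [hL v hv]
    exact b.coord_apply_ne (i := ⟨v, hv⟩) (j := ⟨w, hw⟩) (by simpa using hvw)
  · intro x
    rw [← b.sum_coord_apply_eq_one x, ← Finset.sum_coe_sort]
    exact Finset.sum_congr rfl fun v _ => by rw [hL' v]
  · intro x
    conv_rhs => rw [← b.linear_combination_coord_eq_self x]
    rw [← Finset.sum_coe_sort]
    exact Finset.sum_congr rfl fun v _ => by rw [hL' v]; rfl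
  · intro x
    rw [← hr, b.convexHull_eq_nonneg_coord]
    constructor
    · intro h v hv
      rw [hL v hv]; exact h _
    · intro h v
      rw [← hL' v]; exact h v v.2
  · intro x
    rw [← hr, b.interior_convexHull]
    constructor
    · intro h v hv
      rw [hL v hv]; exact h _
    · intro h v
      rw [← hL' v]; exact h v v.2

/-- Barycentric chart of a triangle `t` in the plane `h = 0`. -/
structure Chart (h : Pt3 →ᵃ[ℝ] ℝ) (t : Finset Pt3) (L : Pt3 → Pt3 →ᵃ[ℝ] ℝ) : Prop where
  card : t.card = 3
  hv : ∀ v ∈ t, h v = 0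
  self : ∀ v ∈ t, L v v = 1
  other : ∀ v ∈ t, ∀ w ∈ t, v ≠ w → L v w = 0
  sum1 : ∀ x, h x = 0 → ∑ v ∈ t, L v x = 1
  sumv : ∀ x, h x = 0 → ∑ v ∈ t, L v x • v = x

theorem aff_hull_nonneg (f : Pt3 →ᵃ[ℝ] ℝ) {s : Set Pt3} (hf : ∀ v ∈ s, 0 ≤ f v) {x : Pt3}
    (hx : x ∈ convexHull ℝ s) : 0 ≤ f x := by
  have hc : Convex ℝ (f ⁻¹' (Ici 0)) := (convex_Ici (0:ℝ)).affine_preimage f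
  exact convexHull_min (fun v hv => hf v hv) hc hx

theorem aff_hull_zero (f : Pt3 →ᵃ[ℝ] ℝ) {s : Set Pt3} (hf : ∀ v ∈ s, f v = 0) {x : Pt3}
    (hx : x ∈ convexHull ℝ s) : f x = 0 := by
  have hc : Convex ℝ (f ⁻¹' {0}) := (convex_singleton (0:ℝ)).affine_preimage f
  exact convexHull_min (fun v hv => hf v hv) hc hx

namespace Chart
variable {h : Pt3 →ᵃ[ℝ] ℝ} {t : Finset Pt3} {L : Pt3 → Pt3 →ᵃ[ℝ] ℝ}

theorem hull (C : Chart h t L) (x : Pt3) :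
    x ∈ convexHull ℝ (t : Set Pt3) ↔ h x = 0 ∧ ∀ v ∈ t, 0 ≤ L v x := by
  constructor
  · intro hx
    refine ⟨aff_hull_zero h C.hv hx, fun v hv => aff_hull_nonneg (L v) (fun w hw => ?_) hx⟩
    by_cases e : v = w
    · subst e; rw [C.self v hv]; exact zero_le_one
    · rw [C.other v hv w hw e]
  · rintro ⟨h0, hp⟩
    rw [← C.sumv x h0]
    exact (convex_convexHull ℝ _).sum_mem hp (C.sum1 x h0) (fun v hv => subset_convexHull ℝ _ hv)

theorem span (C : Chart h t L) {s : Set Pt3} (hts : (t : Set Pt3) ⊆ s) (hs : ∀ x ∈ s, h x = 0) :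
    (affineSpan ℝ s : Set Pt3) = {x | h x = 0} := by
  ext x
  constructor
  · intro hx
    have : affineSpan ℝ s ≤ (affineSpan ℝ {(0:ℝ)}).comap h := by
      rw [affineSpan_le]
      intro y hy
      simp [hs y hy]
    have := this hx
    simpa using this
  · intro hx
    refine affineSpan_mono ℝ hts ?_
    have : (t.affineCombination ℝ id) (fun v => L v x) ∈ affineSpan ℝ (id '' (t : Set Pt3)) := 
      affineCombination_mem_affineSpan_image (C.sum1 x hx) (fun i hi hi' => by simp_all) id
    rw [Finset.affineCombination_eq_linear_combination _ _ _ (C.sum1 x hx)] at this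
    simp only [id] at this
    rw [C.sumv x hx] at this
    simpa using this

theorem hz_ev (_ : Chart h t L) {x q : Pt3} (hx : h x = 0) (hq : h q = 0) (δ : ℝ) : 
    h (x + δ • (q - x)) = 0 := by
  rw [aff_seg, hx, hq]; ring

theorem ne_mem_nhds (C : Chart h t L) {x : Pt3} (hp : ∀ v ∈ t, 0 < L v x) :
    convexHull ℝ (t : Set Pt3) ∈ 𝓝[{x | h x = 0}] x := by
  have : ∀ᶠ y in 𝓝 x, ∀ v ∈ t, 0 < L v y := by
    rw [Filter.eventually_all_finset]
    intro v hv
    exact (aff_cont (L v)).continuousAt.eventually (lt_mem_nhds (hp v hv))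
  filter_upwards [self_mem_nhdsWithin, mem_nhdsWithin_of_mem_nhds this] with y hy hy'
  exact (C.hull y).2 ⟨hy, fun v hv => (hy' v hv).le⟩

theorem oint (C : Chart h t L) (x : Pt3) :
    x ∈ ot t ↔ h x = 0 ∧ ∀ v ∈ t, 0 < L v x := by
  have hsp : (affineSpan ℝ (convexHull ℝ (t : Set Pt3)) : Set Pt3) = {x | h x = 0} :=
    C.span (subset_convexHull ℝ _) (fun x hx => ((C.hull x).1 hx).1)
  unfold ot
  rw [mem_intr_iff, ← SetLike.mem_coe, hsp]
  constructor
  · rintro ⟨hx, hn⟩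
    refine ⟨hx, fun v hv => ?_⟩
    have hx : h x = 0 := hx
    have hc : Tendsto (fun δ : ℝ => x + δ • (x - v)) (𝓝[>] 0) (𝓝[{x | h x = 0}] x) := by
      apply tendsto_nhdsWithin_iff.2 ⟨?_, ?_⟩
      · have : Continuous (fun δ : ℝ => x + δ • (x - v)) := by fun_prop
        have := this.tendsto 0
        simp only [zero_smul, add_zero] at this
        exact this.mono_left nhdsWithin_le_nhds
      · refine Eventually.of_forall fun δ => ?_
        have := aff_seg h x v (-δ)
        rw [C.hv v hv, hx] at this
        simp only [mem_setOf_eq]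
        convert this using 2
        · rw [neg_smul, ← smul_neg, neg_sub]
        · ring
    obtain ⟨δ, h1, h2⟩ := ((hc.eventually hn).and self_mem_nhdsWithin).exists
    have h3 := ((C.hull _).1 h1).2 v hv
    have h4 := aff_seg (L v) x v (-δ)
    have e : x + δ • (x - v) = x + (-δ) • (v - x) := by rw [neg_smul, ← smul_neg, neg_sub]
    rw [e, h4, C.self v hv] at h3
    have h2 : 0 < δ := h2
    by_contra hcon
    push Not at hcon
    nlinarith
  · rintro ⟨h0, hp⟩
    exact ⟨h0, C.ne_mem_nhds hp⟩

theorem sub_hull (C : Chart h t L) {x : Pt3} (hx : x ∈ ot t) : x ∈ convexHull ℝ (t : Set Pt3) :=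
  intrinsicInterior_subset hx

theorem ot_ev (C : Chart h t L) {x q : Pt3} (hx : x ∈ ot t) (hq : h q = 0) :
    ∀ᶠ δ in 𝓝[>] (0:ℝ), x + δ • (q - x) ∈ ot t := by
  have hx := (C.oint x).1 hx
  have : ∀ᶠ δ in 𝓝[>] (0:ℝ), ∀ v ∈ t, 0 < L v (x + δ • (q - x)) := by
    rw [Filter.eventually_all_finset]
    intro v hv
    exact ev_pos _ _ _ (Or.inl (hx.2 v hv))
  filter_upwards [this] with δ hδ
  exact (C.oint _).2 ⟨C.hz_ev hx.1 hq δ, hδ⟩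

theorem hull_ev (C : Chart h t L) {x q : Pt3} (hx : x ∈ convexHull ℝ (t : Set Pt3))
    (hq : q ∈ ot t) : ∀ᶠ δ in 𝓝[>] (0:ℝ), x + δ • (q - x) ∈ ot t := by
  have hx := (C.hull x).1 hx
  have hq := (C.oint q).1 hq
  have : ∀ᶠ δ in 𝓝[>] (0:ℝ), ∀ v ∈ t, 0 < L v (x + δ • (q - x)) := by
    rw [Filter.eventually_all_finset]
    intro v hv
    exact ev_pos _ _ _ (Or.inr ⟨hx.2 v hv, hq.2 v hv⟩)
  filter_upwards [this] with δ hδ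
  exact (C.oint _).2 ⟨C.hz_ev hx.1 hq.1 δ, hδ⟩

theorem ot_nonempty (C : Chart h t L) : (ot t).Nonempty := by
  apply Set.Nonempty.intrinsicInterior (convex_convexHull ℝ _)
  rw [convexHull_nonempty_iff]
  have : t.Nonempty := Finset.card_pos.1 (by rw [C.card]; norm_num)
  exact this

theorem convex_ot (C : Chart h t L) : Convex ℝ (ot t) := by
  have : ot t = {x | h x = 0} ∩ ⋂ v ∈ t, {x | 0 < L v x} := by
    ext x; rw [C.oint]; simp
  rw [this]
  refine Convex.inter ((convex_singleton (0:ℝ)).affine_preimage h) ?_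
  exact convex_iInter₂ fun v _ => (convex_Ioi (0:ℝ)).affine_preimage (L v)

theorem hull_sub_closure (C : Chart h t L) : convexHull ℝ (t : Set Pt3) ⊆ closure (ot t) := by
  intro x hx
  obtain ⟨q, hq⟩ := C.ot_nonempty
  have hc : Tendsto (fun δ : ℝ => x + δ • (q - x)) (𝓝[>] 0) (𝓝 x) := by
    have : Continuous (fun δ : ℝ => x + δ • (q - x)) := by fun_prop
    have := this.tendsto 0
    simp only [zero_smul, add_zero] at this
    exact this.mono_left nhdsWithin_le_nhds
  exact mem_closure_of_tendsto hc (C.hull_ev hx hq)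

theorem eval (C : Chart h t L) (f : Pt3 →ᵃ[ℝ] ℝ) {x : Pt3} (hx : h x = 0) :
    f x = ∑ v ∈ t, L v x * f v :=
  aff_sum_s13 f t _ x (C.sum1 x hx) (C.sumv x hx)

end Chart

theorem tendsto_seg (x q : Pt3) : Tendsto (fun δ : ℝ => x + δ • (q - x)) (𝓝[>] 0) (𝓝 x) := by
  have : Continuous (fun δ : ℝ => x + δ • (q - x)) := by fun_prop
  have := this.tendsto 0
  simp only [zero_smul, add_zero] at this
  exact this.mono_left nhdsWithin_le_nhds


theorem Chart.edge {h : Pt3 →ᵃ[ℝ] ℝ} {t : Finset Pt3} {L : Pt3 → Pt3 →ᵃ[ℝ] ℝ}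
    (C : Chart h t L) {z : Pt3} (hz : z ∈ convexHull ℝ (t : Set Pt3)) (ho : z ∉ ot t)
    (hn : z ∉ t) : ∃ a b c, a ≠ b ∧ a ≠ c ∧ b ≠ c ∧ t = {a, b, c} ∧ 0 < L a z ∧ 0 < L b z ∧
      L c z = 0 := by
  have hh := (C.hull z).1 hz
  have : ∃ c ∈ t, L c z = 0 := by
    by_contra hcon
    push Not at hcon
    exact ho ((C.oint z).2 ⟨hh.1, fun v hv => lt_of_le_of_ne (hh.2 v hv) (Ne.symm (hcon v hv))⟩)
  obtain ⟨c, hc, hcz⟩ := this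
  have h2 : (t.erase c).card = 2 := by rw [Finset.card_erase_of_mem hc, C.card]
  obtain ⟨a, b, hab, he⟩ := Finset.card_eq_two.1 h2
  have hac : a ∈ t.erase c := by rw [he]; simp
  have hbc : b ∈ t.erase c := by rw [he]; simp
  have hac1 : a ≠ c := (Finset.mem_erase.1 hac).1
  have hbc1 : b ≠ c := (Finset.mem_erase.1 hbc).1
  have ht : t = {a, b, c} := by
    rw [← Finset.insert_erase hc, he]
    ext x; simp; tauto
  have hs1 := C.sum1 z hh.1
  have hsv := C.sumv z hh.1
  rw [← Finset.insert_erase hc, Finset.sum_insert (by simp), he, Finset.sum_pair hab] at hs1 hsv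
  rw [hcz] at hs1 hsv
  simp only [zero_add, zero_smul] at hs1 hsv
  have ha0 := hh.2 a (Finset.mem_of_mem_erase hac)
  have hb0 := hh.2 b (Finset.mem_of_mem_erase hbc)
  refine ⟨a, b, c, hab, hac1, hbc1, ht, lt_of_le_of_ne ha0 ?_, lt_of_le_of_ne hb0 ?_, hcz⟩
  · intro e
    rw [← e] at hs1 hsv
    have : L b z = 1 := by linarith
    rw [this] at hsv
    simp at hsv
    exact hn (hsv ▸ Finset.mem_of_mem_erase hbc)
  · intro e
    rw [← e] at hs1 hsv
    have : L a z = 1 := by linarith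
    rw [this] at hsv
    simp at hsv
    exact hn (hsv ▸ Finset.mem_of_mem_erase hac)

/-- Expansion of an affine function in a labelled triangle. -/
theorem Chart.eval3 {h : Pt3 →ᵃ[ℝ] ℝ} {t : Finset Pt3} {L : Pt3 → Pt3 →ᵃ[ℝ] ℝ}
    (C : Chart h t L) {a b c : Pt3} (hab : a ≠ b) (hac : a ≠ c) (hbc : b ≠ c) (ht : t = {a, b, c})
    {x : Pt3} (hx : h x = 0) : (L a x + L b x + L c x = 1) ∧
      (L a x • a + L b x • b + L c x • c = x) ∧
      ∀ f : Pt3 →ᵃ[ℝ] ℝ, f x = L a x * f a + L b x * f b + L c x * f c := by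
  have hs1 := C.sum1 x hx
  have hsv := C.sumv x hx
  have he : ∀ f : Pt3 →ᵃ[ℝ] ℝ, f x = _ := fun f => C.eval f hx
  have ha : a ∉ ({b, c} : Finset Pt3) := by simp [hab, hac]
  rw [ht, Finset.sum_insert ha, Finset.sum_pair hbc] at hs1 hsv
  refine ⟨by linarith, by rw [← add_assoc] at hsv; exact hsv, fun f => ?_⟩
  rw [he f, ht, Finset.sum_insert ha, Finset.sum_pair hbc, add_assoc]

theorem nh_seg {h : Pt3 →ᵃ[ℝ] ℝ} {S : Set Pt3} {z q : Pt3} (hS : S ∈ 𝓝[{x | h x = 0}] z)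
    (hz : h z = 0) (hq : h q = 0) : ∀ᶠ δ in 𝓝[>] (0:ℝ), z + δ • (q - z) ∈ S := by
  have : Tendsto (fun δ : ℝ => z + δ • (q - z)) (𝓝[>] 0) (𝓝[{x | h x = 0}] z) :=
    tendsto_nhdsWithin_iff.2 ⟨tendsto_seg z q, Eventually.of_forall fun δ => by
      change h _ = 0
      rw [aff_seg, hz, hq]; ring⟩
  exact this.eventually hS

/-- The planar situation inside the plane `h = 0`. -/
structure Pl (V : Finset Pt3) (K : Set Pt3) (h : Pt3 →ᵃ[ℝ] ℝ) (C A B : Set (Finset Pt3)) :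
    Prop where
  ext : ∀ v ∈ V, ∃ g : Pt3 →ᵃ[ℝ] ℝ, g v = 0 ∧ ∀ x ∈ K, x ≠ v → g x < 0
  kconv : Convex ℝ K
  vk : (V : Set Pt3) ⊆ K
  fin : C.Finite
  ne : C.Nonempty
  sub : ∀ t ∈ C, t ⊆ V
  chart : ∀ t ∈ C, ∃ L, Chart h t L
  split : ∀ t ∈ C, t ∈ A ∨ t ∈ B
  ac : A ⊆ C
  bc : B ⊆ C
  sepA : ∀ t ∈ A, ∀ t' ∈ A, ∀ x ∈ ot t, x ∈ convexHull ℝ (t' : Set Pt3) → t = t'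
  sepB : ∀ t ∈ B, ∀ t' ∈ B, ∀ x ∈ ot t, x ∈ convexHull ℝ (t' : Set Pt3) → t = t'
  covA : ∀ t ∈ C, ∀ x ∈ convexHull ℝ (t : Set Pt3), ∃ s ∈ A, x ∈ convexHull ℝ (s : Set Pt3)
  covB : ∀ t ∈ C, ∀ x ∈ convexHull ℝ (t : Set Pt3), ∃ s ∈ B, x ∈ convexHull ℝ (s : Set Pt3)
  conn : ∀ t₁ ∈ C, ∀ t₂ ∈ C,
    Relation.ReflTransGen (fun s t => s ∈ C ∧ t ∈ C ∧ (ot s ∩ ot t).Nonempty) t₁ t₂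

namespace Pl
variable {V : Finset Pt3} {K : Set Pt3} {h : Pt3 →ᵃ[ℝ] ℝ} {C A B : Set (Finset Pt3)}

/-- All vertices. -/
def W (C : Set (Finset Pt3)) : Set Pt3 := ⋃ t ∈ C, (t : Set Pt3)

/-- The region. -/
def R (C : Set (Finset Pt3)) : Set Pt3 := ⋃ t ∈ C, convexHull ℝ (t : Set Pt3)

theorem mem_R {C : Set (Finset Pt3)} {x : Pt3} :
    x ∈ R C ↔ ∃ t ∈ C, x ∈ convexHull ℝ (t : Set Pt3) := by simp [R]

theorem hull_sub_M {t : Finset Pt3} (ht : t ∈ C) :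
    convexHull ℝ (t : Set Pt3) ⊆ convexHull ℝ (W C) :=
  convexHull_mono (subset_biUnion_of_mem (u := fun t : Finset Pt3 => (t : Set Pt3)) ht)

theorem hW (P : Pl V K h C A B) {x : Pt3} (hx : x ∈ W C) : h x = 0 := by
  simp only [W, mem_iUnion] at hx
  obtain ⟨t, ht, hx⟩ := hx
  obtain ⟨L, hL⟩ := P.chart t ht
  exact hL.hv x hx

theorem hM (P : Pl V K h C A B) {x : Pt3} (hx : x ∈ convexHull ℝ (W C)) : h x = 0 :=
  aff_hull_zero h (fun _ hv => P.hW hv) hx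

theorem M_sub_K (P : Pl V K h C A B) : convexHull ℝ (W C) ⊆ K := by
  apply convexHull_min _ P.kconv
  intro x hx
  simp only [W, mem_iUnion] at hx
  obtain ⟨t, ht, hx⟩ := hx
  exact P.vk (P.sub t ht hx)

theorem R_closed (P : Pl V K h C A B) : IsClosed (R C) :=
  P.fin.isClosed_biUnion fun t _ => hull_closed t

theorem not_vert (P : Pl V K h C A B) {z : Pt3} (hz : h z = 0)
    (hU : convexHull ℝ (W C) ∈ 𝓝[{x | h x = 0}] z) : z ∉ V := by
  intro hv
  obtain ⟨t, ht⟩ := P.ne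
  obtain ⟨L, hL⟩ := P.chart t ht
  obtain ⟨w, hw, hwz⟩ := Finset.exists_mem_ne (s := t) (by rw [hL.card]; norm_num) z
  obtain ⟨g, hg0, hg⟩ := P.ext z hv
  have hq : h (z + (-1:ℝ) • (w - z)) = 0 := by rw [aff_seg, hz, hL.hv w hw]; ring
  obtain ⟨δ, h1, h2⟩ := ((nh_seg hU hz hq).and self_mem_nhdsWithin).exists
  have h2 : 0 < δ := h2
  have h3 := P.M_sub_K h1
  have h4 := hg w (P.vk (P.sub t ht hw)) hwz
  have h5 : g (z + δ • (z + (-1:ℝ) • (w - z) - z)) ≤ 0 := by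
    by_cases e : z + δ • (z + (-1:ℝ) • (w - z) - z) = z
    · rw [e, hg0]
    · exact (hg _ h3 e).le
  rw [aff_seg, aff_seg, hg0] at h5
  nlinarith

theorem edge_ext (P : Pl V K h C A B) {t : Finset Pt3} (ht : t ∈ C) {L} (hL : Chart h t L)
    {a b c : Pt3} (hab : a ≠ b) (hac : a ≠ c) (hbc : b ≠ c) (htt : t = {a, b, c}) {y : Pt3}
    (hyK : y ∈ K) (hy : h y = 0) (hc : L c y = 0) : 0 ≤ L a y ∧ 0 ≤ L b y := by
  obtain ⟨e1, e2, e3⟩ := hL.eval3 hab hac hbc htt hy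
  have haV : a ∈ V := P.sub t ht (by simp [htt])
  have hbV : b ∈ V := P.sub t ht (by simp [htt])
  constructor
  · obtain ⟨g, g0, g1⟩ := P.ext b hbV
    have h1 := g1 a (P.vk haV) hab
    have h2 : g y ≤ 0 := by
      by_cases e : y = b
      · rw [e, g0]
      · exact (g1 y hyK e).le
    rw [e3 g, g0, hc] at h2
    by_contra hcon
    push Not at hcon
    nlinarith
  · obtain ⟨g, g0, g1⟩ := P.ext a haV
    have h1 := g1 b (P.vk hbV) hab.symm
    have h2 : g y ≤ 0 := by
      by_cases e : y = a
      · rw [e, g0]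
      · exact (g1 y hyK e).le
    rw [e3 g, g0, hc] at h2
    by_contra hcon
    push Not at hcon
    nlinarith

theorem edge_hull (P : Pl V K h C A B) {t : Finset Pt3} (ht : t ∈ C) {L} (hL : Chart h t L)
    {a b c : Pt3} (hab : a ≠ b) (hac : a ≠ c) (hbc : b ≠ c) (htt : t = {a, b, c}) {y : Pt3}
    (hyK : y ∈ K) (hy : h y = 0) (hc : L c y = 0) : y ∈ convexHull ℝ (t : Set Pt3) := by
  have := P.edge_ext ht hL hab hac hbc htt hyK hy hc
  refine (hL.hull y).2 ⟨hy, fun v hv => ?_⟩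
  rw [htt] at hv
  simp only [Finset.mem_insert, Finset.mem_singleton] at hv
  rcases hv with rfl | rfl | rfl
  · exact this.1
  · exact this.2
  · exact hc.ge

theorem edge_pos (P : Pl V K h C A B) {t : Finset Pt3} (ht : t ∈ C) {L} (hL : Chart h t L)
    {a b c : Pt3} (hab : a ≠ b) (hac : a ≠ c) (hbc : b ≠ c) (htt : t = {a, b, c}) {y : Pt3}
    (hyK : y ∈ K) (hy : h y = 0) (hc : L c y = 0) (hyV : y ∉ V) : 0 < L a y ∧ 0 < L b y := by
  have := P.edge_ext ht hL hab hac hbc htt hyK hy hc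
  obtain ⟨e1, e2, e3⟩ := hL.eval3 hab hac hbc htt hy
  have haV : a ∈ V := P.sub t ht (by simp [htt])
  have hbV : b ∈ V := P.sub t ht (by simp [htt])
  refine ⟨lt_of_le_of_ne this.1 fun e => hyV ?_, lt_of_le_of_ne this.2 fun e => hyV ?_⟩
  · have : L b y = 1 := by linarith
    rw [← e, hc, this] at e2
    simp at e2
    exact e2 ▸ hbV
  · have : L a y = 1 := by linarith
    rw [← e, hc, this] at e2
    simp at e2
    exact e2 ▸ haV

theorem ot_K (P : Pl V K h C A B) {t : Finset Pt3} (ht : t ∈ C) {x : Pt3}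
    (hx : x ∈ convexHull ℝ (t : Set Pt3)) : x ∈ K :=
  P.M_sub_K (hull_sub_M ht hx)

/-- Some triangle of the component crosses each edge through a relative interior point. -/
theorem crossing (P : Pl V K h C A B) {z : Pt3} (hz : h z = 0)
    (hU : convexHull ℝ (W C) ∈ 𝓝[{x | h x = 0}] z)
    {t : Finset Pt3} (ht : t ∈ C) {L} (hL : Chart h t L)
    {a b c : Pt3} (hab : a ≠ b) (hac : a ≠ c) (hbc : b ≠ c) (htt : t = {a, b, c})
    (hc : L c z = 0) :
    ∃ s ∈ C, ∃ y ∈ ot s, h y = 0 ∧ L c y = 0 := by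
  by_contra hcon
  push Not at hcon
  have hne : ∀ s ∈ C, ∀ y ∈ ot s, L c y ≠ 0 := by
    intro s hs y hy
    obtain ⟨L', hL'⟩ := P.chart s hs
    exact hcon s hs y hy ((hL'.oint y).1 hy).1
  have hct : c ∈ t := by simp [htt]
  have hall : ∀ s ∈ C, ∀ x ∈ ot s, 0 < L c x := by
    intro s hs
    have hr := P.conn t ht s hs
    induction hr with
    | refl => intro x hx; exact ((hL.oint x).1 hx).2 c hct
    | tail _ hst ih =>
      rename_i s1 s2 _
      obtain ⟨h1, h2, y, hy1, hy2⟩ := hst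
      have hy := ih h1 y hy1
      obtain ⟨L', hL'⟩ := P.chart s2 h2
      intro x hx
      by_contra hx0
      push Not at hx0
      have hpre := hL'.convex_ot.isPreconnected
      obtain ⟨w, hw, hw0⟩ := hpre.intermediate_value hx hy2 (aff_cont (L c)).continuousOn
        (show (0:ℝ) ∈ Icc (L c x) (L c y) from ⟨hx0, hy.le⟩)
      exact hne s2 h2 w hw hw0
  have hW : ∀ x ∈ W C, 0 ≤ L c x := by
    intro x hx
    simp only [W, mem_iUnion] at hx
    obtain ⟨s, hs, hx⟩ := hx
    obtain ⟨L', hL'⟩ := P.chart s hs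
    have : closure (ot s) ⊆ {x | 0 ≤ L c x} :=
      closure_minimal (fun x hx => (hall s hs x hx).le)
        (isClosed_le continuous_const (aff_cont (L c)))
    exact this (hL'.hull_sub_closure (subset_convexHull ℝ _ hx))
  have hq : h (z + (-1:ℝ) • (c - z)) = 0 := by rw [aff_seg, hz, hL.hv c hct]; ring
  obtain ⟨δ, h1, h2⟩ := ((nh_seg hU hz hq).and self_mem_nhdsWithin).exists
  have h2 : 0 < δ := h2
  have h3 := aff_hull_nonneg (L c) hW h1
  rw [aff_seg, aff_seg, hc, hL.self c hct] at h3
  linarith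

theorem R_nhds_of_ot (P : Pl V K h C A B) {t : Finset Pt3} (ht : t ∈ C) {x : Pt3}
    (hx : x ∈ ot t) : R C ∈ 𝓝[{x | h x = 0}] x := by
  obtain ⟨L, hL⟩ := P.chart t ht
  exact mem_of_superset (hL.ne_mem_nhds ((hL.oint x).1 hx).2)
    (subset_biUnion_of_mem (u := fun t : Finset Pt3 => convexHull ℝ (t : Set Pt3)) ht)

theorem ot_not_vert (P : Pl V K h C A B) {t : Finset Pt3} (ht : t ∈ C) {x : Pt3}
    (hx : x ∈ ot t) : x ∉ V := by
  obtain ⟨L, hL⟩ := P.chart t ht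
  refine P.not_vert ((hL.oint x).1 hx).1 (mem_of_superset (P.R_nhds_of_ot ht hx) ?_)
  intro y hy
  obtain ⟨s, hs, hy⟩ := mem_R.1 hy
  exact hull_sub_M hs hy

/-- `y` in an open edge of `t`, and a point on the side of `t`, move into `ot t`. -/
theorem edge_ev {t : Finset Pt3} {L} (hL : Chart h t L)
    {a b c : Pt3} (htt : t = {a, b, c}) {y q : Pt3} (hy : h y = 0) (ha : 0 < L a y)
    (hb : 0 < L b y) (hc : 0 ≤ L c y) (hq : h q = 0) (hqc : 0 < L c q) :
    ∀ᶠ δ in 𝓝[>] (0:ℝ), y + δ • (q - y) ∈ ot t := by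
  filter_upwards [ev_pos (L a) y q (Or.inl ha), ev_pos (L b) y q (Or.inl hb),
    ev_pos (L c) y q (Or.inr ⟨hc, hqc⟩)] with δ h1 h2 h3
  refine (hL.oint _).2 ⟨hL.hz_ev hy hq δ, fun v hv => ?_⟩
  rw [htt] at hv
  simp only [Finset.mem_insert, Finset.mem_singleton] at hv
  rcases hv with rfl | rfl | rfl
  · exact h1
  · exact h2
  · exact h3

/-- Main local step: the region is relatively open inside the relative interior of the hull. -/
theorem open_step (P : Pl V K h C A B) {z : Pt3} (hz : h z = 0)
    (hU : convexHull ℝ (W C) ∈ 𝓝[{x | h x = 0}] z) (hR : z ∈ R C) :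
    R C ∈ 𝓝[{x | h x = 0}] z := by
  have hzV := P.not_vert hz hU
  have hzK : z ∈ K := by
    obtain ⟨t, ht, hzt⟩ := mem_R.1 hR
    exact P.ot_K ht hzt
  obtain ⟨t, htA, hzt⟩ : ∃ t ∈ A, z ∈ convexHull ℝ (t : Set Pt3) := by
    obtain ⟨t, ht, hzt⟩ := mem_R.1 hR
    exact P.covA t ht z hzt
  have ht := P.ac htA
  obtain ⟨L, hL⟩ := P.chart t ht
  by_cases hzo : z ∈ ot t
  · exact P.R_nhds_of_ot ht hzo
  obtain ⟨a, b, c, hab, hac, hbc, htt, hza, hzb, hzc⟩ :=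
    hL.edge hzt hzo (fun hh => hzV (P.sub t ht hh))
  have hct : c ∈ t := by simp [htt]
  obtain ⟨s, hs, y, hys, hy0, hyc⟩ := P.crossing hz hU ht hL hab hac hbc htt hzc
  have hyV := P.ot_not_vert hs hys
  have hyK := P.ot_K hs (intrinsicInterior_subset hys)
  have hRy := P.R_nhds_of_ot hs hys
  obtain ⟨hya, hyb⟩ := P.edge_pos ht hL hab hac hbc htt hyK hy0 hyc hyV
  -- a triangle of `A` on the other side at `y`
  have hq : h (y + (-1:ℝ) • (c - y)) = 0 := by rw [aff_seg, hy0, hL.hv c hct]; ring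
  set q := y + (-1:ℝ) • (c - y) with hqdef
  have hqc : L c q = -1 := by rw [hqdef, aff_seg, hyc, hL.self c hct]; ring
  have hAfin : A.Finite := P.fin.subset P.ac
  have hev : ∀ᶠ δ in 𝓝[>] (0:ℝ), ∃ s ∈ A, y + δ • (q - y) ∈ convexHull ℝ (s : Set Pt3) := by
    filter_upwards [nh_seg hRy hy0 hq] with δ hδ
    obtain ⟨s', hs', hh⟩ := mem_R.1 hδ
    exact P.covA s' hs' _ hh
  obtain ⟨t4, ht4A, hfr⟩ : ∃ t4 ∈ A, ∃ᶠ δ in 𝓝[>] (0:ℝ),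
      y + δ • (q - y) ∈ convexHull ℝ (t4 : Set Pt3) := by
    by_contra hcon
    push Not at hcon
    have : ∀ᶠ δ in 𝓝[>] (0:ℝ), ∀ s ∈ A, y + δ • (q - y) ∉ convexHull ℝ (s : Set Pt3) := by
      rw [Filter.eventually_all_finite hAfin]
      intro s hs
      have := hcon s hs
      exact this
    obtain ⟨δ, ⟨s, hs, h1⟩, h2⟩ := (hev.and this).exists
    exact h2 s hs h1
  have ht4 := P.ac ht4A
  obtain ⟨L4, hL4⟩ := P.chart t4 ht4
  have hy4 : y ∈ convexHull ℝ (t4 : Set Pt3) :=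
    (hull_closed t4).mem_of_frequently_of_tendsto hfr (tendsto_seg y q)
  obtain ⟨δ, hδ4, hδ⟩ := (hfr.and_eventually self_mem_nhdsWithin).exists
  have hδ : 0 < δ := hδ
  set r := y + δ • (q - y) with hrdef
  have hrc : L c r < 0 := by
    rw [hrdef, aff_seg, hyc, hqc]; linarith
  have hne : t4 ≠ t := by
    rintro rfl
    have := ((hL.hull _).1 hδ4).2 c hct
    linarith
  have hyt : y ∈ convexHull ℝ (t : Set Pt3) := P.edge_hull ht hL hab hac hbc htt hyK hy0 hyc
  have hyo4 : y ∉ ot t4 := fun hh => hne (P.sepA t4 ht4A t htA y hh hyt)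
  obtain ⟨a4, b4, c4, hab4, hac4, hbc4, htt4, hya4, hyb4, hyc4⟩ :=
    hL4.edge hy4 hyo4 (fun hh => hyV (P.sub t4 ht4 hh))
  have hle : ∀ v ∈ t4, L c v ≤ 0 := by
    intro v hv
    by_contra hcon
    push Not at hcon
    obtain ⟨ε, h1, h2⟩ := ((edge_ev hL htt hy0 hya hyb hyc.ge (hL4.hv v hv) hcon).and
      (ev_mem (convex_convexHull ℝ _) hy4 (subset_convexHull ℝ _ hv))).exists
    exact hne (P.sepA t htA t4 ht4A _ h1 h2).symm
  have ha4 := hle a4 (by simp [htt4])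
  have hb4 := hle b4 (by simp [htt4])
  have hc4 := hle c4 (by simp [htt4])
  have ey := (hL4.eval3 hab4 hac4 hbc4 htt4 hy0).2.2 (L c)
  rw [hyc, hyc4] at ey
  have ha40 : L c a4 = 0 := by nlinarith
  have hb40 : L c b4 = 0 := by nlinarith
  have hr0 : h r = 0 := ((hL4.hull _).1 hδ4).1
  have her := (hL4.eval3 hab4 hac4 hbc4 htt4 hr0).2.2 (L c)
  rw [ha40, hb40] at her
  have hc4neg : L c c4 < 0 := by
    refine lt_of_le_of_ne hc4 fun e => ?_
    rw [e] at her
    linarith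
  have hzz := (hL4.eval3 hab4 hac4 hbc4 htt4 hz).2.2 (L c)
  rw [ha40, hb40, hzc] at hzz
  have hz4 : L4 c4 z = 0 := by
    have : L4 c4 z * L c c4 = 0 := by linarith
    rcases mul_eq_zero.1 this with h | h
    · exact h
    · linarith
  obtain ⟨hza4, hzb4⟩ := P.edge_pos ht4 hL4 hab4 hac4 hbc4 htt4 hzK hz hz4 hzV
  have E1 := Filter.Eventually.filter_mono (nhdsWithin_le_nhds (s := {x | h x = 0}))
    ((aff_cont (L a)).continuousAt.eventually (lt_mem_nhds hza))
  have E2 := Filter.Eventually.filter_mono (nhdsWithin_le_nhds (s := {x | h x = 0}))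
    ((aff_cont (L b)).continuousAt.eventually (lt_mem_nhds hzb))
  have E3 := Filter.Eventually.filter_mono (nhdsWithin_le_nhds (s := {x | h x = 0}))
    ((aff_cont (L4 a4)).continuousAt.eventually (lt_mem_nhds hza4))
  have E4 := Filter.Eventually.filter_mono (nhdsWithin_le_nhds (s := {x | h x = 0}))
    ((aff_cont (L4 b4)).continuousAt.eventually (lt_mem_nhds hzb4))
  filter_upwards [self_mem_nhdsWithin, E1, E2, E3, E4] with x hx e1 e2 e3 e4
  have hx : h x = 0 := hx
  rcases le_total 0 (L c x) with hh | hh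
  · refine mem_R.2 ⟨t, ht, (hL.hull x).2 ⟨hx, fun v hv => ?_⟩⟩
    rw [htt] at hv
    simp only [Finset.mem_insert, Finset.mem_singleton] at hv
    rcases hv with rfl | rfl | rfl
    · exact le_of_lt e1
    · exact le_of_lt e2
    · exact hh
  · have hxx := (hL4.eval3 hab4 hac4 hbc4 htt4 hx).2.2 (L c)
    rw [ha40, hb40] at hxx
    have hx4 : 0 ≤ L4 c4 x := by
      by_contra hcon
      push Not at hcon
      nlinarith
    refine mem_R.2 ⟨t4, ht4, (hL4.hull x).2 ⟨hx, fun v hv => ?_⟩⟩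
    rw [htt4] at hv
    simp only [Finset.mem_insert, Finset.mem_singleton] at hv
    rcases hv with rfl | rfl | rfl
    · exact le_of_lt e3
    · exact le_of_lt e4
    · exact hx4

theorem U_seg (P : Pl V K h C A B) {z₀ z₁ : Pt3} (hz : h z₀ = 0)
    (hU : convexHull ℝ (W C) ∈ 𝓝[{x | h x = 0}] z₀) (hz₁ : z₁ ∈ convexHull ℝ (W C)) {s : ℝ}
    (hs0 : 0 ≤ s) (hs1 : s < 1) :
    convexHull ℝ (W C) ∈ 𝓝[{x | h x = 0}] (z₀ + s • (z₁ - z₀)) := by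
  have h1s : 0 < 1 - s := by linarith
  have hz1 := P.hM hz₁
  have hc : Continuous (fun x : Pt3 => z₁ + (1 - s)⁻¹ • (x - z₁)) := by fun_prop
  have hval : z₁ + (1 - s)⁻¹ • (z₀ + s • (z₁ - z₀) - z₁) = z₀ := by
    have : z₀ + s • (z₁ - z₀) - z₁ = (1 - s) • (z₀ - z₁) := by module
    rw [this, smul_smul, inv_mul_cancel₀ h1s.ne']; module
  have ht : Tendsto (fun x : Pt3 => z₁ + (1 - s)⁻¹ • (x - z₁))
      (𝓝[{x | h x = 0}] (z₀ + s • (z₁ - z₀))) (𝓝[{x | h x = 0}] z₀) := by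
    refine tendsto_nhdsWithin_iff.2 ⟨?_, ?_⟩
    · have := hc.tendsto (z₀ + s • (z₁ - z₀))
      rw [hval] at this
      exact this.mono_left nhdsWithin_le_nhds
    · filter_upwards [self_mem_nhdsWithin] with x hx
      have hx : h x = 0 := hx
      change h _ = 0
      rw [aff_seg, hx, hz1]; ring
  filter_upwards [ht.eventually hU] with x hx
  have e : x = z₁ + (1 - s) • ((z₁ + (1 - s)⁻¹ • (x - z₁)) - z₁) := by
    rw [add_sub_cancel_left, smul_smul, mul_inv_cancel₀ h1s.ne']; module
  rw [e]
  exact seg_mem (convex_convexHull ℝ _) hz₁ hx h1s.le (by linarith)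

theorem region_eq (P : Pl V K h C A B) : R C = convexHull ℝ (W C) := by
  apply Subset.antisymm
  · intro x hx
    obtain ⟨t, ht, hx⟩ := mem_R.1 hx
    exact hull_sub_M ht hx
  · intro z₁ hz₁
    obtain ⟨t, ht⟩ := P.ne
    obtain ⟨L, hL⟩ := P.chart t ht
    obtain ⟨z₀, hz₀⟩ := hL.ot_nonempty
    have hz0 := ((hL.oint z₀).1 hz₀).1
    have hR0 := P.R_nhds_of_ot ht hz₀
    have hU0 : convexHull ℝ (W C) ∈ 𝓝[{x | h x = 0}] z₀ := by
      refine mem_of_superset hR0 fun y hy => ?_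
      obtain ⟨s, hs, hy⟩ := mem_R.1 hy
      exact hull_sub_M hs hy
    have hc : Continuous (fun s : ℝ => z₀ + s • (z₁ - z₀)) := by fun_prop
    have hz1 := P.hM hz₁
    have key : Icc (0:ℝ) 1 ⊆ (fun s : ℝ => z₀ + s • (z₁ - z₀)) ⁻¹' (R C) := by
      apply IsClosed.Icc_subset_of_forall_mem_nhdsWithin
      · exact (P.R_closed.preimage hc).inter isClosed_Icc
      · simp only [mem_preimage, zero_smul, add_zero]
        exact mem_R.2 ⟨t, ht, intrinsicInterior_subset hz₀⟩
      · rintro s ⟨hs, hs0, hs1⟩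
        have hU := P.U_seg hz0 hU0 hz₁ hs0 hs1
        have hzs : h (z₀ + s • (z₁ - z₀)) = 0 := by rw [aff_seg, hz0, hz1]; ring
        have hO := P.open_step hzs hU hs
        have ht : Tendsto (fun s : ℝ => z₀ + s • (z₁ - z₀)) (𝓝[>] s)
            (𝓝[{x | h x = 0}] (z₀ + s • (z₁ - z₀))) := by
          refine tendsto_nhdsWithin_iff.2 ⟨(hc.tendsto s).mono_left nhdsWithin_le_nhds, ?_⟩
          refine Eventually.of_forall fun s' => ?_
          change h _ = 0
          rw [aff_seg, hz0, hz1]; ring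
        exact ht hO
    have := key ⟨zero_le_one, le_refl (1:ℝ)⟩
    simpa using this

/-- Any direction in the plane at a relative interior point leads into some open triangle. -/
theorem dir_step (P : Pl V K h C A B) {z v : Pt3} (hz : h z = 0)
    (hU : convexHull ℝ (W C) ∈ 𝓝[{x | h x = 0}] z) (hv : h.linear v = 0) (hv0 : v ≠ 0) :
    ∃ t ∈ C, ∃ σ : ℝ, ∀ᶠ δ in 𝓝[>] (0:ℝ), z + (δ * σ) • v ∈ ot t := by
  have hzV := P.not_vert hz hU
  have hzM : z ∈ convexHull ℝ (W C) := mem_of_mem_nhdsWithin hz hU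
  have hzK := P.M_sub_K hzM
  have hzR : z ∈ R C := P.region_eq ▸ hzM
  have hq : ∀ σ : ℝ, h (z + σ • v) = 0 := fun σ => by rw [aff_add, hz, hv]; ring
  have hconv : ∀ δ σ : ℝ, z + (δ * σ) • v = z + δ • (z + σ • v - z) := fun δ σ => by module
  -- analysis for a single triangle
  have one : ∀ t ∈ C, z ∈ convexHull ℝ (t : Set Pt3) →
      (∃ σ : ℝ, ∀ᶠ δ in 𝓝[>] (0:ℝ), z + (δ * σ) • v ∈ ot t) ∨
      ∃ L a b c, Chart h t L ∧ a ≠ b ∧ a ≠ c ∧ b ≠ c ∧ t = {a, b, c} ∧ L c z = 0 ∧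
        (L c).linear v = 0 := by
    intro t ht hzt
    obtain ⟨L, hL⟩ := P.chart t ht
    by_cases hzo : z ∈ ot t
    · left
      refine ⟨1, ?_⟩
      filter_upwards [hL.ot_ev hzo (hq 1)] with δ hδ
      rwa [hconv]
    obtain ⟨a, b, c, hab, hac, hbc, htt, hza, hzb, hzc⟩ :=
      hL.edge hzt hzo (fun hh => hzV (P.sub t ht hh))
    by_cases hlin : (L c).linear v = 0
    · right
      exact ⟨L, a, b, c, hL, hab, hac, hbc, htt, hzc, hlin⟩
    · left
      refine ⟨(L c).linear v, ?_⟩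
      have hpos : 0 < L c (z + ((L c).linear v) • v) := by
        rw [aff_add, hzc, zero_add]
        exact mul_self_pos.2 hlin
      filter_upwards [edge_ev hL htt hz hza hzb hzc.ge (hq _) hpos] with δ hδ
      rwa [hconv]
  obtain ⟨t₀, ht₀, hzt₀⟩ := mem_R.1 hzR
  obtain ⟨t, htA, hzt⟩ := P.covA t₀ ht₀ z hzt₀
  obtain ⟨t', htB, hzt'⟩ := P.covB t₀ ht₀ z hzt₀
  rcases one t (P.ac htA) hzt with h1 | ⟨L, a, b, c, hL, hab, hac, hbc, htt, hzc, hlin⟩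
  · exact ⟨t, P.ac htA, h1⟩
  rcases one t' (P.bc htB) hzt' with h1 | ⟨L', a', b', c', hL', hab', hac', hbc', htt', hzc', hlin'⟩
  · exact ⟨t', P.bc htB, h1⟩
  exfalso
  obtain ⟨s, hs, y, hys, hy0, hyc⟩ := P.crossing hz hU (P.ac htA) hL hab hac hbc htt hzc
  have hyK := P.ot_K hs (intrinsicInterior_subset hys)
  have hct : c ∈ t := by simp [htt]
  have hct' : c' ∈ t' := by simp [htt']
  have par : ∃ r : ℝ, y = z + r • v := by
    have hx1 : h (z + (1:ℝ) • v) = 0 := hq 1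
    have hcx1 : L c (z + (1:ℝ) • v) = 0 := by rw [aff_add, hzc, hlin]; ring
    obtain ⟨z1, z2, -⟩ := hL.eval3 hab hac hbc htt hz
    obtain ⟨x1, x2, -⟩ := hL.eval3 hab hac hbc htt hx1
    obtain ⟨y1, y2, -⟩ := hL.eval3 hab hac hbc htt hy0
    rw [hzc] at z1 z2
    rw [hcx1] at x1 x2
    rw [hyc] at y1 y2
    set α := L b (z + (1:ℝ) • v) with hα
    have ez : z = a + (L b z) • (b - a) := by
      have : L a z = 1 - L b z := by linarith
      rw [this] at z2
      exact z2.symm.trans (by module)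
    have ey : y = a + (L b y) • (b - a) := by
      have : L a y = 1 - L b y := by linarith
      rw [this] at y2
      exact y2.symm.trans (by module)
    have ex : z + (1:ℝ) • v = a + α • (b - a) := by
      have : L a (z + (1:ℝ) • v) = 1 - α := by linarith
      rw [this] at x2
      rw [← x2]
      module
    have ev : v = (α - L b z) • (b - a) := by
      have : v = (z + (1:ℝ) • v) - z := by module
      rw [this, ex]
      nth_rewrite 1 [ez]
      module
    have hne : α - L b z ≠ 0 := by
      intro e
      rw [e, zero_smul] at ev
      exact hv0 ev
    refine ⟨(L b y - L b z) / (α - L b z), ?_⟩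
    have : ((L b y - L b z) / (α - L b z)) • v = (L b y - L b z) • (b - a) := by
      conv_lhs => rw [ev]
      rw [smul_smul, div_mul_cancel₀ _ hne]
    rw [this]
    have : z + (L b y - L b z) • (b - a) = a + L b y • (b - a) := by
      conv_lhs => enter [1]; rw [ez]
      module
    rw [this, ← ey]
  obtain ⟨r, hr⟩ := par
  have hyc' : L' c' y = 0 := by rw [hr, aff_add, hzc', hlin']; ring
  have hyt := P.edge_hull (P.ac htA) hL hab hac hbc htt hyK hy0 hyc
  have hyt' := P.edge_hull (P.bc htB) hL' hab' hac' hbc' htt' hyK hy0 hyc'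
  rcases P.split s hs with hsA | hsB
  · have := P.sepA s hsA t htA y hys hyt
    subst this
    have := ((hL.oint y).1 hys).2 c hct
    linarith
  · have := P.sepB s hsB t' htB y hys hyt'
    subst this
    have := ((hL'.oint y).1 hys).2 c' hct'
    linarith

end Pl


/-- `t` is a face of a tetrahedron of `D` with apex `p`, in the plane `h = 0`, and the
tetrahedron is on the positive side. -/
structure UpP (D : Finset (Finset Pt3)) (h : Pt3 →ᵃ[ℝ] ℝ) (t : Finset Pt3) (p : Pt3) : Prop where
  np : p ∉ t
  mem : insert p t ∈ D
  card : t.card = 3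
  hv : ∀ v ∈ t, h v = 0
  pos : 0 < h p

/-- `t` bounds a tetrahedron on the positive side of `h`. -/
def Up (D : Finset (Finset Pt3)) (h : Pt3 →ᵃ[ℝ] ℝ) (t : Finset Pt3) : Prop := ∃ p, UpP D h t p

theorem UpP.tri {D : Finset (Finset Pt3)} {h : Pt3 →ᵃ[ℝ] ℝ} {t : Finset Pt3} {p : Pt3}
    (u : UpP D h t p) : t ∈ triOf D := by
  simp only [triOf, Finset.mem_biUnion, Finset.mem_powersetCard]
  exact ⟨_, u.mem, Finset.subset_insert _ _, u.card⟩

theorem apex_of_sub {σ t : Finset Pt3} (hσ : σ.card = 4) (hs : t ⊆ σ) (hc : t.card = 3) :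
    ∃ p, p ∉ t ∧ insert p t = σ := by
  have h1 : (σ \ t).card = 1 := by
    rw [Finset.card_sdiff_of_subset hs]; omega
  obtain ⟨p, hp⟩ := Finset.card_eq_one.1 h1
  refine ⟨p, ?_, ?_⟩
  · have : p ∈ σ \ t := by rw [hp]; simp
    exact (Finset.mem_sdiff.1 this).2
  · rw [Finset.insert_eq, ← hp, Finset.sdiff_union_of_subset hs]

theorem tri_apex {V : Finset Pt3} {D : Finset (Finset Pt3)} (hD : IsDissection V D)
    {t : Finset Pt3} (ht : t ∈ triOf D) :
    ∃ p, p ∉ t ∧ insert p t ∈ D ∧ t.card = 3 := by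
  simp only [triOf, Finset.mem_biUnion, Finset.mem_powersetCard] at ht
  obtain ⟨σ, hσ, hs, hc⟩ := ht
  obtain ⟨p, hp, e⟩ := apex_of_sub (hD.1 σ hσ).1.1 hs hc
  exact ⟨p, hp, e ▸ hσ, hc⟩

theorem tet_chart {h : Pt3 →ᵃ[ℝ] ℝ} {t : Finset Pt3} {p : Pt3} {L : Pt3 → Pt3 →ᵃ[ℝ] ℝ}
    (hp : p ∉ t) (hc : t.card = 3) (hv : ∀ v ∈ t, h v = 0) (hp0 : h p ≠ 0)
    (l1 : ∀ v ∈ insert p t, L v v = 1)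
    (l2 : ∀ v ∈ insert p t, ∀ w ∈ insert p t, v ≠ w → L v w = 0)
    (l3 : ∀ x, ∑ v ∈ insert p t, L v x = 1) (l4 : ∀ x, ∑ v ∈ insert p t, L v x • v = x) :
    Chart h t L ∧ ∀ x, h x = L p x * h p := by
  have key : ∀ x, h x = L p x * h p := by
    intro x
    rw [aff_sum_s13 h (insert p t) (fun v => L v x) x (l3 x) (l4 x), Finset.sum_insert hp,
      Finset.sum_eq_zero, add_zero]
    intro v hv'
    rw [hv v hv', mul_zero]
  have key0 : ∀ x, h x = 0 → L p x = 0 := by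
    intro x hx
    rw [key x] at hx
    exact (mul_eq_zero.1 hx).resolve_right hp0
  refine ⟨⟨hc, hv, fun v hv' => l1 v (Finset.mem_insert_of_mem hv'), fun v hv' w hw =>
    l2 v (Finset.mem_insert_of_mem hv') w (Finset.mem_insert_of_mem hw), ?_, ?_⟩, key⟩
  · intro x hx
    have := l3 x
    rwa [Finset.sum_insert hp, key0 x hx, zero_add] at this
  · intro x hx
    have := l4 x
    rwa [Finset.sum_insert hp, key0 x hx, zero_smul, zero_add] at this

theorem UpP.chart {V : Finset Pt3} {D : Finset (Finset Pt3)} (hD : IsDissection V D)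
    {h : Pt3 →ᵃ[ℝ] ℝ} {t : Finset Pt3} {p : Pt3}
    (u : UpP D h t p) : ∃ L, Chart h t L := by
  obtain ⟨L, l1, l2, l3, l4, -, -⟩ := tet_coords (hD.1 _ u.mem).1
  exact ⟨L, (tet_chart u.np u.card u.hv u.pos.ne' l1 l2 l3 l4).1⟩

theorem exists_up {V : Finset Pt3} {D : Finset (Finset Pt3)} (hD : IsDissection V D)
    {t : Finset Pt3} (ht : t ∈ triOf D) : ∃ h p, UpP D h t p := by
  obtain ⟨p, hp, hm, hc⟩ := tri_apex hD ht
  obtain ⟨L, l1, l2, l3, l4, -, -⟩ := tet_coords (hD.1 _ hm).1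
  refine ⟨L p, p, hp, hm, hc, fun v hv => ?_, ?_⟩
  · exact l2 p (by simp) v (Finset.mem_insert_of_mem hv) (fun e => hp (e ▸ hv))
  · rw [l1 p (by simp)]; exact zero_lt_one

/-- If `h` vanishes on a triangle of `D` and `h` is not zero, the apex is on one side. -/
theorem up_or {V : Finset Pt3} {D : Finset (Finset Pt3)} (hD : IsDissection V D)
    {h : Pt3 →ᵃ[ℝ] ℝ} {q : Pt3} (hq : h q ≠ 0)
    {t : Finset Pt3} (ht : t ∈ triOf D) (hv : ∀ v ∈ t, h v = 0) : Up D h t ∨ Up D (-h) t := by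
  obtain ⟨p, hp, hm, hc⟩ := tri_apex hD ht
  rcases lt_trichotomy (h p) 0 with h0 | h0 | h0
  · right
    exact ⟨p, hp, hm, hc, fun v hv' => by simp [hv v hv'], by simpa using h0⟩
  · exfalso
    obtain ⟨L, l1, l2, l3, l4, -, -⟩ := tet_coords (hD.1 _ hm).1
    apply hq
    rw [aff_sum_s13 h _ (fun v => L v q) q (l3 q) (l4 q)]
    apply Finset.sum_eq_zero
    intro v hv'
    rcases Finset.mem_insert.1 hv' with rfl | hv'
    · rw [h0, mul_zero]
    · rw [hv v hv', mul_zero]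
  · left
    exact ⟨p, hp, hm, hc, hv, h0⟩

/-- A tetrahedron through a relative interior point of a face, reaching the side of the face. -/
theorem same_tet {V : Finset Pt3} {D : Finset (Finset Pt3)} (hD : IsDissection V D)
    {h : Pt3 →ᵃ[ℝ] ℝ} {t : Finset Pt3} {p : Pt3} (u : UpP D h t p) {x : Pt3} (hx : x ∈ ot t)
    {τ : Finset Pt3} (hτ : τ ∈ D) (hxτ : x ∈ convexHull ℝ (τ : Set Pt3)) {q : Pt3}
    (hq : q ∈ convexHull ℝ (τ : Set Pt3)) (hq0 : 0 < h q) : τ = insert p t := by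
  by_contra hne
  obtain ⟨L, l1, l2, l3, l4, l5, l6⟩ := tet_coords (hD.1 _ u.mem).1
  obtain ⟨hL, key⟩ := tet_chart u.np u.card u.hv u.pos.ne' l1 l2 l3 l4
  have hxo := (hL.oint x).1 hx
  have hp := u.pos
  have hx0 : 0 ≤ L p x := by
    have := key x
    rw [hxo.1] at this
    exact ((mul_eq_zero.1 this.symm).resolve_right hp.ne').ge
  have hpq : 0 < L p q := by
    have := key q
    rw [this] at hq0
    exact pos_of_mul_pos_left hq0 hp.le
  have ev : ∀ᶠ δ in 𝓝[>] (0:ℝ), ∀ v ∈ insert p t, 0 < L v (x + δ • (q - x)) := by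
    rw [Filter.eventually_all_finset]
    intro v hv
    rcases Finset.mem_insert.1 hv with rfl | hv
    · exact ev_pos _ _ _ (Or.inr ⟨hx0, hpq⟩)
    · exact ev_pos _ _ _ (Or.inl (hxo.2 v hv))
  obtain ⟨δ, h1, h2⟩ := (ev.and (ev_mem (convex_convexHull ℝ _) hxτ hq)).exists
  have h1 := (l6 _).2 h1
  obtain ⟨M, m1, m2, m3, m4, m5, m6⟩ := tet_coords (hD.1 _ hτ).1
  have hnei : (interior (convexHull ℝ (τ : Set Pt3))).Nonempty := by
    refine ⟨∑ v ∈ τ, (1/4:ℝ) • v, (m6 _).2 fun w hw => ?_⟩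
    have hc : τ.card = 4 := (hD.1 _ hτ).1.1
    rw [aff_sum_s13 (M w) τ (fun _ => (1/4:ℝ)) _ (by simp [hc]) rfl]
    apply Finset.sum_pos'
    · intro v hv
      by_cases e : w = v
      · subst e; rw [m1 w hw]; norm_num
      · rw [m2 w hw v hv e]; norm_num
    · exact ⟨w, hw, by rw [m1 w hw]; norm_num⟩
  have hcl : convexHull ℝ (τ : Set Pt3) ⊆ closure (interior (convexHull ℝ (τ : Set Pt3))) := by
    rw [(convex_convexHull ℝ _).closure_interior_eq_closure_of_nonempty_interior hnei]
    exact subset_closure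
  obtain ⟨y, hy1, hy2⟩ := mem_closure_iff.1 (hcl h2) _ isOpen_interior h1
  have := hD.2.1 _ hτ _ u.mem hne
  exact (Set.eq_empty_iff_forall_notMem.1 this) y ⟨hy2, hy1⟩

theorem face_eq {D : Finset (Finset Pt3)} {h : Pt3 →ᵃ[ℝ] ℝ} {t t' : Finset Pt3} {p p' : Pt3}
    (u : UpP D h t p) (u' : UpP D h t' p') (e : insert p' t' = insert p t) : t = t' := by
  have key : ∀ {t p}, UpP D h t p → (insert p t).filter (fun v => h v = 0) = t := by
    intro t p u
    ext v
    simp only [Finset.mem_filter, Finset.mem_insert]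
    constructor
    · rintro ⟨rfl | hv, h0⟩
      · exact absurd h0 u.pos.ne'
      · exact hv
    · intro hv
      exact ⟨Or.inr hv, u.hv v hv⟩
  rw [← key u, ← key u', e]

theorem up_sep {V : Finset Pt3} {D : Finset (Finset Pt3)} (hD : IsDissection V D)
    {h : Pt3 →ᵃ[ℝ] ℝ} {t t' : Finset Pt3} (u : Up D h t) (u' : Up D h t') {x : Pt3}
    (hx : x ∈ ot t) (hx' : x ∈ convexHull ℝ (t' : Set Pt3)) : t = t' := by
  obtain ⟨p, u⟩ := u
  obtain ⟨p', u'⟩ := u'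
  refine face_eq u u' (same_tet hD u hx u'.mem (q := p') ?_ ?_ u'.pos)
  · exact convexHull_mono (by simp) hx'
  · exact subset_convexHull ℝ _ (by simp)

theorem coplanar_of_zero {h : Pt3 →ᵃ[ℝ] ℝ} {t : Finset Pt3} {L} (hL : Chart h t L) {s : Set Pt3}
    (hs : ∀ x ∈ s, h x = 0) : Coplanar ℝ s := by
  obtain ⟨a, b, c, hab, hac, hbc, htt⟩ := Finset.card_eq_three.1 hL.card
  have h1 : Coplanar ℝ (t : Set Pt3) := by
    rw [htt]; push_cast; exact coplanar_triple ℝ a b c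
  have hsub : s ⊆ (affineSpan ℝ (t : Set Pt3) : Set Pt3) := by
    rw [hL.span (s := (t : Set Pt3)) (le_refl _) hL.hv]
    exact hs
  have h2 : Coplanar ℝ (affineSpan ℝ (t : Set Pt3) : Set Pt3) := by
    unfold Coplanar at h1 ⊢
    rwa [← direction_affineSpan, AffineSubspace.affineSpan_coe, direction_affineSpan]
  exact h2.subset hsub

theorem zero_of_coplanar {h : Pt3 →ᵃ[ℝ] ℝ} {t : Finset Pt3} {L} (hL : Chart h t L) {s : Set Pt3}
    (hs : Coplanar ℝ ((t : Set Pt3) ∪ s)) : ∀ x ∈ s, h x = 0 := by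
  intro q hq
  by_contra hq0
  obtain ⟨a, b, c, hab, hac, hbc, htt⟩ := Finset.card_eq_three.1 hL.card
  have hat : a ∈ t := by simp [htt]
  have htop : affineSpan ℝ ((t : Set Pt3) ∪ s) = ⊤ := by
    rw [eq_top_iff]
    intro x _
    have hqm : q ∈ affineSpan ℝ ((t : Set Pt3) ∪ s) := subset_affineSpan ℝ _ (Or.inr hq)
    have ham : a ∈ affineSpan ℝ ((t : Set Pt3) ∪ s) := subset_affineSpan ℝ _ (Or.inl hat)
    have hlin : h.linear (q - a) = h q := by
      have := h.linearMap_vsub q a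
      simp only [vsub_eq_sub] at this
      rw [this, hL.hv a hat, sub_zero]
    have hy : x + (-(h x / h q)) • (q - a) ∈ affineSpan ℝ ((t : Set Pt3) ∪ s) := by
      apply affineSpan_mono ℝ (subset_union_left : (t : Set Pt3) ⊆ _)
      have hsp := hL.span (s := (t : Set Pt3)) (le_refl _) hL.hv
      rw [← SetLike.mem_coe, hsp]
      change h _ = 0
      rw [aff_add, hlin]
      field_simp
      ring
    have hd := AffineSubspace.vsub_mem_direction hqm ham
    have := AffineSubspace.vadd_mem_of_mem_direction
      (Submodule.smul_mem _ (h x / h q) hd) hy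
    simp only [vsub_eq_sub, vadd_eq_add] at this
    convert this using 1
    module
  unfold Coplanar at hs
  rw [← direction_affineSpan, htop, AffineSubspace.direction_top, rank_top] at hs
  have h3 : Module.rank ℝ Pt3 = 3 := by
    rw [← Module.finrank_eq_rank]; simp
  rw [h3] at hs
  norm_num at hs

theorem tri_meet {V : Finset Pt3} {D : Finset (Finset Pt3)} (hD : IsDissection V D)
    {s t : Finset Pt3} (hs : s ∈ triOf D) (ht : t ∈ triOf D) {x : Pt3} (hxs : x ∈ ot s)
    (hxt : x ∈ ot t) : s = t ∨ AdjIn D s t := by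
  by_cases hst : s = t
  · exact Or.inl hst
  right
  obtain ⟨h, p, u⟩ := exists_up hD hs
  obtain ⟨h', p', u'⟩ := exists_up hD ht
  obtain ⟨L, l1, l2, l3, l4, l5, l6⟩ := tet_coords (hD.1 _ u.mem).1
  obtain ⟨hL, key⟩ := tet_chart u.np u.card u.hv u.pos.ne' l1 l2 l3 l4
  obtain ⟨L', hL'⟩ := u'.chart hD
  have hle : ∀ q ∈ t, h q ≤ 0 := by
    intro q hq
    by_contra hcon
    push Not at hcon
    have e := same_tet hD u hxs u'.mem (q := q)
      (convexHull_mono (by simp) (intrinsicInterior_subset hxt))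
      (subset_convexHull ℝ _ (by simp [hq])) hcon
    -- `p'` is a vertex of `s`
    have hp' : p' ∈ insert p s := e ▸ Finset.mem_insert_self _ _
    have hps : p' ∈ s := by
      rcases Finset.mem_insert.1 hp' with e' | e'
      · exfalso
        subst e'
        apply hst
        rw [← Finset.erase_insert u.np, ← e, Finset.erase_insert u'.np]
      · exact e'
    have h1 := ((hL.oint x).1 hxs).2 p' hps
    have h2 : L p' x = 0 := by
      refine aff_hull_zero (L p') (fun w hw => ?_) (intrinsicInterior_subset hxt)
      refine l2 p' hp' w (e ▸ Finset.mem_insert_of_mem hw) (fun e' => u'.np (e' ▸ hw))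
    linarith
  have hx0 := ((hL.oint x).1 hxs).1
  have hxo' := (hL'.oint x).1 hxt
  have hev := hL'.eval h hxo'.1
  rw [hx0] at hev
  have hz : ∀ v ∈ t, L' v x * h v = 0 :=
    (Finset.sum_eq_zero_iff_of_nonpos fun v hv =>
      mul_nonpos_of_nonneg_of_nonpos (hxo'.2 v hv).le (hle v hv)).1 hev.symm
  have hz' : ∀ v ∈ t, h v = 0 := fun v hv =>
    (mul_eq_zero.1 (hz v hv)).resolve_left (hxo'.2 v hv).ne'
  refine ⟨hs, ht, hst, coplanar_of_zero hL ?_, x, hxs, hxt⟩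
  rintro y (hy | hy)
  · exact hL.hv y hy
  · exact hz' y hy


theorem ev_not_mem {S : Set ℝ} (hS : S.Subsingleton) : ∀ᶠ ε in 𝓝[>] (0:ℝ), ε ∉ S := by
  have hf : (S \ {0}).Finite := hS.finite.subset sdiff_subset
  have h1 : (S \ {0})ᶜ ∈ 𝓝 (0:ℝ) := hf.isClosed.isOpen_compl.mem_nhds (by simp)
  filter_upwards [mem_nhdsWithin_of_mem_nhds h1, self_mem_nhdsWithin] with ε h1 h2 h3
  exact h1 ⟨h3, (ne_of_gt h2 : ε ≠ 0)⟩

theorem generic_dir {h : Pt3 →ᵃ[ℝ] ℝ} {t : Finset Pt3} {L : Pt3 → Pt3 →ᵃ[ℝ] ℝ}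
    (hL : Chart h t L) (V : Finset Pt3) :
    ∃ w : Pt3, h.linear w = 0 ∧ ∀ c ∈ V, ∀ d ∈ V, ∀ μ : ℝ, w ≠ μ • (d - c) := by
  obtain ⟨a, b, c, hab, hac, hbc, htt⟩ := Finset.card_eq_three.1 hL.card
  have ha : a ∈ t := by simp [htt]
  have hb : b ∈ t := by simp [htt]
  have hc : c ∈ t := by simp [htt]
  have lin : ∀ (f : Pt3 →ᵃ[ℝ] ℝ) (x y : Pt3), f.linear (x - y) = f x - f y := by
    intro f x y
    have := f.linearMap_vsub x y
    simpa using this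
  obtain ⟨k, hk⟩ := Infinite.exists_notMem_finset
    ((V ×ˢ V).image (fun e : Pt3 × Pt3 => (L c).linear (e.2 - e.1) / (L b).linear (e.2 - e.1)))
  refine ⟨(b - a) + k • (c - a), ?_, ?_⟩
  · rw [map_add, map_smul, lin, lin, hL.hv a ha, hL.hv b hb, hL.hv c hc]; simp
  · intro c' hc' d' hd' μ hw
    apply hk
    rw [Finset.mem_image]
    refine ⟨(c', d'), by simp [hc', hd'], ?_⟩
    have e1 := congrArg (L b).linear hw
    have e2 := congrArg (L c).linear hw
    rw [map_add, map_smul, map_smul, lin, lin (L b) c a, hL.self b hb, hL.other b hb a ha hab.symm,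
      hL.other b hb c hc hbc] at e1
    rw [map_add, map_smul, map_smul, lin, lin (L c) c a, hL.self c hc, hL.other c hc a ha hac.symm,
      hL.other c hc b hb hbc.symm] at e2
    simp only [smul_eq_mul, sub_zero, mul_zero, add_zero, zero_add, mul_one] at e1 e2
    have hne : (L b).linear (d' - c') ≠ 0 := by
      intro e; rw [e, mul_zero] at e1; exact one_ne_zero e1
    change (L c).linear (d' - c') / (L b).linear (d' - c') = k
    rw [div_eq_iff hne, e2, mul_right_comm, ← e1, one_mul]

theorem ev_avoid {w c d x : Pt3} (hw : ∀ μ : ℝ, w ≠ μ • (d - c)) :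
    ∀ᶠ ε in 𝓝[>] (0:ℝ), x + ε • w ∉ segment ℝ c d := by
  apply ev_not_mem (S := {ε : ℝ | x + ε • w ∈ segment ℝ c d})
  intro e1 h1 e2 h2
  by_contra hne
  simp only [Set.mem_ofPred_eq, segment_eq_image'] at h1 h2
  obtain ⟨a, -, ha⟩ := h1
  obtain ⟨b, -, hb⟩ := h2
  have hs : e1 - e2 ≠ 0 := sub_ne_zero.2 hne
  apply hw ((e1 - e2)⁻¹ * (a - b))
  have : (e1 - e2) • w = (a - b) • (d - c) := by
    have : (x + e1 • w) - (x + e2 • w) = (c + a • (d - c)) - (c + b • (d - c)) := by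
      simp only at ha hb
      rw [ha, hb]
    calc (e1 - e2) • w = (x + e1 • w) - (x + e2 • w) := by module
      _ = _ := this
      _ = _ := by module
  rw [mul_smul, ← this, smul_smul, inv_mul_cancel₀ hs, one_smul]

/-- Some tetrahedron lies below a relative interior point of a face. -/
theorem below {V : Finset Pt3} {D : Finset (Finset Pt3)} (hD : IsDissection V D)
    {h : Pt3 →ᵃ[ℝ] ℝ} {t : Finset Pt3} {p : Pt3} (u : UpP D h t p) {q : Pt3}
    (hq : q ∈ convexHull ℝ (V : Set Pt3)) (hq0 : h q < 0) {x : Pt3} (hx : x ∈ ot t) :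
    ∃ τ ∈ D, x ∈ convexHull ℝ (τ : Set Pt3) ∧ ∀ v ∈ τ, h v ≤ 0 := by
  have hx0 : h x = 0 := aff_hull_zero h u.hv (intrinsicInterior_subset hx)
  have hxV : x ∈ convexHull ℝ (V : Set Pt3) := by
    refine convexHull_mono ?_ (intrinsicInterior_subset hx)
    exact fun v hv => (hD.1 _ u.mem).2 (by simp [Finset.mem_coe.1 hv])
  obtain ⟨τ, hτ, hfr⟩ : ∃ τ ∈ D, ∃ᶠ δ in 𝓝[>] (0:ℝ), x + δ • (q - x) ∈ convexHull ℝ (τ : Set Pt3) := by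
    by_contra hcon
    push Not at hcon
    have : ∀ᶠ δ in 𝓝[>] (0:ℝ), ∀ τ ∈ D, x + δ • (q - x) ∉ convexHull ℝ (τ : Set Pt3) := by
      rw [Filter.eventually_all_finset]
      intro τ hτ
      exact hcon τ hτ
    obtain ⟨δ, h1, h2⟩ := (this.and (ev_mem (convex_convexHull ℝ _) hxV hq)).exists
    rw [← hD.2.2] at h2
    simp only [mem_iUnion] at h2
    obtain ⟨τ, hτ, h2⟩ := h2
    exact h1 τ hτ h2
  have hxτ : x ∈ convexHull ℝ (τ : Set Pt3) :=
    (hull_closed τ).mem_of_frequently_of_tendsto hfr (tendsto_seg x q)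
  refine ⟨τ, hτ, hxτ, fun v hv => ?_⟩
  by_contra hcon
  push Not at hcon
  have e := same_tet hD u hx hτ hxτ (subset_convexHull ℝ _ hv) hcon
  obtain ⟨δ, h1, h2⟩ := (hfr.and_eventually self_mem_nhdsWithin).exists
  have h2 : 0 < δ := h2
  have : 0 ≤ h (x + δ • (q - x)) := by
    refine aff_hull_nonneg h (fun v hv => ?_) h1
    rw [e] at hv
    rcases Finset.mem_insert.1 (Finset.mem_coe.1 hv) with rfl | hv
    · exact u.pos.le
    · exact (u.hv v hv).ge
  rw [aff_seg, hx0] at this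
  nlinarith

theorem below_face {V : Finset Pt3} {D : Finset (Finset Pt3)} (hD : IsDissection V D)
    {h : Pt3 →ᵃ[ℝ] ℝ} {t : Finset Pt3} {p : Pt3} (u : UpP D h t p) {q : Pt3}
    (hq : q ∈ convexHull ℝ (V : Set Pt3)) (hq0 : h q < 0) {x : Pt3} (hx : x ∈ ot t) :
    (∃ s, Up D (-h) s ∧ (t = s ∨ AdjIn D t s) ∧ x ∈ convexHull ℝ (s : Set Pt3)) ∨
    ∃ c ∈ V, ∃ d ∈ V, x ∈ segment ℝ c d := by
  obtain ⟨τ, hτ, hxτ, hle⟩ := below hD u hq hq0 hx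
  have hx0 : h x = 0 := aff_hull_zero h u.hv (intrinsicInterior_subset hx)
  obtain ⟨M, m1, m2, m3, m4, m5, m6⟩ := tet_coords (hD.1 _ hτ).1
  have hc4 : τ.card = 4 := (hD.1 _ hτ).1.1
  have hM := (m5 x).1 hxτ
  have hev := aff_sum_s13 h τ (fun v => M v x) x (m3 x) (m4 x)
  rw [hx0] at hev
  have hz : ∀ v ∈ τ, M v x * h v = 0 :=
    (Finset.sum_eq_zero_iff_of_nonpos fun v hv =>
      mul_nonpos_of_nonneg_of_nonpos (hM v hv) (hle v hv)).1 hev.symm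
  set s := τ.filter (fun v => h v = 0) with hs
  have hsτ : s ⊆ τ := Finset.filter_subset _ _
  have hsV : ∀ v ∈ s, v ∈ V := fun v hv => (hD.1 _ hτ).2 (hsτ hv)
  have hout : ∀ v ∈ τ, v ∉ s → M v x = 0 := by
    intro v hv hvs
    refine (mul_eq_zero.1 (hz v hv)).resolve_right fun e => hvs ?_
    rw [hs, Finset.mem_filter]; exact ⟨hv, e⟩
  have hxs : x ∈ convexHull ℝ (s : Set Pt3) := by
    have e1 : ∑ v ∈ s, M v x = 1 := by
      rw [← m3 x]
      exact Finset.sum_subset hsτ hout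
    have e2 : ∑ v ∈ s, M v x • v = x := by
      rw [← m4 x]
      conv_rhs => rw [← m4 x]
      rw [m4 x]
      exact Finset.sum_subset hsτ (fun v hv hvs => by rw [hout v hv hvs, zero_smul])
    have := (convex_convexHull ℝ (s : Set Pt3)).sum_mem (fun v hv => hM v (hsτ hv)) e1
      (fun v hv => subset_convexHull ℝ _ hv)
    rwa [e2] at this
  have hne : s ≠ τ := by
    intro e
    have : h q = 0 := by
      rw [aff_sum_s13 h τ (fun v => M v q) q (m3 q) (m4 q)]
      apply Finset.sum_eq_zero
      intro v hv
      rw [← e] at hv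
      rw [(Finset.mem_filter.1 hv).2, mul_zero]
    linarith
  have hlt : s.card < 4 := hc4 ▸ Finset.card_lt_card (Finset.ssubset_iff_subset_ne.2 ⟨hsτ, hne⟩)
  have hcases : s.card = 0 ∨ s.card = 1 ∨ s.card = 2 ∨ s.card = 3 := by omega
  rcases hcases with e | e | e | e
  · rw [Finset.card_eq_zero] at e
    rw [e] at hxs
    simp at hxs
  · obtain ⟨c, hc⟩ := Finset.card_eq_one.1 e
    right
    rw [hc] at hxs
    have hcV := hsV c (by simp [hc])
    refine ⟨c, hcV, c, hcV, ?_⟩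
    simpa using hxs
  · obtain ⟨c, d, -, hc⟩ := Finset.card_eq_two.1 e
    right
    rw [hc] at hxs
    refine ⟨c, hsV c (by simp [hc]), d, hsV d (by simp [hc]), ?_⟩
    rw [Finset.coe_pair, convexHull_pair] at hxs
    exact hxs
  · left
    obtain ⟨p', hp', ep⟩ := apex_of_sub hc4 hsτ e
    have hhs : ∀ v ∈ s, h v = 0 := fun v hv => (Finset.mem_filter.1 hv).2
    have hp'τ : p' ∈ τ := by rw [← ep]; simp
    have u' : UpP D (-h) s p' := by
      refine ⟨hp', ep ▸ hτ, e, fun v hv => by simp [hhs v hv], ?_⟩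
      have h1 := hle p' hp'τ
      have h2 : h p' ≠ 0 := fun e0 => hp' (by rw [hs, Finset.mem_filter]; exact ⟨hp'τ, e0⟩)
      have : h p' < 0 := lt_of_le_of_ne h1 h2
      simpa using this
    refine ⟨s, ⟨p', u'⟩, ?_, hxs⟩
    obtain ⟨L, hL⟩ := u.chart hD
    obtain ⟨L', hL'⟩ := u'.chart hD
    obtain ⟨y, hy⟩ := hL'.ot_nonempty
    have hy0 : h y = 0 := aff_hull_zero h hhs (intrinsicInterior_subset hy)
    obtain ⟨δ, h1, h2⟩ := ((hL.ot_ev hx hy0).and (hL'.hull_ev hxs hy)).exists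
    exact tri_meet hD u.tri u'.tri h1 h2

theorem cover_s13 {V : Finset Pt3} {D : Finset (Finset Pt3)} (hD : IsDissection V D)
    {h : Pt3 →ᵃ[ℝ] ℝ} {t : Finset Pt3} (u : Up D h t) {q : Pt3}
    (hq : q ∈ convexHull ℝ (V : Set Pt3)) (hq0 : h q < 0) {x : Pt3}
    (hx : x ∈ convexHull ℝ (t : Set Pt3)) :
    ∃ s, Up D (-h) s ∧ (t = s ∨ AdjIn D t s) ∧ x ∈ convexHull ℝ (s : Set Pt3) := by
  obtain ⟨p, u⟩ := u
  obtain ⟨L, hL⟩ := u.chart hD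
  set F := (triOf D).filter (fun s => Up D (-h) s ∧ (t = s ∨ AdjIn D t s)) with hF
  set G : Set Pt3 := ⋃ s ∈ F, convexHull ℝ (s : Set Pt3) with hG
  have hGc : IsClosed G := isClosed_biUnion_finset fun s _ => hull_closed s
  have hGm : ∀ y, y ∈ G ↔
      ∃ s, Up D (-h) s ∧ (t = s ∨ AdjIn D t s) ∧ y ∈ convexHull ℝ (s : Set Pt3) := by
    intro y
    simp only [hG, hF, mem_iUnion, Finset.mem_filter, exists_prop]
    constructor
    · rintro ⟨s, ⟨-, h1, h2⟩, h3⟩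
      exact ⟨s, h1, h2, h3⟩
    · rintro ⟨s, h1, h2, h3⟩
      exact ⟨s, ⟨h1.choose_spec.tri, h1, h2⟩, h3⟩
  rw [← hGm]
  obtain ⟨w, hw0, hw⟩ := generic_dir hL V
  have hot : ot t ⊆ G := by
    intro y hy
    have hy0 : h y = 0 := aff_hull_zero h u.hv (intrinsicInterior_subset hy)
    have e1 : ∀ᶠ ε in 𝓝[>] (0:ℝ), y + ε • w ∈ ot t := by
      have := hL.ot_ev hy (q := y + w) (by
        have := aff_add h y w 1
        rw [one_smul] at this
        rw [this, hy0, hw0]; ring)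
      simp only [add_sub_cancel_left] at this
      exact this
    have e2 : ∀ᶠ ε in 𝓝[>] (0:ℝ), ∀ c ∈ V, ∀ d ∈ V, y + ε • w ∉ segment ℝ c d := by
      rw [Filter.eventually_all_finset]
      intro c hc
      rw [Filter.eventually_all_finset]
      intro d hd
      exact ev_avoid (hw c hc d hd)
    have hc : Tendsto (fun ε : ℝ => y + ε • w) (𝓝[>] 0) (𝓝 y) := by
      have := tendsto_seg y (y + w)
      simpa using this
    refine hGc.mem_of_tendsto hc ?_
    filter_upwards [e1, e2] with ε h1 h2
    rw [hGm]
    rcases below_face hD u hq hq0 h1 with h3 | ⟨c, hc, d, hd, h3⟩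
    · exact h3
    · exact absurd h3 (h2 c hc d hd)
  exact hGc.closure_subset_iff.2 hot (hL.hull_sub_closure hx)


theorem ext_fun {V : Finset Pt3}
    (hpos : ∀ v ∈ V, v ∉ convexHull ℝ ((V.erase v : Finset Pt3) : Set Pt3)) {v : Pt3}
    (hv : v ∈ V) : ∃ g : Pt3 →ᵃ[ℝ] ℝ, g v = 0 ∧
      ∀ x ∈ convexHull ℝ (V : Set Pt3), x ≠ v → g x < 0 := by
  obtain ⟨f, r, h1, h2⟩ := geometric_hahn_banach_closed_point (convex_convexHull ℝ _)
    (hull_closed (V.erase v)) (hpos v hv)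
  set g : Pt3 →ᵃ[ℝ] ℝ := (f : Pt3 →ₗ[ℝ] ℝ).toAffineMap - AffineMap.const ℝ Pt3 (f v) with hg
  have hgx : ∀ x, g x = f x - f v := fun x => by simp [hg]
  refine ⟨g, by simp [hgx], fun x hx hne => ?_⟩
  have hV : (V : Set Pt3) = insert v ((V.erase v : Finset Pt3) : Set Pt3) := by
    rw [← Finset.coe_insert, Finset.insert_erase hv]
  rw [hV] at hx
  rcases (V.erase v).eq_empty_or_nonempty with e | e
  · rw [e] at hx
    simp at hx
    exact absurd hx hne
  · rw [convexHull_insert (Finset.coe_nonempty.2 e)] at hx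
    rw [mem_convexJoin] at hx
    obtain ⟨a, ha, y, hy, hx⟩ := hx
    rw [mem_singleton_iff] at ha
    subst ha
    rw [segment_eq_image'] at hx
    obtain ⟨θ, hθ, rfl⟩ := hx
    have hθ0 : θ ≠ 0 := by
      rintro rfl
      simp at hne
    have hθp : 0 < θ := lt_of_le_of_ne hθ.1 hθ0.symm
    have := h1 y hy
    simp only at *
    rw [aff_seg, hgx, hgx]
    nlinarith

theorem AdjIn.symm {D : Finset (Finset Pt3)} {s t : Finset Pt3} (a : AdjIn D s t) : AdjIn D t s := by
  obtain ⟨h1, h2, h3, h4, h5⟩ := a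
  exact ⟨h2, h1, h3.symm, by rwa [union_comm], by rwa [inter_comm]⟩

theorem reach_symm {D : Finset (Finset Pt3)} {s t : Finset Pt3}
    (a : Relation.ReflTransGen (AdjIn D) s t) : Relation.ReflTransGen (AdjIn D) t s := by
  induction a with
  | refl => exact Relation.ReflTransGen.refl
  | tail _ e ih => exact Relation.ReflTransGen.head e.symm ih

theorem Chart.neg {h : Pt3 →ᵃ[ℝ] ℝ} {t L} (c : Chart (-h) t L) : Chart h t L := by
  obtain ⟨c1, c2, c3, c4, c5, c6⟩ := c
  refine ⟨c1, fun v hv => ?_, c3, c4, fun x hx => c5 x ?_, fun x hx => c6 x ?_⟩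
  · simpa using c2 v hv
  · simpa using hx
  · simpa using hx

theorem build {V : Finset Pt3}
    (hpos : ∀ v ∈ V, v ∉ convexHull ℝ ((V.erase v : Finset Pt3) : Set Pt3))
    {D : Finset (Finset Pt3)} (hD : IsDissection V D) {t₀ : Finset Pt3} (hm : Mismatched D t₀) :
    ∃ h A B, Pl V (convexHull ℝ (V : Set Pt3)) h
      {t' | Relation.ReflTransGen (AdjIn D) t₀ t'} A B := by
  obtain ⟨ht₀, t₁, hne, hr⟩ := hm
  obtain ⟨h, p, u⟩ := exists_up hD ht₀
  have hp0 : h p ≠ 0 := u.pos.ne'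
  set C : Set (Finset Pt3) := {t' | Relation.ReflTransGen (AdjIn D) t₀ t'} with hC
  have h0C : t₀ ∈ C := Relation.ReflTransGen.refl
  -- basic facts on elements of the component
  have chartUp : ∀ t, Up D h t ∨ Up D (-h) t → ∃ L, Chart h t L := by
    rintro t (⟨p, u⟩ | ⟨p, u⟩)
    · exact u.chart hD
    · obtain ⟨L, hL⟩ := u.chart hD
      exact ⟨L, hL.neg⟩
  have basic : ∀ t ∈ C, t ∈ triOf D ∧ (Up D h t ∨ Up D (-h) t) := by
    intro t ht
    change Relation.ReflTransGen (AdjIn D) t₀ t at ht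
    induction ht with
    | refl => exact ⟨ht₀, Or.inl ⟨p, u⟩⟩
    | tail _ a ih =>
      obtain ⟨L, hL⟩ := chartUp _ ih.2
      exact ⟨a.2.1, up_or hD hp0 a.2.1 (zero_of_coplanar hL a.2.2.2.1)⟩
  have triV : ∀ t ∈ triOf D, t ⊆ V := by
    intro t ht
    obtain ⟨p, -, hm, -⟩ := tri_apex hD ht
    intro v hv
    exact (hD.1 _ hm).2 (by simp [hv])
  have nb : ∀ t ∈ C, ∃ s, AdjIn D t s := by
    have h1 : ∃ s, AdjIn D t₀ s := by
      rcases Relation.ReflTransGen.cases_head hr with e | ⟨s, a, -⟩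
      · exact absurd e.symm hne
      · exact ⟨s, a⟩
    intro t ht
    rcases Relation.ReflTransGen.cases_head (reach_symm ht) with e | ⟨s, a, -⟩
    · rw [e]; exact h1
    · exact ⟨s, a⟩
  have step : ∀ t ∈ C, ∀ s, AdjIn D t s → s ∈ C := fun t ht s a => Relation.ReflTransGen.tail ht a
  have apexK : ∀ (k : Pt3 →ᵃ[ℝ] ℝ) t, Up D k t → ∃ q ∈ convexHull ℝ (V : Set Pt3), 0 < k q := by
    rintro k t ⟨p, u⟩
    exact ⟨p, subset_convexHull ℝ _ ((hD.1 _ u.mem).2 (by simp)), u.pos⟩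
  have opp : ∀ t ∈ C, Up D h t → ∃ q ∈ convexHull ℝ (V : Set Pt3), h q < 0 := by
    intro t ht ut
    obtain ⟨s, a⟩ := nb t ht
    rcases (basic s (step t ht s a)).2 with us | us
    · obtain ⟨x, hx1, hx2⟩ := a.2.2.2.2
      exact absurd (up_sep hD ut us hx1 (intrinsicInterior_subset hx2)) a.2.2.1
    · obtain ⟨q, hq, hq0⟩ := apexK _ _ us
      exact ⟨q, hq, by simpa using hq0⟩
  have opp' : ∀ t ∈ C, Up D (-h) t → ∃ q ∈ convexHull ℝ (V : Set Pt3), (-h) q < 0 := by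
    intro t ht ut
    obtain ⟨s, a⟩ := nb t ht
    rcases (basic s (step t ht s a)).2 with us | us
    · obtain ⟨q, hq, hq0⟩ := apexK _ _ us
      exact ⟨q, hq, by simpa using hq0⟩
    · obtain ⟨x, hx1, hx2⟩ := a.2.2.2.2
      exact absurd (up_sep hD ut us hx1 (intrinsicInterior_subset hx2)) a.2.2.1
  have stepE : ∀ t ∈ C, ∀ s, t = s ∨ AdjIn D t s → s ∈ C := by
    rintro t ht s (rfl | a)
    · exact ht
    · exact step t ht s a
  refine ⟨h, {t | t ∈ C ∧ Up D h t}, {t | t ∈ C ∧ Up D (-h) t}, ?_⟩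
  refine ⟨fun v hv => ext_fun hpos hv, convex_convexHull ℝ _, subset_convexHull ℝ _, ?_, ⟨t₀, h0C⟩,
    fun t ht => triV t (basic t ht).1, fun t ht => chartUp t (basic t ht).2, ?_,
    fun t ht => ht.1, fun t ht => ht.1, ?_, ?_, ?_, ?_, ?_⟩
  · exact (triOf D).finite_toSet.subset fun t ht => (basic t ht).1
  · intro t ht
    rcases (basic t ht).2 with h1 | h1
    · exact Or.inl ⟨ht, h1⟩
    · exact Or.inr ⟨ht, h1⟩
  · intro t ht t' ht' x hx hx'
    exact up_sep hD ht.2 ht'.2 hx hx'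
  · intro t ht t' ht' x hx hx'
    exact up_sep hD ht.2 ht'.2 hx hx'
  · intro t ht x hx
    rcases (basic t ht).2 with h1 | h1
    · exact ⟨t, ⟨ht, h1⟩, hx⟩
    · obtain ⟨q, hq, hq0⟩ := opp' t ht h1
      obtain ⟨s, us, hts, hxs⟩ := cover_s13 hD h1 hq hq0 hx
      rw [neg_neg] at us
      exact ⟨s, ⟨stepE t ht s hts, us⟩, hxs⟩
  · intro t ht x hx
    rcases (basic t ht).2 with h1 | h1
    · obtain ⟨q, hq, hq0⟩ := opp t ht h1
      obtain ⟨s, us, hts, hxs⟩ := cover_s13 hD h1 hq hq0 hx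
      exact ⟨s, ⟨stepE t ht s hts, us⟩, hxs⟩
    · exact ⟨t, ⟨ht, h1⟩, hx⟩
  · intro a ha b hb
    have hab : Relation.ReflTransGen (AdjIn D) a b := (reach_symm ha).trans hb
    clear hb
    induction hab with
    | refl => exact Relation.ReflTransGen.refl
    | tail hab' e ih =>
      have hbC := Relation.ReflTransGen.trans ha hab'
      exact ih.tail ⟨hbC, step _ hbC _ e, e.2.2.2.2⟩

theorem Pl.intr {V : Finset Pt3} {K h} {C A B : Set (Finset Pt3)} (P : Pl V K h C A B) {z : Pt3}
    (hz : z ∈ intrinsicInterior ℝ (Pl.R C)) :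
    h z = 0 ∧ convexHull ℝ (Pl.W C) ∈ 𝓝[{x | h x = 0}] z := by
  rw [P.region_eq] at hz
  obtain ⟨t, ht⟩ := P.ne
  obtain ⟨L, hL⟩ := P.chart t ht
  have hsp := hL.span (s := convexHull ℝ (Pl.W C))
    ((subset_convexHull ℝ _).trans (Pl.hull_sub_M ht)) (fun x hx => P.hM hx)
  rw [mem_intr_iff, ← SetLike.mem_coe, hsp] at hz
  exact hz

theorem common_dir (f g : Pt3 →ₗ[ℝ] ℝ) : ∃ v : Pt3, v ≠ 0 ∧ f v = 0 ∧ g v = 0 := by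
  have : LinearMap.ker (f.prod g) ≠ ⊥ := by
    apply LinearMap.ker_ne_bot_of_finrank_lt
    simp
  obtain ⟨v, hv, hv0⟩ := Submodule.exists_mem_ne_zero_of_ne_bot this
  rw [LinearMap.mem_ker] at hv
  exact ⟨v, hv0, congrArg Prod.fst hv, congrArg Prod.snd hv⟩

theorem part_two {V : Finset Pt3}
    (hpos : ∀ v ∈ V, v ∉ convexHull ℝ ((V.erase v : Finset Pt3) : Set Pt3))
    {D : Finset (Finset Pt3)} (hD : IsDissection V D) {t₀ t₀' : Finset Pt3}
    (hm : Mismatched D t₀) (hm' : Mismatched D t₀') {z : Pt3}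
    (hz : z ∈ intrinsicInterior ℝ (region D t₀)) (hz' : z ∈ intrinsicInterior ℝ (region D t₀')) :
    Relation.ReflTransGen (AdjIn D) t₀ t₀' := by
  obtain ⟨h, A, B, P⟩ := build hpos hD hm
  obtain ⟨h', A', B', P'⟩ := build hpos hD hm'
  obtain ⟨hz0, hU⟩ := P.intr hz
  obtain ⟨hz0', hU'⟩ := P'.intr hz'
  obtain ⟨v, hv0, hv, hv'⟩ := common_dir h.linear h'.linear
  obtain ⟨t, ht, σ, hev⟩ := P.dir_step hz0 hU hv hv0
  have hT : Tendsto (fun δ : ℝ => z + (δ * σ) • v) (𝓝[>] 0) (𝓝[{x | h' x = 0}] z) := by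
    apply tendsto_nhdsWithin_of_tendsto_nhds_of_eventually_within
    · have : Continuous (fun δ : ℝ => z + (δ * σ) • v) := by fun_prop
      have := this.tendsto 0
      simp only [zero_mul, zero_smul, add_zero] at this
      exact this.mono_left nhdsWithin_le_nhds
    · refine Eventually.of_forall fun δ => ?_
      change h' _ = 0
      rw [aff_add, hz0', hv', mul_zero, add_zero]
  have hU2 : ∀ᶠ y in 𝓝[{x | h' x = 0}] z, convexHull ℝ
      (Pl.W {t' | Relation.ReflTransGen (AdjIn D) t₀' t'}) ∈ 𝓝[{x | h' x = 0}] y :=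
    eventually_eventually_nhdsWithin.2 hU'
  obtain ⟨δ, h1, h2⟩ := (hev.and (hT.eventually hU2)).exists
  set z₁ := z + (δ * σ) • v with hz₁
  have h3 : h' z₁ = 0 := by rw [hz₁, aff_add, hz0', hv', mul_zero, add_zero]
  have h4 : h z₁ = 0 := by rw [hz₁, aff_add, hz0, hv, mul_zero, add_zero]
  obtain ⟨t', ht', σ', hev'⟩ := P'.dir_step h3 h2 hv' hv0
  obtain ⟨L, hL⟩ := P.chart t ht
  have hev2 := hL.ot_ev h1 (q := z₁ + σ' • v) (by rw [aff_add, h4, hv, mul_zero, add_zero])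
  obtain ⟨ε, h5, h6⟩ := (hev'.and hev2).exists
  rw [add_sub_cancel_left, smul_smul] at h6
  have tri : ∀ {a b}, Mismatched D a → Relation.ReflTransGen (AdjIn D) a b → b ∈ triOf D := by
    intro a b ha hab
    rcases Relation.ReflTransGen.cases_tail hab with e | ⟨c, -, e⟩
    · rw [e]; exact ha.1
    · exact e.2.1
  have ht : Relation.ReflTransGen (AdjIn D) t₀ t := ht
  have ht' : Relation.ReflTransGen (AdjIn D) t₀' t' := ht'
  rcases tri_meet hD (tri hm ht) (tri hm' ht') h6 h5 with e | e
  · subst e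
    exact ht.trans (reach_symm ht')
  · exact (ht.tail e).trans (reach_symm ht')

theorem part_one {V : Finset Pt3}
    (hpos : ∀ v ∈ V, v ∉ convexHull ℝ ((V.erase v : Finset Pt3) : Set Pt3))
    {D : Finset (Finset Pt3)} (hD : IsDissection V D) {t : Finset Pt3} (hm : Mismatched D t) :
    ∃ W : Finset Pt3, W ⊆ V ∧ 3 ≤ W.card ∧ Coplanar ℝ (W : Set Pt3) ∧
        (∀ w ∈ W, w ∉ convexHull ℝ ((W.erase w : Finset Pt3) : Set Pt3)) ∧
        region D t = convexHull ℝ (W : Set Pt3) := by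
  obtain ⟨h, A, B, P⟩ := build hpos hD hm
  set C : Set (Finset Pt3) := {t' | Relation.ReflTransGen (AdjIn D) t t'} with hC
  have htC : t ∈ C := Relation.ReflTransGen.refl
  obtain ⟨L, hL⟩ := P.chart t htC
  have hWV : Pl.W C ⊆ (V : Set Pt3) := by
    intro x hx
    simp only [Pl.W, mem_iUnion] at hx
    obtain ⟨s, hs, hx⟩ := hx
    exact P.sub s hs hx
  have hfin : (Pl.W C).Finite := V.finite_toSet.subset hWV
  have hco : (hfin.toFinset : Set Pt3) = Pl.W C := hfin.coe_toFinset
  have hsub : hfin.toFinset ⊆ V := by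
    rw [← Finset.coe_subset, hco]; exact hWV
  refine ⟨hfin.toFinset, hsub, ?_, ?_, ?_, ?_⟩
  · rw [← hL.card]
    apply Finset.card_le_card
    rw [← Finset.coe_subset, hco]
    exact subset_biUnion_of_mem (u := fun t : Finset Pt3 => (t : Set Pt3)) htC
  · rw [hco]
    exact coplanar_of_zero hL fun x hx => P.hW hx
  · intro w hw hw'
    refine hpos w (hsub hw) (convexHull_mono ?_ hw')
    exact Finset.coe_subset.2 (Finset.erase_subset_erase _ hsub)
  · rw [hco]
    exact P.region_eq

end Helpers

/-- Every mismatched region of a dissection of a convex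
3-polytope `P` is a convex polygon whose vertices are vertices of `P`, and
distinct mismatched regions have disjoint relative interiors. -/
theorem mismatched_regions_are_convex_polygons
    (V : Finset Pt3)
    -- V is the vertex set of a convex 3-polytope
    (hpos : ∀ v ∈ V, v ∉ convexHull ℝ ((V.erase v : Finset Pt3) : Set Pt3))
    (hspan : affineSpan ℝ (V : Set Pt3) = ⊤)
    (D : Finset (Finset Pt3)) (hD : IsDissection V D) :
    (∀ t, Mismatched D t →
      ∃ W : Finset Pt3, W ⊆ V ∧ 3 ≤ W.card ∧ Coplanar ℝ (W : Set Pt3) ∧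
        (∀ w ∈ W, w ∉ convexHull ℝ ((W.erase w : Finset Pt3) : Set Pt3)) ∧
        region D t = convexHull ℝ (W : Set Pt3)) ∧
    (∀ t t', Mismatched D t → Mismatched D t' →
      ¬ Relation.ReflTransGen (AdjIn D) t t' →
      intrinsicInterior ℝ (region D t) ∩ intrinsicInterior ℝ (region D t') = ∅) := by
  refine ⟨fun t ht => part_one hpos hD ht, fun t t' ht ht' hn => ?_⟩
  rw [Set.eq_empty_iff_forall_notMem]
  rintro z ⟨hz, hz'⟩
  exact hn (part_two hpos hD ht ht' hz hz')
end
end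

section
/- Every dissection of a convex 3-polytope with n vertices has at most (n-2 choose 2) tetrahedra. -/
open Set MeasureTheory
open scoped Classical

noncomputable section

/-- A facet of the polytope, recorded by its vertex set. -/
def IsFac (V F : Finset Pt3) : Prop :=
  F ⊆ V ∧ ∃ (f : Pt3) (c : ℝ), (∀ v ∈ V, c ≤ f ⬝ᵥ v) ∧ (∀ v ∈ V, v ∈ F ↔ f ⬝ᵥ v = c) ∧ f ≠ 0 ∧
    ∀ g : Pt3, (∀ v ∈ F, ∀ w ∈ F, g ⬝ᵥ v = g ⬝ᵥ w) → ∃ k : ℝ, g = k • f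

lemma not_flat (V : Finset Pt3) (hspan : affineSpan ℝ (V : Set Pt3) = ⊤) (g : Pt3) (c : ℝ)
    (h : ∀ v ∈ V, g ⬝ᵥ v = c) : g = 0 := by
  have key : ∀ x : Pt3, g ⬝ᵥ x = c := by
    intro x
    have hx : x ∈ affineSpan ℝ (V : Set Pt3) := by rw [hspan]; trivial
    refine affineSpan_induction (p := fun x => g ⬝ᵥ x = c) hx (fun x hx => h x hx) ?_
    intro a u v w hu hv hw
    simp [dotProduct_add, dotProduct_sub, dotProduct_smul, hu, hv, hw]
  have h0 := key 0
  have h1 := key g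
  rw [dotProduct_zero] at h0
  rw [← h0] at h1
  exact dotProduct_self_eq_zero.mp h1

lemma fac_inj {V F G : Finset Pt3} 
    (hFV : F ⊆ V) (hGV : G ⊆ V)
    {f g : Pt3} {c d : ℝ} (hF : ∀ v ∈ V, v ∈ F ↔ f ⬝ᵥ v = c)
    (hu : ∀ g : Pt3, (∀ v ∈ F, ∀ w ∈ F, g ⬝ᵥ v = g ⬝ᵥ w) → ∃ k : ℝ, g = k • f)
    (hG : ∀ v ∈ V, v ∈ G ↔ g ⬝ᵥ v = d) (hg0 : g ≠ 0)
    {p : Pt3} (hp : p ∈ F) (hFG : F ⊆ G) : F = G := by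
  obtain ⟨k, rfl⟩ := hu g (fun v hv w hw => by
    rw [(hG v (hFV hv)).1 (hFG hv), (hG w (hFV hw)).1 (hFG hw)])
  have hk : k ≠ 0 := by rintro rfl; simp at hg0
  have hpf := (hF p (hFV hp)).1 hp
  have hpg := (hG p (hFV hp)).1 (hFG hp)
  apply Finset.Subset.antisymm hFG
  intro v hv
  have h1 := (hG v (hGV hv)).1 hv
  rw [hF v (hGV hv), ← hpf]
  simp only [smul_dotProduct, smul_eq_mul] at h1 hpg
  rw [← hpg] at h1
  exact mul_left_cancel₀ hk h1

/-- Each pair of vertices lies in at most two facets. -/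
lemma pair_le_two {V : Finset Pt3}
    {p q : Pt3} (hpq : p ≠ q) {F₁ F₂ F₃ : Finset Pt3}
    (h₁ : IsFac V F₁) (h₂ : IsFac V F₂) (h₃ : IsFac V F₃)
    (p₁ : p ∈ F₁) (p₂ : p ∈ F₂) (p₃ : p ∈ F₃) (q₁ : q ∈ F₁) (q₂ : q ∈ F₂) (q₃ : q ∈ F₃)
    (h12 : F₁ ≠ F₂) (h13 : F₁ ≠ F₃) (h23 : F₂ ≠ F₃) : False := by
  obtain ⟨s1, f1, c1, a1, b1, n1, u1⟩ := h₁
  obtain ⟨s2, f2, c2, a2, b2, n2, u2⟩ := h₂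
  obtain ⟨s3, f3, c3, a3, b3, n3, u3⟩ := h₃
  have sumz : ∀ (F : Finset Pt3) (f : Pt3) (c : ℝ), p ∈ F → F ⊆ V →
      (∀ v ∈ V, v ∈ F ↔ f ⬝ᵥ v = c) → f ⬝ᵥ (∑ r ∈ F, (r - p)) = 0 := by
    intro F f c hp hF hb
    rw [dotProduct_sum]
    apply Finset.sum_eq_zero
    intro r hr
    rw [dotProduct_sub, (hb r (hF hr)).1 hr, (hb p (hF hp)).1 hp, sub_self]
  have sump : ∀ (F G : Finset Pt3) (f g : Pt3) (c d : ℝ), p ∈ F → p ∈ G → F ⊆ V → G ⊆ V →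
      (∀ v ∈ V, c ≤ f ⬝ᵥ v) → (∀ v ∈ V, v ∈ F ↔ f ⬝ᵥ v = c) →
      (∀ g : Pt3, (∀ v ∈ F, ∀ w ∈ F, g ⬝ᵥ v = g ⬝ᵥ w) → ∃ k : ℝ, g = k • f) →
      (∀ v ∈ V, d ≤ g ⬝ᵥ v) → (∀ v ∈ V, v ∈ G ↔ g ⬝ᵥ v = d) → g ≠ 0 → F ≠ G →
      0 < g ⬝ᵥ (∑ r ∈ F, (r - p)) := by
    intro F G f g c d hpF hpG hF hG hf hbF hu hg hbG hg0 hne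
    have : ¬ F ⊆ G := fun h => hne (fac_inj hF hG hbF hu hbG hg0 hpF h)
    rw [Finset.not_subset] at this
    obtain ⟨r, hr, hrG⟩ := this
    rw [dotProduct_sum]
    have hpd := (hbG p (hF hpF)).1 hpG
    apply Finset.sum_pos'
    · intro i hi
      rw [dotProduct_sub, hpd, sub_nonneg]
      exact hg i (hF hi)
    · refine ⟨r, hr, ?_⟩
      rw [dotProduct_sub, hpd, sub_pos]
      exact lt_of_le_of_ne (hg r (hF hr)) (fun h => hrG ((hbG r (hF hr)).2 h.symm))
  -- linear dependence
  let M : Matrix (Fin 3) (Fin 3) ℝ := ![f1, f2, f3]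
  have hdet : M.det = 0 := by
    rw [← Matrix.exists_mulVec_eq_zero_iff]
    refine ⟨q - p, sub_ne_zero.2 hpq.symm, ?_⟩
    have e1 : f1 ⬝ᵥ (q - p) = 0 := by
      rw [dotProduct_sub, (b1 q (s1 q₁)).1 q₁, (b1 p (s1 p₁)).1 p₁, sub_self]
    have e2 : f2 ⬝ᵥ (q - p) = 0 := by
      rw [dotProduct_sub, (b2 q (s2 q₂)).1 q₂, (b2 p (s2 p₂)).1 p₂, sub_self]
    have e3 : f3 ⬝ᵥ (q - p) = 0 := by
      rw [dotProduct_sub, (b3 q (s3 q₃)).1 q₃, (b3 p (s3 p₃)).1 p₃, sub_self]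
    ext i
    fin_cases i
    · exact e1
    · exact e2
    · exact e3
  obtain ⟨w, hw, hwM⟩ := Matrix.exists_vecMul_eq_zero_iff.2 hdet
  have hcomb : ∀ x : Pt3, w 0 * (f1 ⬝ᵥ x) + w 1 * (f2 ⬝ᵥ x) + w 2 * (f3 ⬝ᵥ x) = 0 := by
    intro x
    have h := congrArg (fun y => y ⬝ᵥ x) hwM
    simp only [zero_dotProduct] at h
    rw [← Matrix.dotProduct_mulVec] at h
    simpa [dotProduct, Fin.sum_univ_three, M, Matrix.mulVec] using h
  have A1 := hcomb (∑ r ∈ F₁, (r - p))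
  have A2 := hcomb (∑ r ∈ F₂, (r - p))
  have A3 := hcomb (∑ r ∈ F₃, (r - p))
  rw [sumz F₁ f1 c1 p₁ s1 b1] at A1
  rw [sumz F₂ f2 c2 p₂ s2 b2] at A2
  rw [sumz F₃ f3 c3 p₃ s3 b3] at A3
  have P12 := sump F₁ F₂ f1 f2 c1 c2 p₁ p₂ s1 s2 a1 b1 u1 a2 b2 n2 h12
  have P13 := sump F₁ F₃ f1 f3 c1 c3 p₁ p₃ s1 s3 a1 b1 u1 a3 b3 n3 h13
  have P21 := sump F₂ F₁ f2 f1 c2 c1 p₂ p₁ s2 s1 a2 b2 u2 a1 b1 n1 h12.symm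
  have P23 := sump F₂ F₃ f2 f3 c2 c3 p₂ p₃ s2 s3 a2 b2 u2 a3 b3 n3 h23
  have P31 := sump F₃ F₁ f3 f1 c3 c1 p₃ p₁ s3 s1 a3 b3 u3 a1 b1 n1 h13.symm
  have P32 := sump F₃ F₂ f3 f2 c3 c2 p₃ p₂ s3 s2 a3 b3 u3 a2 b2 n2 h23.symm
  have opp : ∀ a b x y : ℝ, 0 < x → 0 < y → a * x + b * y = 0 →
      (a = 0 ∧ b = 0) ∨ (a < 0 ∧ 0 < b) ∨ (0 < a ∧ b < 0) := by
    intro a b x y hx hy h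
    rcases lt_trichotomy a 0 with ha | ha | ha
    · have := mul_neg_of_neg_of_pos ha hx
      exact Or.inr (Or.inl ⟨ha, pos_of_mul_pos_left (by linarith : 0 < b * y) hy.le⟩)
    · subst ha
      left
      refine ⟨rfl, ?_⟩
      have : b * y = 0 := by linarith
      exact (mul_eq_zero.1 this).resolve_right hy.ne'
    · have := mul_pos ha hx
      refine Or.inr (Or.inr ⟨ha, ?_⟩)
      by_contra hb
      push Not at hb
      have := mul_nonneg hb hy.le
      linarith
  have O1 := opp (w 1) (w 2) _ _ P12 P13 (by linarith)
  have O2 := opp (w 0) (w 2) _ _ P21 P23 (by linarith)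
  have O3 := opp (w 0) (w 1) _ _ P31 P32 (by linarith)
  have : w 0 = 0 ∧ w 1 = 0 ∧ w 2 = 0 := by
    rcases O1 with ⟨_, _⟩ | ⟨_, _⟩ | ⟨_, _⟩ <;> rcases O2 with ⟨_, _⟩ | ⟨_, _⟩ | ⟨_, _⟩ <;>
      rcases O3 with ⟨_, _⟩ | ⟨_, _⟩ | ⟨_, _⟩ <;> first | (exfalso; linarith) | exact ⟨by assumption, by assumption, by assumption⟩
  apply hw
  ext i
  fin_cases i
  · exact this.1
  · exact this.2.1
  · exact this.2.2

lemma span_three (l h : Pt3) (hm : crossProduct l h ≠ 0) (g : Pt3) :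
    ∃ a b c : ℝ, g = a • crossProduct l h + b • l + c • h := by
  let M : Matrix (Fin 3) (Fin 3) ℝ := ![crossProduct l h, l, h]
  have hdet : M.det ≠ 0 := by
    have : M.det = crossProduct l h ⬝ᵥ crossProduct l h := by
      rw [triple_product_eq_det]
    rw [this]
    exact fun h0 => hm (dotProduct_self_eq_zero.mp h0)
  have hu : IsUnit M.det := isUnit_iff_ne_zero.2 hdet
  refine ⟨Matrix.vecMul g M⁻¹ 0, Matrix.vecMul g M⁻¹ 1, Matrix.vecMul g M⁻¹ 2, ?_⟩
  have : Matrix.vecMul (Matrix.vecMul g M⁻¹) M = g := by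
    rw [Matrix.vecMul_vecMul, Matrix.nonsing_inv_mul _ hu, Matrix.vecMul_one]
  conv_lhs => rw [← this]
  rw [Matrix.vecMul_eq_sum, Fin.sum_univ_three]
  rfl

/-- Construction of a supporting functional at `v` touching an upper and a lower vertex. -/
lemma support_exists (S : Finset Pt3) (l h m : Pt3) (hl : ∀ w ∈ S, 0 < l ⬝ᵥ w)
    (hh : ∀ w ∈ S, h ⬝ᵥ w ≠ 0) (hup : ∃ a ∈ S, 0 < h ⬝ᵥ a) (hdn : ∃ b ∈ S, h ⬝ᵥ b < 0) :
    ∃ s t : ℝ, (∀ w ∈ S, 0 ≤ (m - s • l + t • h) ⬝ᵥ w) ∧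
      ∃ a ∈ S, ∃ b ∈ S, 0 < h ⬝ᵥ a ∧ h ⬝ᵥ b < 0 ∧
        (m - s • l + t • h) ⬝ᵥ a = 0 ∧ (m - s • l + t • h) ⬝ᵥ b = 0 := by
  let U := S.filter (fun a => 0 < h ⬝ᵥ a)
  let W := S.filter (fun a => h ⬝ᵥ a < 0)
  let G : Pt3 × Pt3 → Pt3 := fun x => (h ⬝ᵥ x.1) • x.2 - (h ⬝ᵥ x.2) • x.1
  have hG : ∀ k x, k ⬝ᵥ G x = (h ⬝ᵥ x.1) * (k ⬝ᵥ x.2) - (h ⬝ᵥ x.2) * (k ⬝ᵥ x.1) := by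
    intro k x
    simp [G, dotProduct_sub, dotProduct_smul]
  have hne : (U ×ˢ W).Nonempty := by
    obtain ⟨a, ha, ha'⟩ := hup
    obtain ⟨b, hb, hb'⟩ := hdn
    exact ⟨(a, b), by simp [U, W, ha, hb, ha', hb']⟩
  obtain ⟨⟨a, b⟩, hab, hmin⟩ := Finset.exists_min_image (U ×ˢ W)
    (fun x => (m ⬝ᵥ G x) / (l ⬝ᵥ G x)) hne
  have hlG : ∀ x ∈ U ×ˢ W, 0 < l ⬝ᵥ G x := by
    intro x hx
    rw [hG]
    simp only [Finset.mem_product, U, W, Finset.mem_filter] at hx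
    obtain ⟨⟨h1, h2⟩, h3, h4⟩ := hx
    have := mul_pos h2 (hl _ h3)
    have := mul_neg_of_neg_of_pos h4 (hl _ h1)
    linarith
  set s := (m ⬝ᵥ G (a, b)) / (l ⬝ᵥ G (a, b)) with hs
  have hk : ∀ x ∈ U ×ˢ W, 0 ≤ (m - s • l) ⬝ᵥ G x := by
    intro x hx
    have h1 := hmin x hx
    have h2 := hlG x hx
    rw [le_div_iff₀ h2] at h1
    rw [sub_dotProduct, smul_dotProduct, smul_eq_mul]
    linarith
  have hk0 : (m - s • l) ⬝ᵥ G (a, b) = 0 := by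
    have h2 := hlG _ hab
    rw [sub_dotProduct, smul_dotProduct, smul_eq_mul, hs, div_mul_cancel₀ _ h2.ne', sub_self]
  set k := m - s • l with hkdef
  have hab' := hab
  simp only [Finset.mem_product, U, W, Finset.mem_filter] at hab'
  obtain ⟨⟨ha, hap⟩, hb, hbn⟩ := hab'
  obtain ⟨t, ht⟩ : ∃ t : ℝ, k ⬝ᵥ a + t * (h ⬝ᵥ a) = 0 :=
    ⟨-(k ⬝ᵥ a) / (h ⬝ᵥ a), by field_simp; ring⟩
  rw [hG] at hk0
  simp only at hk0
  have htb : k ⬝ᵥ b + t * (h ⬝ᵥ b) = 0 := by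
    have : (h ⬝ᵥ a) * (k ⬝ᵥ b + t * (h ⬝ᵥ b)) = 0 := by
      linear_combination hk0 + (h ⬝ᵥ b) * ht
    exact (mul_eq_zero.1 this).resolve_left hap.ne'
  have ev : ∀ w, (k + t • h) ⬝ᵥ w = k ⬝ᵥ w + t * (h ⬝ᵥ w) := by
    intro w; rw [add_dotProduct, smul_dotProduct, smul_eq_mul]
  refine ⟨s, t, ?_, a, ha, b, hb, hap, hbn, by rw [ev]; exact ht, by rw [ev]; exact htb⟩
  intro w hw
  rw [ev]
  rcases lt_or_gt_of_ne (hh w hw) with hw' | hw'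
  · have := hk (a, w) (by simp [U, W, ha, hap, hw, hw'])
    rw [hG] at this
    simp only at this
    have h3 : 0 ≤ (h ⬝ᵥ a) * (k ⬝ᵥ w + t * (h ⬝ᵥ w)) := by
      have : (h ⬝ᵥ a) * (k ⬝ᵥ w + t * (h ⬝ᵥ w)) =
        (h ⬝ᵥ a) * (k ⬝ᵥ w) - (h ⬝ᵥ w) * (k ⬝ᵥ a) := by linear_combination (h ⬝ᵥ w) * ht
      linarith
    exact nonneg_of_mul_nonneg_right h3 hap
  · have := hk (w, b) (by simp [U, W, hb, hbn, hw, hw'])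
    rw [hG] at this
    simp only at this
    have h3 : 0 ≤ (-(h ⬝ᵥ b)) * (k ⬝ᵥ w + t * (h ⬝ᵥ w)) := by
      have : (-(h ⬝ᵥ b)) * (k ⬝ᵥ w + t * (h ⬝ᵥ w)) =
        (h ⬝ᵥ w) * (k ⬝ᵥ b) - (h ⬝ᵥ b) * (k ⬝ᵥ w) := by linear_combination (-(h ⬝ᵥ w)) * htb
      linarith
    exact nonneg_of_mul_nonneg_right h3 (by linarith)

lemma two_zero {l h a b : Pt3} (hla : 0 < l ⬝ᵥ a) (hlb : 0 < l ⬝ᵥ b) (ha : 0 < h ⬝ᵥ a)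
    (hb : h ⬝ᵥ b < 0) {x y : ℝ} (h1 : (x • l + y • h) ⬝ᵥ a = 0) (h2 : (x • l + y • h) ⬝ᵥ b = 0) :
    x = 0 ∧ y = 0 := by
  simp only [add_dotProduct, smul_dotProduct, smul_eq_mul] at h1 h2
  have hD : 0 < (l ⬝ᵥ b) * (h ⬝ᵥ a) - (l ⬝ᵥ a) * (h ⬝ᵥ b) := by
    have := mul_pos hlb ha
    have := mul_neg_of_pos_of_neg hla hb
    linarith
  constructor
  · have : x * ((l ⬝ᵥ b) * (h ⬝ᵥ a) - (l ⬝ᵥ a) * (h ⬝ᵥ b)) = 0 := by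
      linear_combination (h ⬝ᵥ a) * h2 - (h ⬝ᵥ b) * h1
    exact (mul_eq_zero.1 this).resolve_right hD.ne'
  · have : y * ((l ⬝ᵥ b) * (h ⬝ᵥ a) - (l ⬝ᵥ a) * (h ⬝ᵥ b)) = 0 := by
      linear_combination (l ⬝ᵥ b) * h1 - (l ⬝ᵥ a) * h2
    exact (mul_eq_zero.1 this).resolve_right hD.ne'

lemma sep_vec (V : Finset Pt3) (v : Pt3)
    (hpos : v ∉ convexHull ℝ ((V.erase v : Finset Pt3) : Set Pt3)) :
    ∃ l : Pt3, ∀ w ∈ V.erase v, 0 < l ⬝ᵥ (w - v) := by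
  obtain ⟨f, u, h1, h2⟩ := geometric_hahn_banach_point_closed
    (convex_convexHull ℝ ((V.erase v : Finset Pt3) : Set Pt3))
    ((V.erase v).finite_toSet.isClosed_convexHull ℝ) hpos
  refine ⟨fun i => f (Pi.single i 1), fun w hw => ?_⟩
  have h3 := h2 w (subset_convexHull ℝ _ hw)
  have : ∀ x : Pt3, (fun i => f (Pi.single i 1)) ⬝ᵥ x = f x := by
    intro x
    conv_rhs => rw [pi_eq_sum_univ' x]
    simp [dotProduct, mul_comm]
  rw [this, map_sub]
  linarith

/-- A vertex which is not extreme for `h` is an intermediate vertex of two facets. -/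
lemma two_facets {V : Finset Pt3} (hspan : affineSpan ℝ (V : Set Pt3) = ⊤) {v : Pt3} (hv : v ∈ V)
    (hpos : v ∉ convexHull ℝ ((V.erase v : Finset Pt3) : Set Pt3)) (h : Pt3)
    (hinj : ∀ w ∈ V, w ≠ v → h ⬝ᵥ w ≠ h ⬝ᵥ v)
    (hup : ∃ a ∈ V, h ⬝ᵥ v < h ⬝ᵥ a) (hdn : ∃ b ∈ V, h ⬝ᵥ b < h ⬝ᵥ v) :
    ∃ F₁ F₂ : Finset Pt3, F₁ ≠ F₂ ∧ (∀ F, F = F₁ ∨ F = F₂ → IsFac V F ∧ v ∈ F ∧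
      (∃ a ∈ F, h ⬝ᵥ v < h ⬝ᵥ a) ∧ (∃ b ∈ F, h ⬝ᵥ b < h ⬝ᵥ v)) := by
  obtain ⟨l, hl⟩ := sep_vec V v hpos
  let S := (V.erase v).image (fun w => w - v)
  have hlS : ∀ w ∈ S, 0 < l ⬝ᵥ w := by
    intro w' hw'
    obtain ⟨w, hw, rfl⟩ := Finset.mem_image.1 hw'
    exact hl w hw
  have hhS : ∀ w ∈ S, h ⬝ᵥ w ≠ 0 := by
    intro w' hw'
    obtain ⟨w, hw, rfl⟩ := Finset.mem_image.1 hw'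
    rw [Finset.mem_erase] at hw
    rw [dotProduct_sub, sub_ne_zero]
    exact hinj w hw.2 hw.1
  have hupS : ∃ a ∈ S, 0 < h ⬝ᵥ a := by
    obtain ⟨a, ha, ha'⟩ := hup
    refine ⟨a - v, Finset.mem_image.2 ⟨a, Finset.mem_erase.2 ⟨?_, ha⟩, rfl⟩, ?_⟩
    · rintro rfl; exact lt_irrefl _ ha'
    · rw [dotProduct_sub]; linarith
  have hdnS : ∃ a ∈ S, h ⬝ᵥ a < 0 := by
    obtain ⟨a, ha, ha'⟩ := hdn
    refine ⟨a - v, Finset.mem_image.2 ⟨a, Finset.mem_erase.2 ⟨?_, ha⟩, rfl⟩, ?_⟩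
    · rintro rfl; exact lt_irrefl _ ha'
    · rw [dotProduct_sub]; linarith
  have hm : crossProduct l h ≠ 0 := by
    rw [crossProduct_ne_zero_iff_linearIndependent, LinearIndependent.pair_iff]
    intro x y hxy
    obtain ⟨a, ha, ha'⟩ := hupS
    obtain ⟨b, hb, hb'⟩ := hdnS
    exact two_zero (hlS a ha) (hlS b hb) ha' hb' (by rw [hxy, zero_dotProduct])
      (by rw [hxy, zero_dotProduct])
  have build : ∀ (m : Pt3), (m = crossProduct l h ∨ m = - crossProduct l h) → ∀ s t : ℝ,
      (∀ w ∈ S, 0 ≤ (m - s • l + t • h) ⬝ᵥ w) → ∀ a ∈ S, ∀ b ∈ S, 0 < h ⬝ᵥ a → h ⬝ᵥ b < 0 →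
        (m - s • l + t • h) ⬝ᵥ a = 0 → (m - s • l + t • h) ⬝ᵥ b = 0 →
      ∀ F, F = V.filter (fun w => (m - s • l + t • h) ⬝ᵥ (w - v) = 0) →
      IsFac V F ∧ v ∈ F ∧
      (∃ a ∈ F, h ⬝ᵥ v < h ⬝ᵥ a) ∧ (∃ b ∈ F, h ⬝ᵥ b < h ⬝ᵥ v) := by
    intro m hmm s t hnn a ha b hb hap hbn hfa hfb F hF
    set f := m - s • l + t • h with hf
    have hal := hlS a ha
    have hbl := hlS b hb
    obtain ⟨a', ha', rfl⟩ := Finset.mem_image.1 ha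
    obtain ⟨b', hb', rfl⟩ := Finset.mem_image.1 hb
    have haF : a' ∈ F := by rw [hF]; exact Finset.mem_filter.2 ⟨Finset.mem_of_mem_erase ha', hfa⟩
    have hbF : b' ∈ F := by rw [hF]; exact Finset.mem_filter.2 ⟨Finset.mem_of_mem_erase hb', hfb⟩
    have hvF : v ∈ F := by rw [hF]; exact Finset.mem_filter.2 ⟨hv, by simp⟩
    have hf0 : f ≠ 0 := by
      intro h0
      have e := congrArg (fun z => z ⬝ᵥ crossProduct l h) h0
      simp only [hf, add_dotProduct, sub_dotProduct, smul_dotProduct, dot_self_cross,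
        dot_cross_self, zero_dotProduct, smul_zero, sub_zero, add_zero] at e
      rcases hmm with rfl | rfl
      · exact hm (dotProduct_self_eq_zero.mp e)
      · rw [neg_dotProduct, neg_eq_zero] at e
        exact hm (dotProduct_self_eq_zero.mp e)
    refine ⟨⟨by rw [hF]; exact Finset.filter_subset _ _, f, f ⬝ᵥ v, ?_, ?_, hf0, ?_⟩, hvF,
      ⟨a', haF, ?_⟩, ⟨b', hbF, ?_⟩⟩
    · intro w hw
      by_cases hwv : w = v
      · rw [hwv]
      · have := hnn (w - v) (Finset.mem_image.2 ⟨w, Finset.mem_erase.2 ⟨hwv, hw⟩, rfl⟩)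
        rw [dotProduct_sub] at this
        linarith
    · intro w hw
      rw [hF, Finset.mem_filter, dotProduct_sub, sub_eq_zero]
      simp [hw]
    · intro g hg
      obtain ⟨x, y, z, hxyz⟩ := span_three l h hm g
      obtain ⟨e, he⟩ : ∃ e : ℝ, x • crossProduct l h = e • m := by
        rcases hmm with rfl | rfl
        · exact ⟨x, rfl⟩
        · exact ⟨-x, by rw [smul_neg, neg_smul, neg_neg]⟩
      have hge : g = e • f + ((y + e * s) • l + (z - e * t) • h) := by
        rw [hxyz, he, hf]
        ext i
        simp
        ring
      have key : ∀ u ∈ F, f ⬝ᵥ (u - v) = 0 → ((y + e * s) • l + (z - e * t) • h) ⬝ᵥ (u - v) = 0 := by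
        intro u hu hfu
        have h1 := hg u hu v hvF
        have h2 : g ⬝ᵥ (u - v) = 0 := by rw [dotProduct_sub]; linarith
        rw [hge, add_dotProduct, smul_dotProduct, hfu, smul_zero, zero_add] at h2
        exact h2
      obtain ⟨e1, e2⟩ := two_zero hal hbl hap hbn (key a' haF hfa) (key b' hbF hfb)
      exact ⟨e, by rw [hge, e1, e2]; simp⟩
    · rw [dotProduct_sub] at hap; linarith
    · rw [dotProduct_sub] at hbn; linarith
  obtain ⟨s1, t1, hn1, a1, ha1, b1, hb1, hap1, hbn1, hfa1, hfb1⟩ :=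
    support_exists S l h (crossProduct l h) hlS hhS hupS hdnS
  obtain ⟨s2, t2, hn2, a2, ha2, b2, hb2, hap2, hbn2, hfa2, hfb2⟩ :=
    support_exists S l h (-crossProduct l h) hlS hhS hupS hdnS
  have B1 := build _ (Or.inl rfl) s1 t1 hn1 a1 ha1 b1 hb1 hap1 hbn1 hfa1 hfb1 _ rfl
  have B2 := build _ (Or.inr rfl) s2 t2 hn2 a2 ha2 b2 hb2 hap2 hbn2 hfa2 hfb2 _ rfl
  refine ⟨_, _, ?_, fun F hF => hF.elim (fun e => e ▸ B1) (fun e => e ▸ B2)⟩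
  intro heq
  have z2 : ∀ a ∈ S, (crossProduct l h - s1 • l + t1 • h) ⬝ᵥ a = 0 →
      (-crossProduct l h - s2 • l + t2 • h) ⬝ᵥ a = 0 := by
    intro a ha h0
    obtain ⟨a', ha', rfl⟩ := Finset.mem_image.1 ha
    have : a' ∈ V.filter (fun w => (crossProduct l h - s1 • l + t1 • h) ⬝ᵥ (w - v) = 0) :=
      Finset.mem_filter.2 ⟨Finset.mem_of_mem_erase ha', h0⟩
    rw [heq] at this
    exact (Finset.mem_filter.1 this).2
  have hsum : (crossProduct l h - s1 • l + t1 • h) + (-crossProduct l h - s2 • l + t2 • h)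
      = (-(s1 + s2)) • l + (t1 + t2) • h := by
    module
  obtain ⟨e1, e2⟩ := two_zero (x := -(s1 + s2)) (y := t1 + t2) (hlS a1 ha1) (hlS b1 hb1) hap1 hbn1
    (by rw [← hsum, add_dotProduct, hfa1, z2 a1 ha1 hfa1, add_zero])
    (by rw [← hsum, add_dotProduct, hfb1, z2 b1 hb1 hfb1, add_zero])
  rw [e1, e2, zero_smul, zero_smul, add_zero] at hsum
  have hflat := not_flat V hspan (crossProduct l h - s1 • l + t1 • h)
    ((crossProduct l h - s1 • l + t1 • h) ⬝ᵥ v) (by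
      intro w hw
      by_cases hwv : w = v
      · rw [hwv]
      · have hwS : w - v ∈ S := Finset.mem_image.2 ⟨w, Finset.mem_erase.2 ⟨hwv, hw⟩, rfl⟩
        have h1 := hn1 _ hwS
        have h2 := hn2 _ hwS
        have h3 := congrArg (fun z => z ⬝ᵥ (w - v)) hsum
        simp only [add_dotProduct _ (-crossProduct l h - s2 • l + t2 • h), zero_dotProduct] at h3
        have h4 : (crossProduct l h - s1 • l + t1 • h) ⬝ᵥ (w - v) = 0 := by linarith
        rw [dotProduct_sub] at h4
        linarith)
  have e := congrArg (fun z => z ⬝ᵥ crossProduct l h) hflat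
  simp only [add_dotProduct, sub_dotProduct, smul_dotProduct, dot_self_cross,
    dot_cross_self, zero_dotProduct, smul_zero, sub_zero, add_zero] at e
  exact hm (dotProduct_self_eq_zero.mp e)

lemma exists_generic (V : Finset Pt3) :
    ∃ h : Pt3, ∀ v ∈ V, ∀ w ∈ V, w ≠ v → h ⬝ᵥ w ≠ h ⬝ᵥ v := by
  obtain ⟨f, hf⟩ := Module.exists_dual_forall_apply_ne_zero (K := ℝ)
    (fun x : {x // x ∈ V.offDiag} => x.1.1 - x.1.2) (by
      rintro ⟨x, hx⟩
      rw [Finset.mem_offDiag] at hx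
      exact sub_ne_zero.2 hx.2.2)
  refine ⟨fun i => f (Pi.single i 1), fun v hv w hw hne => ?_⟩
  have : ∀ x : Pt3, (fun i => f (Pi.single i 1)) ⬝ᵥ x = f x := by
    intro x
    conv_rhs => rw [pi_eq_sum_univ' x]
    simp [dotProduct, mul_comm]
  rw [this, this, ← sub_ne_zero, ← map_sub]
  exact hf ⟨(w, v), by simp [hv, hw, hne]⟩

/-- Ordered pairs of distinct vertices lying in a common facet. -/
def bdPairs (V : Finset Pt3) : Finset (Pt3 × Pt3) :=
  V.offDiag.filter (fun x => ∃ F, IsFac V F ∧ x.1 ∈ F ∧ x.2 ∈ F)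

lemma mid_card (F : Finset Pt3) (h : Pt3 → ℝ) :
    6 * (F.filter (fun v => (∃ a ∈ F, h v < h a) ∧ (∃ b ∈ F, h b < h v))).card
      ≤ F.offDiag.card := by
  set M := F.filter (fun v => (∃ a ∈ F, h v < h a) ∧ (∃ b ∈ F, h b < h v)) with hM
  rcases M.eq_empty_or_nonempty with h0 | ⟨v, hv⟩
  · rw [h0]; simp
  have hne : F.Nonempty := ⟨v, (Finset.mem_filter.1 hv).1⟩
  obtain ⟨x, hx, hxm⟩ := Finset.exists_max_image F h hne
  obtain ⟨y, hy, hym⟩ := Finset.exists_min_image F h hne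
  have hxy : x ≠ y := by
    rintro rfl
    obtain ⟨_, ⟨a, ha, hva⟩, -⟩ := Finset.mem_filter.1 hv
    have h1 := hxm a ha
    have h2 := hym v (Finset.mem_filter.1 hv).1
    linarith
  have hsub : M ⊆ (F.erase x).erase y := by
    intro w hw
    obtain ⟨h1, ⟨a, ha, hwa⟩, b, hb, hwb⟩ := Finset.mem_filter.1 hw
    rw [Finset.mem_erase, Finset.mem_erase]
    refine ⟨?_, ?_, h1⟩
    · rintro rfl; have := hym b hb; linarith
    · rintro rfl; have := hxm a ha; linarith
  have hc := Finset.card_le_card hsub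
  rw [Finset.card_erase_of_mem (Finset.mem_erase.2 ⟨hxy.symm, hy⟩), Finset.card_erase_of_mem hx] at hc
  have hpos : 0 < M.card := Finset.card_pos.2 ⟨v, hv⟩
  rw [Finset.offDiag_card]
  obtain ⟨k, hk⟩ : ∃ k, F.card = k + 3 := ⟨F.card - 3, by omega⟩
  rw [hk] at hc ⊢
  have h1 : M.card ≤ k + 1 := by omega
  have h2 : 6 * (k + 1) + (k + 3) ≤ (k + 3) * (k + 3) := by
    rcases k with _ | k
    · norm_num
    · nlinarith
  omega

lemma bdPairs_card {V : Finset Pt3} (hspan : affineSpan ℝ (V : Set Pt3) = ⊤)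
    (hpos : ∀ v ∈ V, v ∉ convexHull ℝ ((V.erase v : Finset Pt3) : Set Pt3)) :
    6 * V.card ≤ (bdPairs V).card + 12 := by
  obtain ⟨h, hh⟩ := exists_generic V
  let 𝓕 := V.powerset.filter (IsFac V)
  have h𝓕 : ∀ F, F ∈ 𝓕 ↔ IsFac V F := by
    intro F
    simp only [𝓕, Finset.mem_filter, Finset.mem_powerset]
    exact ⟨fun h => h.2, fun h => ⟨h.1, h⟩⟩
  -- double count of pairs
  have c1 : ∑ F ∈ 𝓕, F.offDiag.card ≤ 2 * (bdPairs V).card := by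
    have e := Finset.sum_card_bipartiteAbove_eq_sum_card_bipartiteBelow
      (fun (F : Finset Pt3) (x : Pt3 × Pt3) => x.1 ∈ F ∧ x.2 ∈ F) (s := 𝓕) (t := bdPairs V)
    have e1 : ∀ F ∈ 𝓕, F.offDiag.card ≤ (Finset.bipartiteAbove
        (fun (F : Finset Pt3) (x : Pt3 × Pt3) => x.1 ∈ F ∧ x.2 ∈ F) (bdPairs V) F).card := by
      intro F hF
      apply Finset.card_le_card
      intro x hx
      rw [Finset.mem_offDiag] at hx
      have hf := (h𝓕 F).1 hF
      simp only [Finset.bipartiteAbove, bdPairs, Finset.mem_filter, Finset.mem_offDiag]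
      exact ⟨⟨⟨hf.1 hx.1, hf.1 hx.2.1, hx.2.2⟩, F, hf, hx.1, hx.2.1⟩, hx.1, hx.2.1⟩
    refine (Finset.sum_le_sum e1).trans ?_
    rw [e, mul_comm, ← smul_eq_mul]
    apply Finset.sum_le_card_nsmul
    intro x hx
    by_contra hlt
    push Not at hlt
    obtain ⟨F₁, h1, F₂, h2, F₃, h3, n12, n13, n23⟩ := Finset.two_lt_card.1 hlt
    simp only [Finset.bipartiteBelow, Finset.mem_filter, h𝓕] at h1 h2 h3
    have hxne : x.1 ≠ x.2 := (Finset.mem_offDiag.1 (Finset.mem_filter.1 hx).1).2.2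
    exact pair_le_two hxne h1.1 h2.1 h3.1 h1.2.1 h2.2.1 h3.2.1 h1.2.2 h2.2.2 h3.2.2 n12 n13 n23
  -- double count of intermediate vertices
  let Md : Finset Pt3 → Pt3 → Prop := fun F v =>
    v ∈ F ∧ (∃ a ∈ F, h ⬝ᵥ v < h ⬝ᵥ a) ∧ (∃ b ∈ F, h ⬝ᵥ b < h ⬝ᵥ v)
  have c2 : 6 * ∑ F ∈ 𝓕, (Finset.bipartiteAbove Md V F).card ≤ ∑ F ∈ 𝓕, F.offDiag.card := by
    rw [Finset.mul_sum]
    apply Finset.sum_le_sum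
    intro F hF
    refine le_trans ?_ (mid_card F (fun v => h ⬝ᵥ v))
    apply Nat.mul_le_mul_left
    apply Finset.card_le_card
    intro v hv
    simp only [Finset.bipartiteAbove, Finset.mem_filter, Md] at hv ⊢
    exact hv.2
  rw [Finset.sum_card_bipartiteAbove_eq_sum_card_bipartiteBelow] at c2
  have c3 : 2 * V.card ≤ ∑ v ∈ V, (Finset.bipartiteBelow Md 𝓕 v).card + 4 := by
    rcases V.eq_empty_or_nonempty with h0 | hne
    · rw [h0]; simp
    obtain ⟨x, hx, hxm⟩ := Finset.exists_max_image V (fun v => h ⬝ᵥ v) hne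
    obtain ⟨y, hy, hym⟩ := Finset.exists_min_image V (fun v => h ⬝ᵥ v) hne
    have hb : ((V.erase x).erase y).card * 2 ≤
        ∑ v ∈ (V.erase x).erase y, (Finset.bipartiteBelow Md 𝓕 v).card := by
      rw [← smul_eq_mul]
      apply Finset.card_nsmul_le_sum
      intro v hv
      rw [Finset.mem_erase, Finset.mem_erase] at hv
      obtain ⟨hvy, hvx, hvV⟩ := hv
      obtain ⟨F₁, F₂, hne, hF⟩ := two_facets hspan hvV (hpos v hvV) h
        (fun w hw hwv => hh v hvV w hw hwv)
        ⟨x, hx, lt_of_le_of_ne (hxm v hvV) (hh x hx v hvV hvx)⟩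
        ⟨y, hy, lt_of_le_of_ne (hym v hvV) (hh y hy v hvV hvy).symm⟩
      rw [← Finset.card_pair hne]
      apply Finset.card_le_card
      intro F hF'
      rw [Finset.mem_insert, Finset.mem_singleton] at hF'
      obtain ⟨g1, g2⟩ := hF F hF'
      simp only [Finset.bipartiteBelow, Finset.mem_filter, Md, h𝓕]
      exact ⟨g1, g2⟩
    have hb2 : ∑ v ∈ (V.erase x).erase y, (Finset.bipartiteBelow Md 𝓕 v).card ≤
        ∑ v ∈ V, (Finset.bipartiteBelow Md 𝓕 v).card :=
      Finset.sum_le_sum_of_subset ((Finset.erase_subset _ _).trans (Finset.erase_subset _ _))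
    have h1 := Finset.pred_card_le_card_erase (s := V.erase x) (a := y)
    have h2 := Finset.pred_card_le_card_erase (s := V) (a := x)
    omega
  omega

/-- Barycentric coordinates of a tetrahedron. -/
lemma exists_coords {σ : Finset Pt3} (hσ : IsTet σ) :
    ∃ L : Pt3 → (Pt3 →ᵃ[ℝ] ℝ), (∀ p ∈ σ, ∀ q ∈ σ, L p q = if p = q then 1 else 0) ∧
      convexHull ℝ (σ : Set Pt3) = {x | ∀ p ∈ σ, 0 ≤ L p x} ∧
      interior (convexHull ℝ (σ : Set Pt3)) = {x | ∀ p ∈ σ, 0 < L p x} := by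
  obtain ⟨hc, hi⟩ := hσ
  have hr : Set.range (fun p : (σ : Set Pt3) => (p : Pt3)) = (σ : Set Pt3) := by simp
  have htop : affineSpan ℝ (Set.range (fun p : (σ : Set Pt3) => (p : Pt3))) = ⊤ := by
    rw [hi.affineSpan_eq_top_iff_card_eq_finrank_add_one]
    simp [hc]
  let b : AffineBasis (σ : Set Pt3) ℝ Pt3 := ⟨fun p => p, hi, htop⟩
  have hrb : Set.range b = (σ : Set Pt3) := hr
  refine ⟨fun p => if hp : p ∈ σ then b.coord ⟨p, hp⟩ else 0, ?_, ?_, ?_⟩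
  · intro p hp q hq
    have := b.coord_apply ⟨p, hp⟩ ⟨q, hq⟩
    simp only [hp, dite_true]
    change (b.coord ⟨p, hp⟩) (b ⟨q, hq⟩) = _
    rw [this]
    simp
  · conv_lhs => rw [← hrb, b.convexHull_eq_nonneg_coord]
    ext x
    constructor
    · intro h p hp
      simpa [hp] using h ⟨p, hp⟩
    · rintro h ⟨p, hp⟩
      have := h p hp
      have hp' : p ∈ σ := hp
      simpa [hp'] using this
  · conv_lhs => rw [← hrb, b.interior_convexHull]
    ext x
    constructor
    · intro h p hp
      simpa [hp] using h ⟨p, hp⟩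
    · rintro h ⟨p, hp⟩
      have := h p hp
      have hp' : p ∈ σ := hp
      simpa [hp'] using this

lemma exists_base (V : Finset Pt3) (hspan : affineSpan ℝ (V : Set Pt3) = ⊤)
    (D : Finset (Finset Pt3)) (L : Finset Pt3 → Pt3 → (Pt3 →ᵃ[ℝ] ℝ))
    (hL : ∀ σ ∈ D, ∀ p ∈ σ, L σ p p = 1) :
    ∃ x ∈ interior (convexHull ℝ (V : Set Pt3)), ∀ σ ∈ D, ∀ p ∈ σ, L σ p x ≠ 0 := by
  by_contra hcon
  push Not at hcon
  have hne := interior_convexHull_nonempty_iff_affineSpan_eq_top.2 hspan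
  have hp := isOpen_interior.measure_pos (volume : Measure Pt3) hne
  have hsub : interior (convexHull ℝ (V : Set Pt3)) ⊆ ⋃ σ ∈ D, ⋃ p ∈ σ, {x | L σ p x = 0} := by
    intro x hx
    obtain ⟨σ, hσ, p, hpσ, h⟩ := hcon x hx
    simp only [Set.mem_iUnion]
    exact ⟨σ, hσ, p, hpσ, h⟩
  have hz : volume (⋃ σ ∈ D, ⋃ p ∈ σ, {x | L σ p x = 0}) = 0 := by
    have hD' := (measure_biUnion_null_iff (μ := (volume : Measure Pt3))
      (s := fun σ => ⋃ p ∈ σ, {x | L σ p x = 0}) D.countable_toSet).2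
    apply hD'
    intro σ hσ
    have := (measure_biUnion_null_iff (μ := (volume : Measure Pt3)) (s := fun p => {x | L σ p x = 0})
      σ.countable_toSet).2
    apply this
    intro p hpσ
    let A : AffineSubspace ℝ Pt3 := (affineSpan ℝ {(0 : ℝ)}).comap (L σ p)
    have hA : (A : Set Pt3) = {x | L σ p x = 0} := by
      ext x
      simp [A]
    change volume {x | L σ p x = 0} = 0
    rw [← hA]
    apply Measure.addHaar_affineSubspace
    intro htop
    have : p ∈ (A : Set Pt3) := by rw [htop]; trivial
    rw [hA] at this
    have h1 := hL σ hσ p hpσ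
    rw [Set.mem_ofPred_eq, h1] at this
    exact one_ne_zero this
  exact absurd (measure_mono_null hsub hz) hp.ne'

set_option maxRecDepth 100000 in
set_option maxHeartbeats 4000000 in
/-- The sign count for one tetrahedron. -/
lemma sign_count (σ : Finset Pt3) (hσ : σ.card = 4) (s : Pt3 → ℝ) (hs : ∀ p ∈ σ, s p ≠ 0) :
    4 + 2 * (σ.filter (fun v => ∀ j ∈ σ, j ≠ v → 0 < s j)).card ≤
      (σ.offDiag.filter (fun x => ∀ j ∈ σ, j ≠ x.1 → j ≠ x.2 → 0 < s j)).card +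
      (σ.offDiag.filter (fun x => ∀ j ∈ σ, j ≠ x.1 → j ≠ x.2 → s j < 0)).card := by
  obtain ⟨e⟩ : Nonempty (Fin 4 ≃ σ) := ⟨(Finset.equivFinOfCardEq hσ).symm⟩
  let i : Fin 4 ↪ Pt3 := ⟨fun k => (e k : Pt3), fun a b h => e.injective (Subtype.ext h)⟩
  have hmem : ∀ p, p ∈ σ ↔ ∃ k, i k = p := by
    intro p
    constructor
    · intro hp
      exact ⟨e.symm ⟨p, hp⟩, by change ((e (e.symm ⟨p, hp⟩) : σ) : Pt3) = p; rw [e.apply_symm_apply]⟩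
    · rintro ⟨k, rfl⟩
      exact (e k).2
  let t : Fin 4 → Bool := fun k => decide (0 < s (i k))
  have ht : ∀ k, 0 < s (i k) ↔ t k = true := by intro k; simp [t]
  have ht' : ∀ k, s (i k) < 0 ↔ t k = false := by
    intro k
    have := hs (i k) ((hmem _).2 ⟨k, rfl⟩)
    simp only [t, decide_eq_false_iff_not, not_lt]
    exact ⟨le_of_lt, fun h => lt_of_le_of_ne h this⟩
  have key : ∀ t : Fin 4 → Bool,
    4 + 2 * (Finset.univ.filter (fun v : Fin 4 => ∀ j, j ≠ v → t j = true)).card ≤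
      (Finset.univ.filter (fun x : Fin 4 × Fin 4 => x.1 ≠ x.2 ∧
        ∀ j, j ≠ x.1 → j ≠ x.2 → t j = true)).card +
      (Finset.univ.filter (fun x : Fin 4 × Fin 4 => x.1 ≠ x.2 ∧
        ∀ j, j ≠ x.1 → j ≠ x.2 → t j = false)).card := by
    decide
  have k1 : σ.filter (fun v => ∀ j ∈ σ, j ≠ v → 0 < s j) =
      (Finset.univ.filter (fun v : Fin 4 => ∀ j, j ≠ v → t j = true)).map i := by
    ext p
    simp only [Finset.mem_filter, Finset.mem_map, Finset.mem_univ, true_and, hmem]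
    constructor
    · rintro ⟨⟨k, rfl⟩, h⟩
      exact ⟨k, fun j hj => (ht j).1 (h _ ⟨j, rfl⟩ (fun h' => hj (i.injective h'))), rfl⟩
    · rintro ⟨k, h, rfl⟩
      refine ⟨⟨k, rfl⟩, ?_⟩
      rintro _ ⟨j, rfl⟩ hj
      exact (ht j).2 (h j (fun h' => hj (by rw [h'])))
  have k2 : σ.offDiag.filter (fun x => ∀ j ∈ σ, j ≠ x.1 → j ≠ x.2 → 0 < s j) =
      (Finset.univ.filter (fun x : Fin 4 × Fin 4 => x.1 ≠ x.2 ∧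
        ∀ j, j ≠ x.1 → j ≠ x.2 → t j = true)).map (i.prodMap i) := by
    ext ⟨p, q⟩
    simp only [Finset.mem_filter, Finset.mem_map, Finset.mem_univ, true_and, hmem,
      Finset.mem_offDiag, Prod.exists, Function.Embedding.coe_prodMap, Prod.map, Prod.mk.injEq]
    constructor
    · rintro ⟨⟨⟨k, rfl⟩, ⟨l, rfl⟩, hkl⟩, h⟩
      exact ⟨k, l, ⟨fun h' => hkl (by rw [h']), fun j hj hj' => (ht j).1 (h _ ⟨j, rfl⟩
        (fun h' => hj (i.injective h')) (fun h' => hj' (i.injective h')))⟩, rfl, rfl⟩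
    · rintro ⟨k, l, ⟨hkl, h⟩, rfl, rfl⟩
      refine ⟨⟨⟨k, rfl⟩, ⟨l, rfl⟩, fun h' => hkl (i.injective h')⟩, ?_⟩
      rintro _ ⟨j, rfl⟩ hj hj'
      exact (ht j).2 (h j (fun h' => hj (by rw [h'])) (fun h' => hj' (by rw [h'])))
  have k3 : σ.offDiag.filter (fun x => ∀ j ∈ σ, j ≠ x.1 → j ≠ x.2 → s j < 0) =
      (Finset.univ.filter (fun x : Fin 4 × Fin 4 => x.1 ≠ x.2 ∧
        ∀ j, j ≠ x.1 → j ≠ x.2 → t j = false)).map (i.prodMap i) := by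
    ext ⟨p, q⟩
    simp only [Finset.mem_filter, Finset.mem_map, Finset.mem_univ, true_and, hmem,
      Finset.mem_offDiag, Prod.exists, Function.Embedding.coe_prodMap, Prod.map, Prod.mk.injEq]
    constructor
    · rintro ⟨⟨⟨k, rfl⟩, ⟨l, rfl⟩, hkl⟩, h⟩
      exact ⟨k, l, ⟨fun h' => hkl (by rw [h']), fun j hj hj' => (ht' j).1 (h _ ⟨j, rfl⟩
        (fun h' => hj (i.injective h')) (fun h' => hj' (i.injective h')))⟩, rfl, rfl⟩
    · rintro ⟨k, l, ⟨hkl, h⟩, rfl, rfl⟩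
      refine ⟨⟨⟨k, rfl⟩, ⟨l, rfl⟩, fun h' => hkl (i.injective h')⟩, ?_⟩
      rintro _ ⟨j, rfl⟩ hj hj'
      exact (ht' j).2 (h j (fun h' => hj (by rw [h'])) (fun h' => hj' (by rw [h'])))
  rw [k1, k2, k3, Finset.card_map, Finset.card_map, Finset.card_map]
  convert key t

/-- Near the midpoint of an edge, moving towards (or away from) `x` enters the tetrahedron. -/
lemma edge_enter {σ : Finset Pt3} {L : Pt3 → (Pt3 →ᵃ[ℝ] ℝ)}
    (h1 : ∀ p ∈ σ, ∀ q ∈ σ, L p q = if p = q then 1 else 0)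
    (h3 : interior (convexHull ℝ (σ : Set Pt3)) = {x | ∀ p ∈ σ, 0 < L p x})
    {p q : Pt3} (hp : p ∈ σ) (hq : q ∈ σ) (hpq : p ≠ q) (x : Pt3) (s : ℝ)
    (hs : ∀ j ∈ σ, j ≠ p → j ≠ q → 0 < s * L j x) :
    ∀ᶠ ε in nhdsWithin (0 : ℝ) (Set.Ioi 0),
      AffineMap.lineMap (midpoint ℝ p q) x (s * ε) ∈ interior (convexHull ℝ (σ : Set Pt3)) := by
  rw [h3]
  simp only [Set.mem_ofPred_eq]
  rw [Filter.eventually_all_finset]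
  intro j hj
  have hval : ∀ ε : ℝ, L j (AffineMap.lineMap (midpoint ℝ p q) x (s * ε)) =
      (1 - s * ε) * L j (midpoint ℝ p q) + (s * ε) * L j x := by
    intro ε
    rw [AffineMap.apply_lineMap, AffineMap.lineMap_apply_ring]
  have hmid : L j (midpoint ℝ p q) = (L j p + L j q) / 2 := by
    rw [AffineMap.map_midpoint, midpoint_eq_smul_add]
    simp
    ring
  by_cases hjpq : j = p ∨ j = q
  · have hpos : 0 < L j (midpoint ℝ p q) := by
      rw [hmid, h1 j hj p hp, h1 j hj q hq]
      rcases hjpq with rfl | rfl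
      · simp [hpq]
      · simp [hpq.symm]
    have hcont : Continuous (fun ε : ℝ => (1 - s * ε) * L j (midpoint ℝ p q) + (s * ε) * L j x) := by
      fun_prop
    have : ∀ᶠ ε in nhds (0 : ℝ), 0 < (1 - s * ε) * L j (midpoint ℝ p q) + (s * ε) * L j x := by
      apply hcont.continuousAt.eventually_const_lt
      simpa using hpos
    filter_upwards [nhdsWithin_le_nhds this] with ε hε
    rw [hval]; exact hε
  · push Not at hjpq
    filter_upwards [self_mem_nhdsWithin] with ε hε
    rw [hval, hmid, h1 j hj p hp, h1 j hj q hq, if_neg hjpq.1, if_neg hjpq.2]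
    have := mul_pos (hs j hj hjpq.1 hjpq.2) (show (0 : ℝ) < ε from hε)
    linarith

/-- At each vertex `v`, some tetrahedron at `v` is entered by moving towards `x`. -/
lemma vertex_enter {V : Finset Pt3}
    (hpos : ∀ v ∈ V, v ∉ convexHull ℝ ((V.erase v : Finset Pt3) : Set Pt3))
    {D : Finset (Finset Pt3)} (hD : IsDissection V D)
    {L : Finset Pt3 → Pt3 → (Pt3 →ᵃ[ℝ] ℝ)}
    (h1 : ∀ σ ∈ D, ∀ p ∈ σ, ∀ q ∈ σ, L σ p q = if p = q then 1 else 0)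
    (h2 : ∀ σ ∈ D, convexHull ℝ (σ : Set Pt3) = {x | ∀ p ∈ σ, 0 ≤ L σ p x})
    {x : Pt3} (hx : x ∈ convexHull ℝ (V : Set Pt3)) (hx0 : ∀ σ ∈ D, ∀ p ∈ σ, L σ p x ≠ 0)
    {v : Pt3} (hv : v ∈ V) :
    ∃ σ ∈ D, v ∈ σ ∧ ∀ j ∈ σ, j ≠ v → 0 < L σ j x := by
  have hev : ∀ᶠ ε in nhdsWithin (0 : ℝ) (Set.Ioi 0), ∀ σ ∈ D, v ∉ convexHull ℝ (σ : Set Pt3) →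
      AffineMap.lineMap v x ε ∉ convexHull ℝ (σ : Set Pt3) := by
    rw [Filter.eventually_all_finset]
    intro σ hσ
    by_cases hvσ : v ∈ convexHull ℝ (σ : Set Pt3)
    · exact Filter.Eventually.of_forall (fun ε h => absurd hvσ h)
    have hcl : IsClosed (convexHull ℝ (σ : Set Pt3)) := σ.finite_toSet.isClosed_convexHull ℝ
    have hcont : Continuous (fun ε : ℝ => AffineMap.lineMap v x ε) := AffineMap.lineMap_continuous
    have : ∀ᶠ ε in nhds (0 : ℝ), AffineMap.lineMap v x ε ∈ (convexHull ℝ (σ : Set Pt3))ᶜ := by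
      apply hcont.continuousAt.eventually_mem
      apply hcl.isOpen_compl.mem_nhds
      simpa using hvσ
    filter_upwards [nhdsWithin_le_nhds this] with ε hε _
    exact hε
  have hle : ∀ᶠ ε in nhdsWithin (0 : ℝ) (Set.Ioi 0), ε ≤ 1 :=
    nhdsWithin_le_nhds (eventually_le_nhds one_pos)
  obtain ⟨ε, ⟨hε, hε1⟩, hε0⟩ := ((hev.and hle).and self_mem_nhdsWithin).exists
  have hε0' : 0 < ε := hε0
  have hmem : AffineMap.lineMap v x ε ∈ convexHull ℝ (V : Set Pt3) :=
    (convex_convexHull ℝ _).lineMap_mem (subset_convexHull ℝ _ hv) hx ⟨hε0'.le, hε1⟩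
  rw [← hD.2.2] at hmem
  simp only [Set.mem_iUnion] at hmem
  obtain ⟨σ, hσ, hy⟩ := hmem
  have hvc : v ∈ convexHull ℝ (σ : Set Pt3) := by
    by_contra h
    exact hε σ hσ h hy
  have hvσ : v ∈ σ := by
    by_contra h
    apply hpos v hv
    refine convexHull_mono ?_ hvc
    intro w hw
    rw [Finset.coe_erase]
    refine ⟨(hD.1 σ hσ).2 hw, ?_⟩
    rintro rfl
    exact h hw
  refine ⟨σ, hσ, hvσ, fun j hj hjv => ?_⟩
  rw [h2 σ hσ] at hy
  have hyj := hy j hj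
  rw [AffineMap.apply_lineMap, AffineMap.lineMap_apply_ring, h1 σ hσ j hj v hvσ, if_neg hjv,
    mul_zero, zero_add] at hyj
  exact lt_of_le_of_ne (nonneg_of_mul_nonneg_right hyj hε0') (hx0 σ hσ j hj).symm

/-- A nonzero functional bounded below on `V` is strictly above its bound in the interior. -/
lemma interior_lt {V : Finset Pt3} {f : Pt3} {c : ℝ} (hf : ∀ v ∈ V, c ≤ f ⬝ᵥ v) (hf0 : f ≠ 0)
    {x : Pt3} (hx : x ∈ interior (convexHull ℝ (V : Set Pt3))) : c < f ⬝ᵥ x := by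
  have hsub : convexHull ℝ (V : Set Pt3) ⊆ {y | c ≤ f ⬝ᵥ y} := by
    refine convexHull_min (fun v hv => hf v hv) ?_
    intro a ha b hb s t hs ht hst
    have ha : c ≤ f ⬝ᵥ a := ha
    have hb : c ≤ f ⬝ᵥ b := hb
    change c ≤ f ⬝ᵥ (s • a + t • b)
    rw [dotProduct_add, dotProduct_smul, dotProduct_smul, smul_eq_mul, smul_eq_mul]
    calc c = s * c + t * c := by rw [← add_mul, hst, one_mul]
      _ ≤ _ := add_le_add (mul_le_mul_of_nonneg_left ha hs) (mul_le_mul_of_nonneg_left hb ht)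
  have hcont : Continuous (fun ε : ℝ => x - ε • f) := by fun_prop
  have hev : ∀ᶠ ε in nhds (0 : ℝ), x - ε • f ∈ interior (convexHull ℝ (V : Set Pt3)) := by
    apply hcont.continuousAt.eventually_mem
    apply isOpen_interior.mem_nhds
    simpa using hx
  obtain ⟨ε, hε, hε0⟩ :=
    ((hev.filter_mono nhdsWithin_le_nhds).and (self_mem_nhdsWithin (s := Set.Ioi (0 : ℝ)))).exists
  have h := hsub (interior_subset hε)
  simp only [Set.mem_ofPred_eq, dotProduct_sub, dotProduct_smul, smul_eq_mul] at h
  have hff : 0 < f ⬝ᵥ f := by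
    have h0 : 0 ≤ f ⬝ᵥ f := Finset.sum_nonneg (fun i _ => mul_self_nonneg (f i))
    exact lt_of_le_of_ne h0 (fun h => hf0 (dotProduct_self_eq_zero.mp h.symm))
  have := mul_pos (show (0 : ℝ) < ε from hε0) hff
  linarith

lemma convexHull_ge {V : Finset Pt3} {f : Pt3} {c : ℝ} (hf : ∀ v ∈ V, c ≤ f ⬝ᵥ v) (hf0 : f ≠ 0)
    {p q : Pt3} (hp : f ⬝ᵥ p = c) (hq : f ⬝ᵥ q = c)
    {x : Pt3} (hx : x ∈ interior (convexHull ℝ (V : Set Pt3))) {ε : ℝ} (hε : 0 < ε)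
    (hy : AffineMap.lineMap (midpoint ℝ p q) x (-1 * ε) ∈ interior (convexHull ℝ (V : Set Pt3))) :
    False := by
  have h1 := interior_lt hf hf0 hx
  have h2 := interior_lt hf hf0 hy
  rw [AffineMap.lineMap_apply_module, midpoint_eq_smul_add] at h2
  simp only [dotProduct_add, dotProduct_smul, smul_eq_mul, hp, hq, invOf_eq_inv] at h2
  nlinarith [mul_pos hε (sub_pos.2 h1)]

/-- Every dissection of a convex 3-polytope with `n` vertices has
at most `(n - 2 choose 2)` tetrahedra. -/
theorem dissection_upper_bound
    (V : Finset Pt3) (n : ℕ) (hn : V.card = n)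
    -- V is the vertex set of a convex 3-polytope
    (hpos : ∀ v ∈ V, v ∉ convexHull ℝ ((V.erase v : Finset Pt3) : Set Pt3))
    (hspan : affineSpan ℝ (V : Set Pt3) = ⊤)
    (D : Finset (Finset Pt3)) (hD : IsDissection V D) :
    D.card ≤ (n - 2).choose 2 := by
  have hex : ∀ σ : Finset Pt3, ∃ L : Pt3 → (Pt3 →ᵃ[ℝ] ℝ), σ ∈ D →
      (∀ p ∈ σ, ∀ q ∈ σ, L p q = if p = q then 1 else 0) ∧
      convexHull ℝ (σ : Set Pt3) = {x | ∀ p ∈ σ, 0 ≤ L p x} ∧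
      interior (convexHull ℝ (σ : Set Pt3)) = {x | ∀ p ∈ σ, 0 < L p x} := by
    intro σ
    by_cases hσ : σ ∈ D
    · obtain ⟨L, hL⟩ := exists_coords (hD.1 σ hσ).1
      exact ⟨L, fun _ => hL⟩
    · exact ⟨0, fun h => absurd h hσ⟩
  choose L hL using hex
  obtain ⟨x, hx, hx0⟩ := exists_base V hspan D L (fun σ hσ p hp => by
    rw [(hL σ hσ).1 p hp p hp, if_pos rfl])
  have hsubV : ∀ σ ∈ D, σ ⊆ V := fun σ hσ => Finset.coe_subset.1 (hD.1 σ hσ).2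
  let Pv : Finset Pt3 → Pt3 → Prop := fun σ v => v ∈ σ ∧ ∀ j ∈ σ, j ≠ v → 0 < L σ j x
  let Pe : Finset Pt3 → Pt3 × Pt3 → Prop := fun σ y => y ∈ σ.offDiag ∧
    ∀ j ∈ σ, j ≠ y.1 → j ≠ y.2 → 0 < L σ j x
  let Ne : Finset Pt3 → Pt3 × Pt3 → Prop := fun σ y => y ∈ σ.offDiag ∧
    ∀ j ∈ σ, j ≠ y.1 → j ≠ y.2 → L σ j x < 0
  -- local counts
  have loc : ∑ σ ∈ D, (4 + 2 * (Finset.bipartiteAbove Pv V σ).card) ≤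
      ∑ σ ∈ D, ((Finset.bipartiteAbove Pe V.offDiag σ).card +
        (Finset.bipartiteAbove Ne V.offDiag σ).card) := by
    apply Finset.sum_le_sum
    intro σ hσ
    have hs := sign_count σ (hD.1 σ hσ).1.1 (fun j => L σ j x) (hx0 σ hσ)
    have a1 : (Finset.bipartiteAbove Pv V σ).card ≤
        (σ.filter (fun v => ∀ j ∈ σ, j ≠ v → 0 < L σ j x)).card := by
      apply Finset.card_le_card
      intro v hv
      simp only [Finset.bipartiteAbove, Finset.mem_filter, Pv] at hv ⊢
      exact hv.2
    have hoff : σ.offDiag ⊆ V.offDiag := Finset.offDiag_mono (hsubV σ hσ)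
    have a2 : (σ.offDiag.filter (fun y => ∀ j ∈ σ, j ≠ y.1 → j ≠ y.2 → 0 < L σ j x)).card ≤
        (Finset.bipartiteAbove Pe V.offDiag σ).card := by
      apply Finset.card_le_card
      intro v hv
      simp only [Finset.bipartiteAbove, Finset.mem_filter, Pe] at hv ⊢
      exact ⟨hoff hv.1, hv⟩
    have a3 : (σ.offDiag.filter (fun y => ∀ j ∈ σ, j ≠ y.1 → j ≠ y.2 → L σ j x < 0)).card ≤
        (Finset.bipartiteAbove Ne V.offDiag σ).card := by
      apply Finset.card_le_card
      intro v hv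
      simp only [Finset.bipartiteAbove, Finset.mem_filter, Ne] at hv ⊢
      exact ⟨hoff hv.1, hv⟩
    omega
  rw [Finset.sum_add_distrib, Finset.sum_add_distrib, ← Finset.mul_sum,
    Finset.sum_card_bipartiteAbove_eq_sum_card_bipartiteBelow,
    Finset.sum_card_bipartiteAbove_eq_sum_card_bipartiteBelow,
    Finset.sum_card_bipartiteAbove_eq_sum_card_bipartiteBelow, Finset.sum_const, smul_eq_mul] at loc
  -- vertices
  have cv : V.card * 1 ≤ ∑ v ∈ V, (Finset.bipartiteBelow Pv D v).card := by
    rw [← smul_eq_mul]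
    apply Finset.card_nsmul_le_sum
    intro v hv
    obtain ⟨σ, hσ, h⟩ := vertex_enter hpos hD (fun σ hσ => (hL σ hσ).1)
      (fun σ hσ => (hL σ hσ).2.1) (interior_subset hx) hx0 hv
    exact Finset.card_pos.2 ⟨σ, by simp only [Finset.bipartiteBelow, Finset.mem_filter, Pv]; exact ⟨hσ, h⟩⟩
  -- edges, towards x
  have ent : ∀ (s : ℝ) (y : Pt3 × Pt3) (σ : Finset Pt3), σ ∈ D → y ∈ σ.offDiag →
      (∀ j ∈ σ, j ≠ y.1 → j ≠ y.2 → 0 < s * L σ j x) →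
      ∀ᶠ ε in nhdsWithin (0 : ℝ) (Set.Ioi 0), AffineMap.lineMap (midpoint ℝ y.1 y.2) x (s * ε) ∈
        interior (convexHull ℝ (σ : Set Pt3)) := by
    intro s y σ hσ hy h
    rw [Finset.mem_offDiag] at hy
    exact edge_enter (hL σ hσ).1 (hL σ hσ).2.2 hy.1 hy.2.1 hy.2.2 x s h
  have uniq : ∀ (s : ℝ) (y : Pt3 × Pt3) (σ τ : Finset Pt3), σ ∈ D → τ ∈ D → y ∈ σ.offDiag →
      y ∈ τ.offDiag → (∀ j ∈ σ, j ≠ y.1 → j ≠ y.2 → 0 < s * L σ j x) →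
      (∀ j ∈ τ, j ≠ y.1 → j ≠ y.2 → 0 < s * L τ j x) → σ = τ := by
    intro s y σ τ hσ hτ hyσ hyτ h1 h2
    by_contra hne
    obtain ⟨ε, e1, e2⟩ := ((ent s y σ hσ hyσ h1).and (ent s y τ hτ hyτ h2)).exists
    have := hD.2.1 σ hσ τ hτ hne
    exact Set.eq_empty_iff_forall_notMem.1 this _ ⟨e1, e2⟩
  have ce : ∑ y ∈ V.offDiag, (Finset.bipartiteBelow Pe D y).card ≤ V.offDiag.card * 1 := by
    rw [← smul_eq_mul]
    apply Finset.sum_le_card_nsmul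
    intro y hy
    rw [Finset.card_le_one]
    intro σ hσ τ hτ
    simp only [Finset.bipartiteBelow, Finset.mem_filter, Pe] at hσ hτ
    exact uniq 1 y σ τ hσ.1 hτ.1 hσ.2.1 hτ.2.1 (by simpa using hσ.2.2) (by simpa using hτ.2.2)
  have cn : ∑ y ∈ V.offDiag, (Finset.bipartiteBelow Ne D y).card + (bdPairs V).card
      ≤ V.offDiag.card := by
    have hb : (bdPairs V) ⊆ V.offDiag := Finset.filter_subset _ _
    rw [← Finset.sum_sdiff hb]
    have z : ∑ y ∈ bdPairs V, (Finset.bipartiteBelow Ne D y).card = 0 := by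
      apply Finset.sum_eq_zero
      intro y hy
      rw [Finset.card_eq_zero, Finset.eq_empty_iff_forall_notMem]
      intro σ hσ
      simp only [Finset.bipartiteBelow, Finset.mem_filter, Ne] at hσ
      obtain ⟨-, F, ⟨hFV, f, c, g1, g2, g3, -⟩, hy1, hy2⟩ := Finset.mem_filter.1 hy
      obtain ⟨ε, e1, e2⟩ := ((ent (-1) y σ hσ.1 hσ.2.1 (by
        intro j hj h1 h2
        have := hσ.2.2 j hj h1 h2
        linarith)).and self_mem_nhdsWithin).exists
      refine convexHull_ge g1 g3 ((g2 _ (hFV hy1)).1 hy1) ((g2 _ (hFV hy2)).1 hy2) hx e2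
        (interior_mono (convexHull_mono (hD.1 σ hσ.1).2) e1)
    have z2 : ∑ y ∈ V.offDiag \ bdPairs V, (Finset.bipartiteBelow Ne D y).card ≤
        (V.offDiag \ bdPairs V).card * 1 := by
      rw [← smul_eq_mul]
      apply Finset.sum_le_card_nsmul
      intro y hy
      rw [Finset.card_le_one]
      intro σ hσ τ hτ
      simp only [Finset.bipartiteBelow, Finset.mem_filter, Ne] at hσ hτ
      exact uniq (-1) y σ τ hσ.1 hτ.1 hσ.2.1 hτ.2.1
        (by intro j hj h1 h2; have := hσ.2.2 j hj h1 h2; linarith)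
        (by intro j hj h1 h2; have := hτ.2.2 j hj h1 h2; linarith)
    have z3 := Finset.card_sdiff_add_card_eq_card hb
    omega
  have hbd := bdPairs_card hspan hpos
  rw [Finset.offDiag_card] at ce cn
  -- there are at least three vertices
  have hn4 : 3 ≤ V.card ∨ D.card = 0 := by
    rcases D.eq_empty_or_nonempty with h | ⟨σ, hσ⟩
    · right; simp [h]
    · left
      have := Finset.card_le_card (hsubV σ hσ)
      have := (hD.1 σ hσ).1.1
      omega
  rcases hn4 with h4 | h4
  · subst hn
    obtain ⟨k, hk⟩ : ∃ k, V.card = k + 3 := ⟨V.card - 3, by omega⟩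
    rw [hk] at ce cn cv hbd ⊢
    have e1 : k + 3 - 2 = k + 1 := by omega
    rw [e1, Nat.choose_two_right, Nat.le_div_iff_mul_le (by norm_num)]
    have e2 : (k + 3) * (k + 3) - (k + 3) = k * k + 5 * k + 6 := by
      have : (k + 3) * (k + 3) = k * k + 5 * k + 6 + (k + 3) := by ring
      omega
    have e3 : (k + 1) * (k + 1 - 1) = k * k + k := by simp; ring
    rw [e2] at ce cn
    rw [e3]
    omega
  · rw [h4]; exact Nat.zero_le _
end
end
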